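/- arXiv:1107.0101 — 6 statements merged into one kernel-verified Lean document; each statement's English description precedes it below -/
import Mathlib

section
/- Let ω ∈ (π/2, π) and let q satisfy 0 < q < (√2/π)(π − ω) and q < (1/√2)·sin ω. Let (a,f,g) ∈ 𝒞 be a minimizer of L over 𝒞. Then the constraint produces no Lagrange multiplier: (a,f,g) is a critical point of L with respect to all compactly supported C¹ variations of a, f, g, and a, f, g satisfy the dyon equations (4), (5), (6) on (0,∞). -/
open Real MeasureTheory Set Filter

noncomputable section

/-- `h` is continuous on `[0,∞)` and absolutely continuous on every compact
subinterval of `(0,∞)` (encoded via the fundamental theorem of calculus,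
with `deriv h` playing the role of the a.e. derivative `h'`). -/
def LocAC (h : ℝ → ℝ) : Prop :=
  ContinuousOn h (Set.Ici 0) ∧
  ∀ s t : ℝ, 0 < s → s ≤ t →
    IntervalIntegrable (deriv h) MeasureTheory.volume s t ∧
    h t - h s = ∫ r in s..t, deriv h r

/-- `h` is locally absolutely continuous on `(0,∞)`, with derivative `deriv h`. -/
def LocACIoi (h : ℝ → ℝ) : Prop :=
  ∀ s t : ℝ, 0 < s → s ≤ t →
    IntervalIntegrable (deriv h) MeasureTheory.volume s t ∧
    h t - h s = ∫ r in s..t, deriv h r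

/-- The density `𝓔₁`. -/
def calE1 (κ : ℝ) (a f : ℝ → ℝ) (r : ℝ) : ℝ :=
  2 * (2 * (deriv a r) ^ 2 + ((a r) ^ 2 - 1) ^ 2 / r ^ 2)
    + (1 / 2) * (r ^ 2 * (deriv f r) ^ 2 + 2 * (a r) ^ 2 * Real.sin (f r) ^ 2)
    + 2 * κ * (a r) ^ 2 * Real.sin (f r) ^ 2
        * (2 * (deriv f r) ^ 2 + (a r) ^ 2 * Real.sin (f r) ^ 2 / r ^ 2)

/-- The density `𝓔₂`. -/
def calE2 (a g : ℝ → ℝ) (r : ℝ) : ℝ :=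
  r ^ 2 * (deriv g r) ^ 2 + 2 * (a r) ^ 2 * (g r) ^ 2

/-- Finite energy: `E(a,f,g) = ∫₀^∞ (𝓔₁ + 𝓔₂) dr < ∞`. -/
def FiniteEnergy (κ : ℝ) (a f g : ℝ → ℝ) : Prop :=
  MeasureTheory.IntegrableOn (fun r => calE1 κ a f r + calE2 a g r) (Set.Ioi 0)

/-- The action `L(a,f,g) = ∫₀^∞ (𝓔₁ - 𝓔₂) dr`. -/
def actionL (κ : ℝ) (a f g : ℝ → ℝ) : ℝ :=
  ∫ r in Set.Ioi (0 : ℝ), (calE1 κ a f r - calE2 a g r)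

/-- The admissible class `𝒜`. -/
structure Admissible (κ ω q : ℝ) (a f g : ℝ → ℝ) : Prop where
  locAC_a : LocAC a
  locAC_f : LocAC f
  locAC_g : LocAC g
  a_zero : a 0 = 1
  f_zero : f 0 = 0
  a_infty : Filter.Tendsto a Filter.atTop (nhds 0)
  f_infty : Filter.Tendsto f Filter.atTop (nhds (Real.pi - ω))
  g_infty : Filter.Tendsto g Filter.atTop (nhds q)
  finite_energy : FiniteEnergy κ a f g

/-- The constrained class `𝒞`: members of `𝒜` such that
`∫₀^∞ (r² g' G' + 2 a² g G) dr = 0` for every admissible test function `G`. -/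
def Constrained (κ ω q : ℝ) (a f g : ℝ → ℝ) : Prop :=
  Admissible κ ω q a f g ∧
  ∀ G : ℝ → ℝ, LocACIoi G → Filter.Tendsto G Filter.atTop (nhds 0) →
    MeasureTheory.IntegrableOn
      (fun r => r ^ 2 * (deriv G r) ^ 2 + 2 * (a r) ^ 2 * (G r) ^ 2) (Set.Ioi 0) →
    MeasureTheory.IntegrableOn
      (fun r => r ^ 2 * deriv g r * deriv G r + 2 * (a r) ^ 2 * g r * G r) (Set.Ioi 0) ∧
    ∫ r in Set.Ioi (0 : ℝ), (r ^ 2 * deriv g r * deriv G r + 2 * (a r) ^ 2 * g r * G r) = 0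

/-- The dyon equations (4), (5), (6) on `(0,∞)`:
(4) `a'' = a(a²-1)/r² + (1/4) a sin²f + κ a sin²f (f')² + κ a³ sin⁴f / r² - a g²/2`;
(5) `8κ (a² sin²f f')' + (r² f')' = 2a² sin f cos f + 8κ a² sin f cos f (f')² + 8κ a⁴ sin³f cos f / r²`;
(6) `(r² g')' = 2 a² g`. -/
def DyonEqs (κ : ℝ) (a f g : ℝ → ℝ) : Prop :=
  ∀ r ∈ Set.Ioi (0 : ℝ),
    DifferentiableAt ℝ a r ∧ DifferentiableAt ℝ f r ∧ DifferentiableAt ℝ g r ∧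
    HasDerivAt (deriv a)
      (a r * ((a r) ^ 2 - 1) / r ^ 2 + (1 / 4) * a r * Real.sin (f r) ^ 2
        + κ * a r * Real.sin (f r) ^ 2 * (deriv f r) ^ 2
        + κ * (a r) ^ 3 * Real.sin (f r) ^ 4 / r ^ 2
        - a r * (g r) ^ 2 / 2) r ∧
    HasDerivAt
      (fun ρ => 8 * κ * ((a ρ) ^ 2 * Real.sin (f ρ) ^ 2 * deriv f ρ) + ρ ^ 2 * deriv f ρ)
      (2 * (a r) ^ 2 * Real.sin (f r) * Real.cos (f r)
        + 8 * κ * (a r) ^ 2 * Real.sin (f r) * Real.cos (f r) * (deriv f r) ^ 2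
        + 8 * κ * (a r) ^ 4 * Real.sin (f r) ^ 3 * Real.cos (f r) / r ^ 2) r ∧
    HasDerivAt (fun ρ => ρ ^ 2 * deriv g ρ) (2 * (a r) ^ 2 * g r) r

/-! ### Locally absolutely continuous functions on the half-line -/

lemma ae_restrict_Ioi_of_forall_Icc {p : ℝ → Prop}
    (h : ∀ s t : ℝ, 0 < s → s ≤ t → ∀ᵐ x, x ∈ Icc s t → p x) :
    ∀ᵐ x ∂volume.restrict (Ioi (0 : ℝ)), p x := by
  rw [ae_restrict_iff' measurableSet_Ioi]
  have H : ∀ᵐ x : ℝ, ∀ n : ℕ, x ∈ Icc (1 / ((n : ℝ) + 1)) (n + 1) → p x := by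
    refine ae_all_iff.2 fun n => h _ _ (by positivity) ?_
    rw [div_le_iff₀ (by positivity)]
    nlinarith [(Nat.cast_nonneg n : (0 : ℝ) ≤ n)]
  filter_upwards [H] with x hx hx0
  have hx0 : 0 < x := hx0
  obtain ⟨n, hn⟩ := exists_nat_gt (max x (1 / x))
  refine hx n ⟨?_, by linarith [le_max_left x (1 / x)]⟩
  have h1 : 1 / x < n := lt_of_le_of_lt (le_max_right _ _) hn
  rw [div_lt_iff₀ hx0] at h1
  rw [div_le_iff₀ (by positivity)]
  nlinarith

lemma LocACIoi.absolutelyContinuousOnInterval {h : ℝ → ℝ} (hh : LocACIoi h) {s t : ℝ}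
    (hs : 0 < s) (hst : s ≤ t) : AbsolutelyContinuousOnInterval h s t := by
  have h1 := (hh s t hs hst).1.absolutelyContinuousOnInterval_intervalIntegral
    (c := s) left_mem_uIcc
  have h2 : AbsolutelyContinuousOnInterval (fun _ : ℝ => h s) s t := by
    refine ContDiffOn.absolutelyContinuousOnInterval ?_
    exact contDiffOn_const
  refine (absolutelyContinuousOnInterval_iff _ _ _).2 fun ε hε => ?_
  obtain ⟨δ, hδ, H⟩ := (absolutelyContinuousOnInterval_iff _ _ _).1 (h1.add h2) ε hε
  refine ⟨δ, hδ, fun E hE hE' => ?_⟩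
  have := H E hE hE'
  refine lt_of_eq_of_lt (Finset.sum_congr rfl fun i hi => ?_) this
  have hm : ∀ x ∈ uIcc s t, h x = (∫ v in s..x, deriv h v) + h s := by
    intro x hx
    rw [uIcc_of_le hst] at hx
    linarith [(hh s x hs hx.1).2]
  have hi' := hE.1 i hi
  simp only [Pi.add_apply]
  rw [hm _ hi'.1, hm _ hi'.2]

lemma LocACIoi.of_absolutelyContinuousOnInterval {h : ℝ → ℝ}
    (hh : ∀ s t : ℝ, 0 < s → s ≤ t → AbsolutelyContinuousOnInterval h s t) : LocACIoi h :=
  fun s t hs hst => ⟨(hh s t hs hst).intervalIntegrable_deriv,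
    (hh s t hs hst).integral_deriv_eq_sub.symm⟩

lemma LocACIoi.ae_differentiableAt {h : ℝ → ℝ} (hh : LocACIoi h) :
    ∀ᵐ x ∂volume.restrict (Ioi (0 : ℝ)), DifferentiableAt ℝ h x := by
  refine ae_restrict_Ioi_of_forall_Icc fun s t hs hst => ?_
  have := (hh.absolutelyContinuousOnInterval hs hst).ae_differentiableAt
  rwa [uIcc_of_le hst] at this

lemma LocACIoi.continuousOn {h : ℝ → ℝ} (hh : LocACIoi h) : ContinuousOn h (Ioi 0) := by
  intro x hx
  have hx : 0 < x := hx
  have h1 := (hh.absolutelyContinuousOnInterval (half_pos hx)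
    (by linarith : x / 2 ≤ x + 1)).continuousOn
  rw [uIcc_of_le (by linarith)] at h1
  exact (h1.continuousAt (Icc_mem_nhds (by linarith) (by linarith))).continuousWithinAt

lemma LocACIoi.add {h k : ℝ → ℝ} (hh : LocACIoi h) (hk : LocACIoi k) :
    LocACIoi (fun r => h r + k r) :=
  .of_absolutelyContinuousOnInterval fun _ _ hs hst =>
    (hh.absolutelyContinuousOnInterval hs hst).add (hk.absolutelyContinuousOnInterval hs hst)

lemma LocACIoi.const_mul {h : ℝ → ℝ} (hh : LocACIoi h) (c : ℝ) :
    LocACIoi (fun r => c * h r) :=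
  .of_absolutelyContinuousOnInterval fun _ _ hs hst =>
    (hh.absolutelyContinuousOnInterval hs hst).const_mul c

lemma ContDiff.locACIoi {h : ℝ → ℝ} (hh : ContDiff ℝ 1 h) : LocACIoi h :=
  .of_absolutelyContinuousOnInterval fun _ _ _ _ =>
    hh.contDiffOn.absolutelyContinuousOnInterval

lemma LocACIoi.congr {h k : ℝ → ℝ} (hh : LocACIoi h) (hk : EqOn k h (Ioi 0)) : LocACIoi k := by
  have hd : EqOn (deriv k) (deriv h) (Ioi 0) := fun x hx =>
    (hk.eventuallyEq_of_mem (Ioi_mem_nhds hx)).deriv_eq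
  intro s t hs hst
  have hsub : uIoc s t ⊆ Ioi 0 := fun x hx => by
    rw [uIoc_of_le hst] at hx; exact hs.trans hx.1
  refine ⟨(hh s t hs hst).1.congr (hd.symm.mono hsub), ?_⟩
  rw [hk hs, hk (mem_Ioi.2 (hs.trans_le hst)), (hh s t hs hst).2]
  refine intervalIntegral.integral_congr_ae (ae_of_all _ fun x hx => (hd (hsub hx)).symm)

lemma LocAC.locACIoi {h : ℝ → ℝ} (hh : LocAC h) : LocACIoi h := hh.2

lemma ae_hasDerivAt_of_sub_eq_integral {h φ : ℝ → ℝ}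
    (H : ∀ s t : ℝ, 0 < s → s ≤ t →
      IntervalIntegrable φ volume s t ∧ h t - h s = ∫ r in s..t, φ r) :
    ∀ᵐ x ∂volume.restrict (Ioi (0 : ℝ)), HasDerivAt h (φ x) x := by
  refine ae_restrict_Ioi_of_forall_Icc fun s t hs hst => ?_
  have h1 := (H (s / 2) (t + 1) (by linarith) (by linarith)).1.ae_hasDerivAt_integral
  rw [uIcc_of_le (by linarith)] at h1
  filter_upwards [h1] with x hx hxst
  have h2 := (hx ⟨by linarith [hxst.1], by linarith [hxst.2]⟩ (s / 2)
    ⟨le_rfl, by linarith⟩).add_const (h (s / 2))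
  refine h2.congr_of_eventuallyEq ?_
  filter_upwards [Icc_mem_nhds (show s / 2 < x by linarith [hxst.1])
    (show x < x + 1 by linarith)] with y hy
  linarith [(H (s / 2) y (by linarith) hy.1).2]

lemma LocACIoi.of_sub_eq_integral {h φ : ℝ → ℝ}
    (H : ∀ s t : ℝ, 0 < s → s ≤ t →
      IntervalIntegrable φ volume s t ∧ h t - h s = ∫ r in s..t, φ r) : LocACIoi h := by
  have h1 : ∀ᵐ x ∂volume.restrict (Ioi (0 : ℝ)), φ x = deriv h x :=
    (ae_hasDerivAt_of_sub_eq_integral H).mono fun x hx => hx.deriv.symm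
  intro s t hs hst
  have hsub : uIoc s t ⊆ Ioi 0 := fun x hx => by
    rw [uIoc_of_le hst] at hx; exact hs.trans hx.1
  have h2 : ∀ᵐ x ∂volume.restrict (uIoc s t), φ x = deriv h x :=
    ae_restrict_of_ae_restrict_of_subset hsub h1
  refine ⟨(H s t hs hst).1.congr_ae h2, ?_⟩
  rw [(H s t hs hst).2]
  exact intervalIntegral.integral_congr_ae_restrict h2

/-- A locally absolutely continuous function is differentiable with derivative `φ` as soon as its
derivative is a.e. equal to the continuous function `φ`. -/
lemma LocACIoi.hasDerivAt_of_ae_eq {h φ : ℝ → ℝ} (hh : LocACIoi h)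
    (hφ : ContinuousOn φ (Ioi 0))
    (hd : ∀ᵐ x ∂volume.restrict (Ioi (0 : ℝ)), deriv h x = φ x) {x : ℝ} (hx : 0 < x) :
    HasDerivAt h (φ x) x := by
  have hs : 0 < x / 2 := half_pos hx
  have hφx : ContinuousAt φ x := hφ.continuousAt (Ioi_mem_nhds hx)
  have hsub : ∀ y, x / 2 ≤ y → uIoc (x / 2) y ⊆ Ioi 0 := fun y hy z hz => by
    rw [uIoc_of_le hy] at hz; exact hs.trans hz.1
  have hint : IntervalIntegrable φ volume (x / 2) x :=
    ((hh (x / 2) x hs (by linarith)).1).congr_ae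
      (ae_restrict_of_ae_restrict_of_subset (hsub x (by linarith)) hd)
  have h1 := (intervalIntegral.integral_hasDerivAt_right hint
    (hφ.stronglyMeasurableAtFilter isOpen_Ioi x hx) hφx).add_const (h (x / 2))
  refine h1.congr_of_eventuallyEq ?_
  filter_upwards [Ioi_mem_nhds (show x / 2 < x by linarith)] with y hy
  have hy : x / 2 ≤ y := le_of_lt hy
  rw [← intervalIntegral.integral_congr_ae_restrict
    (ae_restrict_of_ae_restrict_of_subset (hsub y hy) hd), ← (hh (x / 2) y hs hy).2]
  ring

/-! ### The lemma of du Bois-Reymond on the half-line -/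

lemma exists_Icc_of_tsupport_subset_Ioi {η : ℝ → ℝ} (hc : HasCompactSupport η)
    (hs : tsupport η ⊆ Ioi 0) :
    ∃ s t : ℝ, 0 < s ∧ s ≤ 1 ∧ 1 ≤ t ∧ tsupport η ⊆ Icc s t := by
  rcases (tsupport η).eq_empty_or_nonempty with he | hne
  · exact ⟨1, 1, one_pos, le_rfl, le_rfl, by simp [he]⟩
  · have hK : IsCompact (tsupport η) := hc
    refine ⟨min (sInf (tsupport η)) 1, max (sSup (tsupport η)) 1,
      lt_min (hs (hK.sInf_mem hne)) one_pos, min_le_right _ _, le_max_right _ _, fun x hx =>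
      ⟨(min_le_left _ _).trans (csInf_le hK.bddBelow hx),
        (le_csSup hK.bddAbove hx).trans (le_max_left _ _)⟩⟩

lemma eq_zero_of_notMem_of_tsupport_subset {η : ℝ → ℝ} {S : Set ℝ} (hs : tsupport η ⊆ S) {x : ℝ}
    (hx : x ∉ S) : η x = 0 :=
  image_eq_zero_of_notMem_tsupport fun h => hx (hs h)

lemma deriv_eq_zero_of_notMem_of_tsupport_subset {η : ℝ → ℝ} {S : Set ℝ} (hs : tsupport η ⊆ S)
    {x : ℝ} (hx : x ∉ S) : deriv η x = 0 := by
  by_contra h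
  exact hx (hs (support_deriv_subset h))

lemma MeasureTheory.LocallyIntegrableOn.intervalIntegrable_of_pos {Q : ℝ → ℝ}
    (hQ : LocallyIntegrableOn Q (Ioi 0)) {s t : ℝ} (hs : 0 < s) (ht : 0 < t) :
    IntervalIntegrable Q volume s t := by
  have : uIcc s t ⊆ Ioi 0 := fun x hx => lt_of_lt_of_le (lt_min hs ht) hx.1
  exact intervalIntegrable_iff.2
    ((hQ.integrableOn_compact_subset this isCompact_uIcc).mono_set uIoc_subset_uIcc)

lemma MeasureTheory.LocallyIntegrableOn.integrableOn_Icc_of_pos {Q : ℝ → ℝ}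
    (hQ : LocallyIntegrableOn Q (Ioi 0)) {s t : ℝ} (hs : 0 < s) : IntegrableOn Q (Icc s t) :=
  hQ.integrableOn_compact_subset (fun _ hx => lt_of_lt_of_le hs hx.1) isCompact_Icc

lemma locallyIntegrableOn_Ioi_of_Icc {Q : ℝ → ℝ}
    (h : ∀ s t : ℝ, 0 < s → s ≤ t → IntegrableOn Q (Icc s t)) :
    LocallyIntegrableOn Q (Ioi 0) := by
  refine (locallyIntegrableOn_iff isOpen_Ioi.isLocallyClosed).2 fun K hK hKc => ?_
  rcases K.eq_empty_or_nonempty with rfl | hne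
  · simp
  exact (h (sInf K) (sSup K) (hK (hKc.sInf_mem hne))
    (csInf_le_csSup hne hKc.bddBelow hKc.bddAbove)).mono_set fun x hx =>
    ⟨csInf_le hKc.bddBelow hx, le_csSup hKc.bddAbove hx⟩

lemma setIntegral_Ioi_eq_intervalIntegral {F : ℝ → ℝ} {s t : ℝ} (hs : 0 < s) (hst : s ≤ t)
    (hF : ∀ x, x ∉ Icc s t → F x = 0) : ∫ r in Ioi 0, F r = ∫ r in s..t, F r := by
  rw [intervalIntegral.integral_of_le hst, ← integral_Icc_eq_integral_Ioc]
  exact setIntegral_eq_of_subset_of_forall_sdiff_eq_zero measurableSet_Ioi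
    (fun x hx => lt_of_lt_of_le hs hx.1) fun x hx => hF x hx.2

lemma integral_primitive_mul_deriv {Q η : ℝ → ℝ} (hQ : LocallyIntegrableOn Q (Ioi 0))
    (hη : ContDiff ℝ 1 η) (hc : HasCompactSupport η) (hs : tsupport η ⊆ Ioi 0) :
    ∫ r in Ioi 0, (∫ x in (1 : ℝ)..r, Q x) * deriv η r = - ∫ r in Ioi 0, Q r * η r := by
  obtain ⟨s, t, hs0, hs1, ht1, hst⟩ := exists_Icc_of_tsupport_subset_Ioi hc hs
  have hsub : tsupport η ⊆ Icc (s / 2) (t + 1) :=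
    hst.trans (Icc_subset_Icc (by linarith) (by linarith))
  have hle : s / 2 ≤ t + 1 := by linarith
  have hQi := hQ.intervalIntegrable_of_pos (half_pos hs0) (by linarith : 0 < t + 1)
  have hR := hQi.absolutelyContinuousOnInterval_intervalIntegral (c := 1)
    (by rw [uIcc_of_le hle]; constructor <;> linarith)
  have hηac : AbsolutelyContinuousOnInterval η (s / 2) (t + 1) :=
    hη.contDiffOn.absolutelyContinuousOnInterval
  rw [setIntegral_Ioi_eq_intervalIntegral (half_pos hs0) hle fun x hx => by
      rw [deriv_eq_zero_of_notMem_of_tsupport_subset hsub hx, mul_zero],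
    setIntegral_Ioi_eq_intervalIntegral (half_pos hs0) hle fun x hx => by
      rw [eq_zero_of_notMem_of_tsupport_subset hsub hx, mul_zero],
    hR.integral_mul_deriv_eq_deriv_mul hηac,
    eq_zero_of_notMem_of_tsupport_subset hst (x := t + 1) (by simp),
    eq_zero_of_notMem_of_tsupport_subset hst (x := s / 2) (by simp; intro; linarith)]
  simp only [mul_zero, sub_zero, zero_sub, neg_inj]
  refine intervalIntegral.integral_congr_ae ?_
  filter_upwards [hQi.ae_hasDerivAt_integral] with x hx hxm
  rw [(hx (uIoc_subset_uIcc hxm) 1 (by rw [uIcc_of_le hle]; constructor <;> linarith)).deriv]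

lemma integrableOn_mul_of_tsupport_subset {F η : ℝ → ℝ} (hF : LocallyIntegrableOn F (Ioi 0))
    (hη : Continuous η) (hc : HasCompactSupport η) (hs : tsupport η ⊆ Ioi 0) :
    IntegrableOn (fun r => F r * η r) (Ioi 0) := by
  have h1 : IntegrableOn (fun r => F r * η r) (tsupport η) :=
    (hF.integrableOn_compact_subset hs hc).mul_continuousOn hη.continuousOn hc
  refine (h1.integrable_of_forall_notMem_eq_zero fun x hx => ?_).integrableOn
  rw [image_eq_zero_of_notMem_tsupport hx, mul_zero]

lemma exists_primitive_of_integral_eq_zero {χ : ℝ → ℝ} (hχ : Continuous χ)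
    (hc : HasCompactSupport χ) (hs : tsupport χ ⊆ Ioi 0) (h0 : ∫ r in Ioi 0, χ r = 0) :
    ∃ η : ℝ → ℝ, ContDiff ℝ 1 η ∧ HasCompactSupport η ∧ tsupport η ⊆ Ioi 0 ∧ deriv η = χ := by
  obtain ⟨s, t, hs0, hs1, ht1, hst⟩ := exists_Icc_of_tsupport_subset_Ioi hc hs
  have hd : ∀ x, HasDerivAt (fun r => ∫ y in s..r, χ y) (χ x) x := fun x =>
    intervalIntegral.integral_hasDerivAt_right (hχ.intervalIntegrable _ _)
      hχ.stronglyMeasurable.stronglyMeasurableAtFilter hχ.continuousAt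
  have hder : deriv (fun r => ∫ y in s..r, χ y) = χ := funext fun x => (hd x).deriv
  have hzero : ∀ x, x ∉ Icc s t → ∫ y in s..x, χ y = 0 := by
    intro x hx
    rcases lt_or_ge x s with h | h
    · rw [intervalIntegral.integral_symm, neg_eq_zero, intervalIntegral.integral_of_le h.le,
        integral_Ioc_eq_integral_Ioo]
      refine setIntegral_eq_zero_of_forall_eq_zero fun y hy => ?_
      exact eq_zero_of_notMem_of_tsupport_subset hst fun h' => not_lt.2 h'.1 hy.2
    · rw [← h0, setIntegral_Ioi_eq_intervalIntegral hs0 h]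
      intro y hy
      refine eq_zero_of_notMem_of_tsupport_subset hst fun h' => hy ⟨h'.1, h'.2.trans ?_⟩
      by_contra hxt
      exact hx ⟨h, by linarith⟩
  have hsupp : tsupport (fun r => ∫ y in s..r, χ y) ⊆ Icc s t :=
    closure_minimal (fun x hx => by_contra fun h => hx (hzero x h)) isClosed_Icc
  refine ⟨_, contDiff_one_iff_deriv.2 ⟨fun x => (hd x).differentiableAt, by rwa [hder]⟩,
    HasCompactSupport.of_support_subset_isCompact isCompact_Icc
      ((subset_tsupport _).trans hsupp), hsupp.trans fun x hx => hs0.trans_le hx.1, hder⟩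

lemma ae_eq_const_of_integral_mul_deriv_eq_zero {F : ℝ → ℝ} (hF : LocallyIntegrableOn F (Ioi 0))
    (h : ∀ η : ℝ → ℝ, ContDiff ℝ 1 η → HasCompactSupport η → tsupport η ⊆ Ioi 0 →
      ∫ r in Ioi 0, F r * deriv η r = 0) :
    ∃ c, ∀ᵐ r ∂volume.restrict (Ioi 0), F r = c := by
  let b : ContDiffBump (2 : ℝ) := ⟨1 / 2, 1, by norm_num, by norm_num⟩
  let θ : ℝ → ℝ := b.normed volume
  have hθ : ContDiff ℝ 1 θ := b.contDiff_normed
  have hθc : HasCompactSupport θ := b.hasCompactSupport_normed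
  have hθs : tsupport θ ⊆ Ioi 0 := by
    rw [b.tsupport_normed_eq, Real.closedBall_eq_Icc]
    intro x hx
    have : (2 : ℝ) - 1 ≤ x := hx.1
    show 0 < x
    linarith
  have hθ1 : ∫ r in Ioi 0, θ r = 1 := by
    rw [setIntegral_eq_integral_of_forall_compl_eq_zero fun x hx =>
      eq_zero_of_notMem_of_tsupport_subset hθs hx]
    exact b.integral_normed
  refine ⟨∫ r in Ioi 0, F r * θ r, ?_⟩
  rw [ae_restrict_iff' measurableSet_Ioi]
  set c := ∫ r in Ioi 0, F r * θ r with hcdef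
  have key := IsOpen.ae_eq_zero_of_integral_contDiff_smul_eq_zero (μ := volume) (U := Ioi (0 : ℝ))
    isOpen_Ioi (f := fun r => F r - c)
    (hF.sub ((locallyIntegrable_const c).locallyIntegrableOn _)) ?_
  · filter_upwards [key] with x hx hx0
    linarith [hx hx0]
  intro ψ hψ hψc hψs
  have hψ1 : ContDiff ℝ 1 ψ := hψ.of_le (by exact_mod_cast le_top)
  set m := ∫ r in Ioi 0, ψ r with hm
  have hψi : IntegrableOn ψ (Ioi 0) :=
    (hψ.continuous.integrable_of_hasCompactSupport hψc).integrableOn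
  have hθi : IntegrableOn θ (Ioi 0) :=
    (hθ.continuous.integrable_of_hasCompactSupport hθc).integrableOn
  have hFψ := integrableOn_mul_of_tsupport_subset hF hψ.continuous hψc hψs
  have hFθ := integrableOn_mul_of_tsupport_subset hF hθ.continuous hθc hθs
  obtain ⟨η, hη, hηc, hηs, hηd⟩ := exists_primitive_of_integral_eq_zero
    (χ := fun r => ψ r - m * θ r) (hψ.continuous.sub (continuous_const.mul hθ.continuous))
    (hψc.sub hθc.mul_left) ((tsupport_sub _ _).trans (union_subset hψs
      ((tsupport_mul_subset_right).trans hθs)))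
    (by rw [integral_sub hψi (hθi.const_mul m), integral_const_mul, hθ1]; simp [hm])
  have h1 := h η hη hηc hηs
  rw [hηd] at h1
  have h2 : ∫ r in Ioi 0, F r * (ψ r - m * θ r) = (∫ r in Ioi 0, F r * ψ r) - m * c := by
    rw [hcdef, ← integral_const_mul, ← integral_sub hFψ (hFθ.const_mul m)]
    exact integral_congr_ae (ae_of_all _ fun r => by simp only []; ring)
  rw [← setIntegral_eq_integral_of_forall_compl_eq_zero (s := Ioi (0 : ℝ)) fun x hx => by
      rw [eq_zero_of_notMem_of_tsupport_subset hψs hx, zero_smul]]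
  have h3 : ∫ r in Ioi 0, ψ r • (F r - c) = (∫ r in Ioi 0, F r * ψ r) - m * c := by
    rw [hm, mul_comm, ← integral_const_mul, ← integral_sub hFψ (hψi.const_mul c)]
    exact integral_congr_ae (ae_of_all _ fun r => by simp only [smul_eq_mul]; ring)
  rw [h3, ← h2, h1]

lemma MeasureTheory.LocallyIntegrableOn.continuousOn_primitive {Q : ℝ → ℝ}
    (hQ : LocallyIntegrableOn Q (Ioi 0)) :
    ContinuousOn (fun r => ∫ x in (1 : ℝ)..r, Q x) (Ioi 0) := by
  intro x hx
  have hx : 0 < x := hx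
  have hmin : 0 < min 1 x := lt_min one_pos hx
  have h1 := ((hQ.intervalIntegrable_of_pos (half_pos hmin)
    (by positivity : 0 < max 1 x + 1)).absolutelyContinuousOnInterval_intervalIntegral
      (c := 1) ?_).continuousOn
  · rw [uIcc_of_le] at h1
    · refine (h1.continuousAt (Icc_mem_nhds ?_ ?_)).continuousWithinAt
      · linarith [min_le_right 1 x]
      · linarith [le_max_right 1 x]
    · linarith [min_le_right 1 x, le_max_right 1 x]
  · rw [uIcc_of_le (by linarith [min_le_right 1 x, le_max_right 1 x])]
    constructor
    · linarith [min_le_left 1 x]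
    · linarith [le_max_left 1 x]

lemma hasDerivAt_primitive_of_continuousOn {Q : ℝ → ℝ} (hQ : ContinuousOn Q (Ioi 0)) (c : ℝ)
    {r : ℝ} (hr : 0 < r) : HasDerivAt (fun r => c + ∫ x in (1 : ℝ)..r, Q x) (Q r) r :=
  (intervalIntegral.integral_hasDerivAt_right
    ((hQ.locallyIntegrableOn (μ := volume) measurableSet_Ioi).intervalIntegrable_of_pos one_pos hr)
    (hQ.stronglyMeasurableAtFilter isOpen_Ioi r hr)
    (hQ.continuousAt (Ioi_mem_nhds hr))).const_add c

lemma exists_ae_eq_add_primitive {P Q : ℝ → ℝ} (hP : LocallyIntegrableOn P (Ioi 0))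
    (hQ : LocallyIntegrableOn Q (Ioi 0))
    (h : ∀ η : ℝ → ℝ, ContDiff ℝ 1 η → HasCompactSupport η → tsupport η ⊆ Ioi 0 →
      ∫ r in Ioi 0, (P r * deriv η r + Q r * η r) = 0) :
    ∃ c, ∀ᵐ r ∂volume.restrict (Ioi 0), P r = c + ∫ x in (1 : ℝ)..r, Q x := by
  have hRi := hQ.continuousOn_primitive.locallyIntegrableOn (μ := volume) measurableSet_Ioi
  suffices H : ∀ η : ℝ → ℝ, ContDiff ℝ 1 η → HasCompactSupport η → tsupport η ⊆ Ioi 0 →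
      ∫ r in Ioi 0, (P r - ∫ x in (1 : ℝ)..r, Q x) * deriv η r = 0 by
    obtain ⟨c, hc⟩ := ae_eq_const_of_integral_mul_deriv_eq_zero (hP.sub hRi) H
    exact ⟨c, hc.mono fun x hx => by simp only [Pi.sub_apply] at hx; linarith⟩
  intro η hη hηc hηs
  have hdc : Continuous (deriv η) := hη.continuous_deriv le_rfl
  have hds : tsupport (deriv η) ⊆ Ioi 0 :=
    (closure_minimal support_deriv_subset (isClosed_tsupport _)).trans hηs
  have h1 := integrableOn_mul_of_tsupport_subset hP hdc hηc.deriv hds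
  have h2 := integrableOn_mul_of_tsupport_subset hRi hdc hηc.deriv hds
  have h3 := integrableOn_mul_of_tsupport_subset hQ hη.continuous hηc hηs
  have h4 := h η hη hηc hηs
  rw [integral_add h1 h3] at h4
  have h5 := integral_primitive_mul_deriv hQ hη hηc hηs
  simp only [sub_mul]
  rw [integral_sub h1 h2, h5]
  linarith

/-! ### The first variation of the action -/

/-- Test functions: `C¹` with compact support in `(0,∞)`. -/
def IsTest (η : ℝ → ℝ) : Prop :=
  ContDiff ℝ 1 η ∧ HasCompactSupport η ∧ tsupport η ⊆ Ioi 0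

lemma isTest_zero : IsTest (fun _ => 0) :=
  ⟨contDiff_const, HasCompactSupport.zero, by simp [tsupport]⟩

lemma IsTest.continuous_deriv {η : ℝ → ℝ} (h : IsTest η) : Continuous (deriv η) :=
  h.1.continuous_deriv le_rfl

/-- The integrand of the action as a function of the values and derivatives of the fields. -/
def lagr (κ r A F G X Y Z : ℝ) : ℝ :=
  (2 * (2 * X ^ 2 + (A ^ 2 - 1) ^ 2 / r ^ 2)
    + (1 / 2) * (r ^ 2 * Y ^ 2 + 2 * A ^ 2 * Real.sin F ^ 2)
    + 2 * κ * A ^ 2 * Real.sin F ^ 2 * (2 * Y ^ 2 + A ^ 2 * Real.sin F ^ 2 / r ^ 2))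
    - (r ^ 2 * Z ^ 2 + 2 * A ^ 2 * G ^ 2)

lemma calE1_sub_calE2 (κ : ℝ) (a f g : ℝ → ℝ) (r : ℝ) :
    calE1 κ a f r - calE2 a g r =
      lagr κ r (a r) (f r) (g r) (deriv a r) (deriv f r) (deriv g r) := rfl

/-- The derivative of `lagr` in the direction `(dA, dF, dG, dX, dY, dZ)`. -/
def dlagr (κ r A F G X Y Z dA dF dG dX dY dZ : ℝ) : ℝ :=
  (8 * (A ^ 2 - 1) * A * dA / r ^ 2 + 2 * A * dA * Real.sin F ^ 2
      + 2 * A ^ 2 * Real.sin F * Real.cos F * dF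
      + 8 * κ * (A ^ 3 * dA * Real.sin F ^ 4 + A ^ 4 * Real.sin F ^ 3 * Real.cos F * dF) / r ^ 2
      - 4 * A * dA * G ^ 2 - 4 * A ^ 2 * G * dG)
    + 8 * dX * X + (r ^ 2 * dY + 8 * κ * A ^ 2 * Real.sin F ^ 2 * dY) * Y
    - 2 * r ^ 2 * dZ * Z
    + 8 * κ * (A * dA * Real.sin F ^ 2 + A ^ 2 * Real.sin F * Real.cos F * dF) * Y ^ 2

lemma dlagr_zero (κ r A F G X Y Z : ℝ) : dlagr κ r A F G X Y Z 0 0 0 0 0 0 = 0 := by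
  simp [dlagr]

lemma hasDerivAt_lagr (κ r A F G X Y Z dA dF dG dX dY dZ t : ℝ) :
    HasDerivAt (fun t => lagr κ r (A + t * dA) (F + t * dF) (G + t * dG)
        (X + t * dX) (Y + t * dY) (Z + t * dZ))
      (dlagr κ r (A + t * dA) (F + t * dF) (G + t * dG)
        (X + t * dX) (Y + t * dY) (Z + t * dZ) dA dF dG dX dY dZ) t := by
  have lin : ∀ u v : ℝ, HasDerivAt (fun t => u + t * v) v t := fun u v => by
    simpa using ((hasDerivAt_id t).mul_const v).const_add u
  have hA := lin A dA
  have hS := (lin F dF).sin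
  have hG := lin G dG
  have hX := lin X dX
  have hY := lin Y dY
  have hZ := lin Z dZ
  have hA2 := hA.pow 2
  have hS2 := hS.pow 2
  have hY2 := hY.pow 2
  have h1 := (((hX.pow 2).const_mul 2).add (((hA2.sub_const 1).pow 2).div_const (r ^ 2))).const_mul 2
  have h2 := ((hY2.const_mul (r ^ 2)).add ((hA2.const_mul 2).mul hS2)).const_mul (1 / 2)
  have h3 := ((hA2.const_mul (2 * κ)).mul hS2).mul
    ((hY2.const_mul 2).add ((hA2.mul hS2).div_const (r ^ 2)))
  have h4 := ((hZ.pow 2).const_mul (r ^ 2)).add ((hA2.const_mul 2).mul (hG.pow 2))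
  refine (((h1.add h2).add h3).sub h4).congr_deriv ?_
  simp only [dlagr, Pi.pow_apply, Pi.mul_apply, Pi.add_apply]
  ring

lemma exists_bound_dlagr {T : Type*} [TopologicalSpace T] {S : Set T} (hS : IsCompact S) (κ : ℝ)
    {R A F G dA dF dG dX dY dZ : T → ℝ} (hR0 : ∀ p ∈ S, R p ^ 2 ≠ 0)
    (hR : ContinuousOn R S) (hA : ContinuousOn A S) (hF : ContinuousOn F S)
    (hG : ContinuousOn G S) (hdA : ContinuousOn dA S) (hdF : ContinuousOn dF S)
    (hdG : ContinuousOn dG S) (hdX : ContinuousOn dX S) (hdY : ContinuousOn dY S)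
    (hdZ : ContinuousOn dZ S) :
    ∃ K, 0 ≤ K ∧ ∀ p ∈ S, ∀ X Y Z : ℝ,
      |dlagr κ (R p) (A p) (F p) (G p) X Y Z (dA p) (dF p) (dG p) (dX p) (dY p) (dZ p)|
        ≤ K * (1 + X ^ 2 + Y ^ 2 + Z ^ 2) := by
  obtain ⟨K0, h0⟩ := hS.exists_bound_of_continuousOn
    (f := fun p => 8 * (A p ^ 2 - 1) * A p * dA p / R p ^ 2 + 2 * A p * dA p * Real.sin (F p) ^ 2
      + 2 * A p ^ 2 * Real.sin (F p) * Real.cos (F p) * dF p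
      + 8 * κ * (A p ^ 3 * dA p * Real.sin (F p) ^ 4
        + A p ^ 4 * Real.sin (F p) ^ 3 * Real.cos (F p) * dF p) / R p ^ 2
      - 4 * A p * dA p * G p ^ 2 - 4 * A p ^ 2 * G p * dG p) (by fun_prop (disch := assumption))
  obtain ⟨K1, h1⟩ := hS.exists_bound_of_continuousOn (f := fun p => 8 * dX p) (by fun_prop)
  obtain ⟨K2, h2⟩ := hS.exists_bound_of_continuousOn
    (f := fun p => R p ^ 2 * dY p + 8 * κ * A p ^ 2 * Real.sin (F p) ^ 2 * dY p) (by fun_prop)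
  obtain ⟨K3, h3⟩ := hS.exists_bound_of_continuousOn (f := fun p => 2 * R p ^ 2 * dZ p)
    (by fun_prop)
  obtain ⟨K4, h4⟩ := hS.exists_bound_of_continuousOn
    (f := fun p => 8 * κ * (A p * dA p * Real.sin (F p) ^ 2
      + A p ^ 2 * Real.sin (F p) * Real.cos (F p) * dF p)) (by fun_prop)
  refine ⟨|K0| + |K1| + |K2| + |K3| + |K4|, by positivity, fun p hp X Y Z => ?_⟩
  have h0 := (h0 p hp).trans (le_abs_self _)
  have h1 := (h1 p hp).trans (le_abs_self _)
  have h2 := (h2 p hp).trans (le_abs_self _)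
  have h3 := (h3 p hp).trans (le_abs_self _)
  have h4 := (h4 p hp).trans (le_abs_self _)
  rw [Real.norm_eq_abs] at h0 h1 h2 h3 h4
  unfold dlagr
  set c0 := 8 * (A p ^ 2 - 1) * A p * dA p / R p ^ 2 + 2 * A p * dA p * Real.sin (F p) ^ 2
      + 2 * A p ^ 2 * Real.sin (F p) * Real.cos (F p) * dF p
      + 8 * κ * (A p ^ 3 * dA p * Real.sin (F p) ^ 4
        + A p ^ 4 * Real.sin (F p) ^ 3 * Real.cos (F p) * dF p) / R p ^ 2
      - 4 * A p * dA p * G p ^ 2 - 4 * A p ^ 2 * G p * dG p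
  set c1 := 8 * dX p
  set c2 := R p ^ 2 * dY p + 8 * κ * A p ^ 2 * Real.sin (F p) ^ 2 * dY p
  set c3 := 2 * R p ^ 2 * dZ p
  set c4 := 8 * κ * (A p * dA p * Real.sin (F p) ^ 2
      + A p ^ 2 * Real.sin (F p) * Real.cos (F p) * dF p)
  have hlin : ∀ x : ℝ, |x| ≤ 1 + x ^ 2 := fun x => by
    rw [← sq_abs]; nlinarith [sq_nonneg (|x| - 1), abs_nonneg x]
  have e1 : |c1 * X| ≤ |K1| * (1 + X ^ 2) := by
    rw [abs_mul]; exact mul_le_mul h1 (hlin X) (abs_nonneg _) (abs_nonneg _)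
  have e2 : |c2 * Y| ≤ |K2| * (1 + Y ^ 2) := by
    rw [abs_mul]; exact mul_le_mul h2 (hlin Y) (abs_nonneg _) (abs_nonneg _)
  have e3 : |c3 * Z| ≤ |K3| * (1 + Z ^ 2) := by
    rw [abs_mul]; exact mul_le_mul h3 (hlin Z) (abs_nonneg _) (abs_nonneg _)
  have e4 : |c4 * Y ^ 2| ≤ |K4| * Y ^ 2 := by
    rw [abs_mul, abs_of_nonneg (sq_nonneg Y)]
    exact mul_le_mul_of_nonneg_right h4 (sq_nonneg _)
  have t1 : |c0 + c1 * X + c2 * Y - c3 * Z + c4 * Y ^ 2|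
      ≤ |c0| + |c1 * X| + |c2 * Y| + |c3 * Z| + |c4 * Y ^ 2| := by
    have q1 := abs_add_le (c0 + c1 * X + c2 * Y - c3 * Z) (c4 * Y ^ 2)
    have q2 := abs_sub (c0 + c1 * X + c2 * Y) (c3 * Z)
    have q3 := abs_add_le (c0 + c1 * X) (c2 * Y)
    have q4 := abs_add_le c0 (c1 * X)
    linarith
  have p0 := mul_nonneg (abs_nonneg K0) (by positivity : 0 ≤ X ^ 2 + Y ^ 2 + Z ^ 2)
  have p1 := mul_nonneg (abs_nonneg K1) (by positivity : 0 ≤ Y ^ 2 + Z ^ 2)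
  have p2 := mul_nonneg (abs_nonneg K2) (by positivity : 0 ≤ X ^ 2 + Z ^ 2)
  have p3 := mul_nonneg (abs_nonneg K3) (by positivity : 0 ≤ X ^ 2 + Y ^ 2)
  have p4 := mul_nonneg (abs_nonneg K4) (by positivity : 0 ≤ 1 + X ^ 2 + Z ^ 2)
  linarith

lemma IsTest.exists_Icc₃ {η₁ η₂ η₃ : ℝ → ℝ} (h₁ : IsTest η₁) (h₂ : IsTest η₂) (h₃ : IsTest η₃) :
    ∃ s t : ℝ, 0 < s ∧ s ≤ t ∧ tsupport η₁ ⊆ Icc s t ∧ tsupport η₂ ⊆ Icc s t ∧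
      tsupport η₃ ⊆ Icc s t := by
  obtain ⟨s1, t1, a1, b1, c1, d1⟩ := exists_Icc_of_tsupport_subset_Ioi h₁.2.1 h₁.2.2
  obtain ⟨s2, t2, a2, b2, c2, d2⟩ := exists_Icc_of_tsupport_subset_Ioi h₂.2.1 h₂.2.2
  obtain ⟨s3, t3, a3, b3, c3, d3⟩ := exists_Icc_of_tsupport_subset_Ioi h₃.2.1 h₃.2.2
  refine ⟨min s1 (min s2 s3), max t1 (max t2 t3), by positivity,
    ((min_le_left _ _).trans b1).trans (c1.trans (le_max_left _ _)),
    d1.trans (Icc_subset_Icc (by simp) (by simp)), d2.trans (Icc_subset_Icc (by simp) (by simp)),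
    d3.trans (Icc_subset_Icc (by simp) (by simp))⟩

lemma LocACIoi.ae_deriv_add_mul {h η : ℝ → ℝ} (hh : LocACIoi h) (hη : IsTest η) :
    ∀ᵐ r ∂volume.restrict (Ioi (0 : ℝ)), ∀ t : ℝ,
      deriv (fun x => h x + t * η x) r = deriv h r + t * deriv η r := by
  filter_upwards [hh.ae_differentiableAt] with r hr t
  have hη' : DifferentiableAt ℝ η r := (hη.1.differentiable one_ne_zero) r
  exact (hr.hasDerivAt.add (hη'.hasDerivAt.const_mul t)).deriv

theorem action_variation {κ : ℝ} {a f g da df dg : ℝ → ℝ}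
    (ha : LocACIoi a) (hf : LocACIoi f) (hg : LocACIoi g)
    (ha2 : LocallyIntegrableOn (fun r => deriv a r ^ 2) (Ioi 0))
    (hf2 : LocallyIntegrableOn (fun r => deriv f r ^ 2) (Ioi 0))
    (hg2 : LocallyIntegrableOn (fun r => deriv g r ^ 2) (Ioi 0))
    (hint : IntegrableOn (fun r => calE1 κ a f r - calE2 a g r) (Ioi 0))
    (hda : IsTest da) (hdf : IsTest df) (hdg : IsTest dg) :
    (∀ t : ℝ, |t| ≤ 1 → IntegrableOn (fun r =>
      calE1 κ (fun r => a r + t * da r) (fun r => f r + t * df r) r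
        - calE2 (fun r => a r + t * da r) (fun r => g r + t * dg r) r) (Ioi 0)) ∧
    HasDerivAt (fun t : ℝ => actionL κ (fun r => a r + t * da r) (fun r => f r + t * df r)
      (fun r => g r + t * dg r))
      (∫ r in Ioi 0, dlagr κ r (a r) (f r) (g r) (deriv a r) (deriv f r) (deriv g r)
        (da r) (df r) (dg r) (deriv da r) (deriv df r) (deriv dg r)) 0 := by
  obtain ⟨s, b, hs, hsb, hsa, hsf, hsg⟩ := hda.exists_Icc₃ hdf hdg
  let Φ : ℝ → ℝ → ℝ := fun t r => lagr κ r (a r + t * da r) (f r + t * df r) (g r + t * dg r)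
    (deriv a r + t * deriv da r) (deriv f r + t * deriv df r) (deriv g r + t * deriv dg r)
  let Φ' : ℝ → ℝ → ℝ := fun t r => dlagr κ r (a r + t * da r) (f r + t * df r) (g r + t * dg r)
    (deriv a r + t * deriv da r) (deriv f r + t * deriv df r) (deriv g r + t * deriv dg r)
    (da r) (df r) (dg r) (deriv da r) (deriv df r) (deriv dg r)
  have hΦ : ∀ᵐ r ∂volume.restrict (Ioi (0 : ℝ)), ∀ t : ℝ,
      calE1 κ (fun r => a r + t * da r) (fun r => f r + t * df r) r
        - calE2 (fun r => a r + t * da r) (fun r => g r + t * dg r) r = Φ t r := by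
    filter_upwards [ha.ae_deriv_add_mul hda, hf.ae_deriv_add_mul hdf, hg.ae_deriv_add_mul hdg]
      with r h1 h2 h3 t
    rw [calE1_sub_calE2, h1, h2, h3]
  have hsub : Icc s b ⊆ Ioi 0 := fun x hx => hs.trans_le hx.1
  have hS : IsCompact (Icc (-1 : ℝ) 1 ×ˢ Icc s b) := isCompact_Icc.prod isCompact_Icc
  have lift : ∀ {u : ℝ → ℝ}, ContinuousOn u (Ioi 0) →
      ContinuousOn (fun p : ℝ × ℝ => u p.2) (Icc (-1 : ℝ) 1 ×ˢ Icc s b) := fun hu =>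
    hu.comp continuousOn_snd fun p hp => hsub hp.2
  have hdac := hda.1.continuous
  have hdfc := hdf.1.continuous
  have hdgc := hdg.1.continuous
  have hdac' := hda.continuous_deriv
  have hdfc' := hdf.continuous_deriv
  have hdgc' := hdg.continuous_deriv
  obtain ⟨K, hK0, hK⟩ := exists_bound_dlagr hS κ (R := fun p => p.2)
    (A := fun p => a p.2 + p.1 * da p.2) (F := fun p => f p.2 + p.1 * df p.2)
    (G := fun p => g p.2 + p.1 * dg p.2) (dA := fun p => da p.2) (dF := fun p => df p.2)
    (dG := fun p => dg p.2) (dX := fun p => deriv da p.2) (dY := fun p => deriv df p.2)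
    (dZ := fun p => deriv dg p.2)
    (fun p hp => pow_ne_zero 2 (ne_of_gt (hsub hp.2))) continuousOn_snd
    ((lift ha.continuousOn).add (by fun_prop)) ((lift hf.continuousOn).add (by fun_prop))
    ((lift hg.continuousOn).add (by fun_prop)) (by fun_prop) (by fun_prop) (by fun_prop)
    (by fun_prop) (by fun_prop) (by fun_prop)
  let bd : ℝ → ℝ := (Icc s b).indicator fun r => K * (1 + 2 * (deriv a r ^ 2 + deriv f r ^ 2
    + deriv g r ^ 2) + 2 * (deriv da r ^ 2 + deriv df r ^ 2 + deriv dg r ^ 2))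
  have hbd : IntegrableOn bd (Ioi 0) := by
    refine Integrable.integrableOn ((integrable_indicator_iff measurableSet_Icc).2 ?_)
    have i1 : IntegrableOn (fun r => deriv a r ^ 2 + deriv f r ^ 2 + deriv g r ^ 2) (Icc s b) :=
      ((ha2.integrableOn_Icc_of_pos hs).add (hf2.integrableOn_Icc_of_pos hs)).add
        (hg2.integrableOn_Icc_of_pos hs)
    have i2 : IntegrableOn (fun r => deriv da r ^ 2 + deriv df r ^ 2 + deriv dg r ^ 2)
      (Icc s b) := Continuous.integrableOn_Icc (by fun_prop)
    have i3 : IntegrableOn (fun _ : ℝ => (1 : ℝ)) (Icc s b) := continuous_const.integrableOn_Icc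
    exact ((i3.add (i1.const_mul 2)).add (i2.const_mul 2)).const_mul K
  have hb : ∀ t ∈ Icc (-1 : ℝ) 1, ∀ r, ‖Φ' t r‖ ≤ bd r := by
    intro t ht r
    by_cases hr : r ∈ Icc s b
    · have h1 := hK (t, r) ⟨ht, hr⟩ (deriv a r + t * deriv da r) (deriv f r + t * deriv df r)
        (deriv g r + t * deriv dg r)
      have hsq : ∀ x y : ℝ, (x + t * y) ^ 2 ≤ 2 * x ^ 2 + 2 * y ^ 2 := fun x y => by
        have : t ^ 2 ≤ 1 := by nlinarith [ht.1, ht.2]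
        nlinarith [sq_nonneg (x - t * y), mul_nonneg (sub_nonneg.2 this) (sq_nonneg y)]
      refine h1.trans ?_
      simp only [bd, indicator_of_mem hr]
      refine mul_le_mul_of_nonneg_left ?_ hK0
      linarith [hsq (deriv a r) (deriv da r), hsq (deriv f r) (deriv df r),
        hsq (deriv g r) (deriv dg r)]
    · simp only [Φ', bd, indicator_of_notMem hr,
        eq_zero_of_notMem_of_tsupport_subset hsa hr, eq_zero_of_notMem_of_tsupport_subset hsf hr,
        eq_zero_of_notMem_of_tsupport_subset hsg hr,
        deriv_eq_zero_of_notMem_of_tsupport_subset hsa hr,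
        deriv_eq_zero_of_notMem_of_tsupport_subset hsf hr,
        deriv_eq_zero_of_notMem_of_tsupport_subset hsg hr, dlagr_zero, norm_zero, le_refl]
  have hder : ∀ r t, HasDerivAt (fun t => Φ t r) (Φ' t r) t := fun r t => hasDerivAt_lagr ..
  have hma : AEMeasurable a (volume.restrict (Ioi 0)) :=
    (ha.continuousOn.aestronglyMeasurable measurableSet_Ioi).aemeasurable
  have hmf : AEMeasurable f (volume.restrict (Ioi 0)) :=
    (hf.continuousOn.aestronglyMeasurable measurableSet_Ioi).aemeasurable
  have hmg : AEMeasurable g (volume.restrict (Ioi 0)) :=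
    (hg.continuousOn.aestronglyMeasurable measurableSet_Ioi).aemeasurable
  have hmda := measurable_deriv a
  have hmdf := measurable_deriv f
  have hmdg := measurable_deriv g
  have hmA := hdac.measurable
  have hmF := hdfc.measurable
  have hmG := hdgc.measurable
  have hmA' := hdac'.measurable
  have hmF' := hdfc'.measurable
  have hmG' := hdgc'.measurable
  have hmΦ : ∀ t, AEStronglyMeasurable (Φ t) (volume.restrict (Ioi 0)) := fun t => by
    refine AEMeasurable.aestronglyMeasurable ?_
    simp only [Φ, lagr]
    fun_prop
  have hmΦ' : AEStronglyMeasurable (Φ' 0) (volume.restrict (Ioi 0)) := by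
    refine AEMeasurable.aestronglyMeasurable ?_
    simp only [Φ', dlagr]
    fun_prop
  have hΦ0 : IntegrableOn (Φ 0) (Ioi 0) := by
    refine hint.congr_fun (fun r _ => ?_) measurableSet_Ioi
    simp only [Φ, zero_mul, add_zero, calE1_sub_calE2]
  constructor
  · intro t ht
    have hdiff : IntegrableOn (fun r => Φ t r - Φ 0 r) (Ioi 0) := by
      refine Integrable.mono' hbd ((hmΦ t).sub (hmΦ 0)) (ae_of_all _ fun r => ?_)
      have := (convex_Icc (-1 : ℝ) 1).norm_image_sub_le_of_norm_hasDerivWithin_le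
        (f := fun t => Φ t r) (f' := fun t => Φ' t r) (C := bd r)
        (fun x _ => (hder r x).hasDerivWithinAt) (fun x hx => hb x hx r)
        (show (0 : ℝ) ∈ Icc (-1 : ℝ) 1 by simp) (show t ∈ Icc (-1 : ℝ) 1 from abs_le.1 ht)
      refine this.trans ?_
      rw [sub_zero, Real.norm_eq_abs]
      have hbd0 : 0 ≤ bd r := (norm_nonneg _).trans (hb 0 (by simp) r)
      nlinarith
    have h1 := hdiff.add hΦ0
    refine Integrable.congr h1 ?_
    filter_upwards [hΦ] with r hr
    rw [hr t]
    simp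
  · have h1 := (hasDerivAt_integral_of_dominated_loc_of_deriv_le (μ := volume.restrict (Ioi 0))
      (F := Φ) (F' := Φ') (x₀ := 0) (s := Icc (-1 : ℝ) 1) (bound := bd)
      (Icc_mem_nhds (by norm_num) (by norm_num)) (Eventually.of_forall hmΦ) hΦ0 hmΦ'
      (ae_of_all _ fun r t ht => hb t ht r) hbd (ae_of_all _ fun r t _ => hder r t)).2
    have h2 : (fun t : ℝ => actionL κ (fun r => a r + t * da r) (fun r => f r + t * df r)
        (fun r => g r + t * dg r)) = fun t => ∫ r in Ioi 0, Φ t r := by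
      funext t
      exact integral_congr_ae (hΦ.mono fun r hr => hr t)
    rw [h2]
    refine h1.congr_deriv ?_
    simp only [Φ', zero_mul, add_zero]

/-! ### Regularity and the Euler-Lagrange equations -/

lemma LocACIoi.locallyIntegrableOn_deriv {h : ℝ → ℝ} (hh : LocACIoi h) :
    LocallyIntegrableOn (deriv h) (Ioi 0) :=
  locallyIntegrableOn_Ioi_of_Icc fun s t hs hst =>
    (intervalIntegrable_iff_integrableOn_Icc_of_le hst).1 (hh s t hs hst).1

lemma setIntegral_eq_zero_of_eq_const_mul {u v : ℝ → ℝ} {s : Set ℝ} {c : ℝ} (hc : c ≠ 0)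
    (hv : ∫ r in s, v r = 0) (h : ∀ r, v r = c * u r) : ∫ r in s, u r = 0 := by
  simp only [h, integral_const_mul] at hv
  exact (mul_eq_zero.1 hv).resolve_left hc

lemma LocACIoi.regularity_of_weak_eq {h c Q : ℝ → ℝ} (hh : LocACIoi h)
    (hc : ContinuousOn c (Ioi 0)) (hc0 : ∀ r, 0 < r → c r ≠ 0)
    (hQ : LocallyIntegrableOn Q (Ioi 0))
    (hw : ∀ η, IsTest η → ∫ r in Ioi 0, (c r * deriv h r * deriv η r + Q r * η r) = 0) :
    (∀ r, 0 < r → DifferentiableAt ℝ h r) ∧ ContinuousOn (deriv h) (Ioi 0) ∧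
      (ContinuousOn Q (Ioi 0) →
        ∀ r, 0 < r → HasDerivAt (fun ρ => c ρ * deriv h ρ) (Q r) r) := by
  have hP : LocallyIntegrableOn (fun r => c r * deriv h r) (Ioi 0) :=
    hh.locallyIntegrableOn_deriv.continuousOn_mul hc isOpen_Ioi.isLocallyClosed
  obtain ⟨C, hC⟩ := exists_ae_eq_add_primitive hP hQ fun η h1 h2 h3 => hw η ⟨h1, h2, h3⟩
  have hpc : ContinuousOn (fun r => C + ∫ x in (1 : ℝ)..r, Q x) (Ioi 0) :=
    continuousOn_const.add hQ.continuousOn_primitive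
  have hd : ∀ r, 0 < r → HasDerivAt h ((C + ∫ x in (1 : ℝ)..r, Q x) / c r) r := fun r hr => by
    refine hh.hasDerivAt_of_ae_eq (hpc.div hc fun x hx => hc0 x hx) ?_ hr
    filter_upwards [hC, ae_restrict_mem measurableSet_Ioi] with x hx hx0
    rw [Pi.div_apply, eq_div_iff (hc0 x hx0), mul_comm, hx]
  have hEq : EqOn (fun r => c r * deriv h r) (fun r => C + ∫ x in (1 : ℝ)..r, Q x) (Ioi 0) :=
    fun r hr => by
      simp only [(hd r hr).deriv]
      rw [mul_div_cancel₀ _ (hc0 r hr)]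
  refine ⟨fun r hr => (hd r hr).differentiableAt, ?_, fun hQc r hr => ?_⟩
  · exact (hpc.div hc fun x hx => hc0 x hx).congr fun r hr => (hd r hr).deriv
  · exact (hasDerivAt_primitive_of_continuousOn hQc C hr).congr_of_eventuallyEq
      (hEq.eventuallyEq_of_mem (Ioi_mem_nhds hr))

theorem dyonEqs_of_critical {κ : ℝ} (hκ : 0 < κ) {a f g : ℝ → ℝ}
    (ha : LocACIoi a) (hf : LocACIoi f) (hg : LocACIoi g)
    (hf2 : LocallyIntegrableOn (fun r => deriv f r ^ 2) (Ioi 0))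
    (H : ∀ da df dg, IsTest da → IsTest df → IsTest dg →
      ∫ r in Ioi 0, dlagr κ r (a r) (f r) (g r) (deriv a r) (deriv f r) (deriv g r)
        (da r) (df r) (dg r) (deriv da r) (deriv df r) (deriv dg r) = 0) :
    DyonEqs κ a f g := by
  have hac := ha.continuousOn
  have hfc := hf.continuousOn
  have hgc := hg.continuousOn
  have hr0 : ∀ r ∈ Ioi (0 : ℝ), r ^ 2 ≠ 0 := fun r hr => pow_ne_zero 2 (ne_of_gt hr)
  have hlc : IsLocallyClosed (Ioi (0 : ℝ)) := isOpen_Ioi.isLocallyClosed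
  have hrl : ∀ {u : ℝ → ℝ}, ContinuousOn u (Ioi 0) → LocallyIntegrableOn u (Ioi 0) := fun hu =>
    hu.locallyIntegrableOn measurableSet_Ioi
  obtain ⟨ga, gb, gc⟩ := hg.regularity_of_weak_eq (c := fun r => r ^ 2)
    (Q := fun r => 2 * a r ^ 2 * g r) (by fun_prop) (fun r hr => hr0 r hr)
    (hrl (by fun_prop)) (fun η hη => by
      refine setIntegral_eq_zero_of_eq_const_mul (c := -2) (by norm_num)
        (H _ _ η isTest_zero isTest_zero hη) fun r => ?_
      simp only [dlagr, deriv_const]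
      ring)
  obtain ⟨fa, fb, fc⟩ := hf.regularity_of_weak_eq
    (c := fun r => r ^ 2 + 8 * κ * (a r ^ 2 * Real.sin (f r) ^ 2))
    (Q := fun r => (2 * a r ^ 2 * Real.sin (f r) * Real.cos (f r)
        + 8 * κ * a r ^ 4 * Real.sin (f r) ^ 3 * Real.cos (f r) / r ^ 2)
        + 8 * κ * a r ^ 2 * Real.sin (f r) * Real.cos (f r) * (deriv f r) ^ 2) (by fun_prop)
    (fun r hr => by positivity)
    ((hrl (by fun_prop (disch := assumption))).add (hf2.continuousOn_mul (by fun_prop) hlc))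
    (fun η hη => by
      refine setIntegral_eq_zero_of_eq_const_mul (c := 1) one_ne_zero
        (H _ η _ isTest_zero hη isTest_zero) fun r => ?_
      simp only [dlagr, deriv_const]
      ring)
  obtain ⟨aa, ab, ac⟩ := ha.regularity_of_weak_eq (c := fun r => 1)
    (Q := fun r => (a r * (a r ^ 2 - 1) / r ^ 2 + 1 / 4 * a r * Real.sin (f r) ^ 2
        + κ * a r ^ 3 * Real.sin (f r) ^ 4 / r ^ 2 - a r * g r ^ 2 / 2)
        + κ * a r * Real.sin (f r) ^ 2 * deriv f r ^ 2) (by fun_prop)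
    (fun r hr => one_ne_zero)
    ((hrl (by fun_prop (disch := assumption))).add (hf2.continuousOn_mul (by fun_prop) hlc))
    (fun η hη => by
      refine setIntegral_eq_zero_of_eq_const_mul (c := 8) (by norm_num)
        (H η _ _ hη isTest_zero isTest_zero) fun r => ?_
      simp only [dlagr, deriv_const]
      ring)
  intro r hr
  refine ⟨aa r hr, fa r hr, ga r hr, ?_, ?_, gc (by fun_prop) r hr⟩
  · have := ac (by fun_prop (disch := assumption)) r hr
    simp only [one_mul] at this
    exact this.congr_deriv (by ring)
  · refine ((fc (by fun_prop (disch := assumption)) r hr).congr_of_eventuallyEq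
      (Eventually.of_forall fun ρ => ?_)).congr_deriv ?_
    · simp only []; ring
    · ring

/-! ### Hardy's inequality -/

lemma LocACIoi.ae_hasDerivAt {h : ℝ → ℝ} (hh : LocACIoi h) :
    ∀ᵐ x ∂volume.restrict (Ioi (0 : ℝ)), HasDerivAt h (deriv h x) x :=
  hh.ae_differentiableAt.mono fun _ hx => hx.hasDerivAt

lemma integrableOn_inv_sq_Ioi {t : ℝ} (ht : 0 < t) :
    IntegrableOn (fun r : ℝ => 1 / r ^ 2) (Ioi t) ∧ ∫ r in Ioi t, 1 / r ^ 2 = 1 / t := by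
  have h1 : EqOn (fun r : ℝ => r ^ (-2 : ℝ)) (fun r => 1 / r ^ 2) (Ioi t) := fun r hr => by
    simp only [Real.rpow_neg (ht.trans hr).le, one_div]
    norm_num
  refine ⟨(integrableOn_Ioi_rpow_of_lt (by norm_num) ht).congr_fun h1 measurableSet_Ioi, ?_⟩
  rw [← setIntegral_congr_fun measurableSet_Ioi h1, integral_Ioi_rpow_of_lt (by norm_num) ht]
  norm_num
  rw [Real.rpow_neg ht.le, Real.rpow_one]

lemma integrableOn_Ioi_div_of_memLp {φ : ℝ → ℝ} (hφ : MemLp φ 2 (volume.restrict (Ioi 0))) {t : ℝ}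
    (ht : 0 < t) : IntegrableOn (fun r => φ r / r) (Ioi t) := by
  have hsub : Ioi t ⊆ Ioi 0 := Ioi_subset_Ioi ht.le
  have h1 : IntegrableOn (fun r => φ r ^ 2) (Ioi t) :=
    IntegrableOn.mono_set hφ.integrable_sq hsub
  refine (h1.add (integrableOn_inv_sq_Ioi ht).1).mono'
    ((hφ.1.mono_set hsub).mul (measurable_id.inv.aestronglyMeasurable)) ?_
  filter_upwards [ae_restrict_mem measurableSet_Ioi] with r hr
  have hr : 0 < r := ht.trans hr
  simp only [Pi.add_apply, norm_div, Real.norm_eq_abs, one_div]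
  rw [← inv_pow, ← sq_abs (φ r), div_eq_mul_inv, abs_of_pos hr]
  nlinarith [sq_nonneg (|φ r| - r⁻¹), sq_nonneg (|φ r|), sq_nonneg (r⁻¹)]

section Hardy

variable {h : ℝ → ℝ}

lemma integrableOn_deriv_Ioi_of_memLp
    (hd : MemLp (fun r => r * deriv h r) 2 (volume.restrict (Ioi 0))) {t : ℝ} (ht : 0 < t) : IntegrableOn (deriv h) (Ioi t) :=
  (integrableOn_Ioi_div_of_memLp hd ht).congr_fun
    (fun _ hr => mul_div_cancel_left₀ _ (ht.trans hr).ne') measurableSet_Ioi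

lemma LocACIoi.integral_deriv_Ioi (hh : LocACIoi h) (h0 : Tendsto h atTop (nhds 0))
    (hd : MemLp (fun r => r * deriv h r) 2 (volume.restrict (Ioi 0)))
    {t : ℝ} (ht : 0 < t) : ∫ r in Ioi t, deriv h r = - h t := by
  have h1 := intervalIntegral_tendsto_integral_Ioi t
    (integrableOn_deriv_Ioi_of_memLp hd ht) tendsto_id
  have h2 : Tendsto (fun x => h x - h t) atTop (nhds (0 - h t)) := h0.sub_const _
  rw [zero_sub] at h2
  refine tendsto_nhds_unique h1 (h2.congr' ?_)
  filter_upwards [eventually_ge_atTop t] with x hx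
  exact (hh t x ht hx).2

lemma LocACIoi.mul_sq_le (hh : LocACIoi h) (h0 : Tendsto h atTop (nhds 0))
    (hd : MemLp (fun r => r * deriv h r) 2 (volume.restrict (Ioi 0)))
    {t : ℝ} (ht : 0 < t) : t * h t ^ 2 ≤ ∫ r in Ioi 0, (r * deriv h r) ^ 2 := by
  have hsub : Ioi t ⊆ Ioi 0 := Ioi_subset_Ioi ht.le
  have i1 : IntegrableOn (fun r => (r * deriv h r) ^ 2) (Ioi t) :=
    IntegrableOn.mono_set hd.integrable_sq hsub
  have i2 := integrableOn_deriv_Ioi_of_memLp hd ht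
  obtain ⟨i3, e3⟩ := integrableOn_inv_sq_Ioi ht
  have hmono : ∫ r in Ioi t, (r * deriv h r) ^ 2 ≤ ∫ r in Ioi 0, (r * deriv h r) ^ 2 :=
    setIntegral_mono_set hd.integrable_sq (ae_of_all _ fun r => sq_nonneg _) hsub.eventuallyLE
  have key : ∀ l : ℝ, 0 ≤ (∫ r in Ioi t, (r * deriv h r) ^ 2) * (l * l) + (-2 * h t) * l + 1 / t := by
    intro l
    have h1 : 0 ≤ ∫ r in Ioi t, ((l * l) * (r * deriv h r) ^ 2 + (2 * l) * deriv h r + 1 / r ^ 2) := by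
      refine setIntegral_nonneg measurableSet_Ioi fun r hr => ?_
      have hr : 0 < r := ht.trans hr
      have : (l * l) * (r * deriv h r) ^ 2 + (2 * l) * deriv h r + 1 / r ^ 2
          = (l * (r * deriv h r) + 1 / r) ^ 2 := by field_simp; ring
      rw [this]; positivity
    have i12 : IntegrableOn (fun r => (l * l) * (r * deriv h r) ^ 2 + (2 * l) * deriv h r) (Ioi t) :=
      (i1.const_mul _).add (i2.const_mul _)
    rw [integral_add i12 i3,
      integral_add (i1.const_mul _) (i2.const_mul _), integral_const_mul, integral_const_mul, e3,
      hh.integral_deriv_Ioi h0 hd ht] at h1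
    linarith
  have := discrim_le_zero key
  rw [discrim] at this
  have h2 : h t ^ 2 ≤ (∫ r in Ioi t, (r * deriv h r) ^ 2) / t := by
    rw [div_eq_mul_one_div]; nlinarith
  rw [le_div_iff₀ ht] at h2
  linarith

lemma LocACIoi.intervalIntegral_sq_le (hh : LocACIoi h) (h0 : Tendsto h atTop (nhds 0))
    (hd : MemLp (fun r => r * deriv h r) 2 (volume.restrict (Ioi 0)))
    {s t : ℝ} (hs : 0 < s) (hst : s ≤ t) :
    ∫ r in s..t, h r ^ 2 ≤ 6 * ∫ r in Ioi 0, (r * deriv h r) ^ 2 := by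
  have ht := hs.trans_le hst
  have hac := hh.absolutelyContinuousOnInterval hs hst
  have hid : AbsolutelyContinuousOnInterval (fun r : ℝ => r) s t :=
    ContDiffOn.absolutelyContinuousOnInterval contDiffOn_id
  have hF := (hid.mul (hac.mul hac)).integral_deriv_eq_sub
  have hsub : Ioc s t ⊆ Ioi 0 := fun r hr => hs.trans hr.1
  have ihI : IntervalIntegrable (fun r => h r ^ 2) volume s t :=
    ((hac.continuousOn).pow 2).intervalIntegrable
  have iu : IntervalIntegrable (fun r => (r * deriv h r) ^ 2) volume s t :=
    (intervalIntegrable_iff_integrableOn_Ioc_of_le hst).2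
      (IntegrableOn.mono_set hd.integrable_sq hsub)
  have huΦ : ∫ r in s..t, (r * deriv h r) ^ 2 ≤ ∫ r in Ioi 0, (r * deriv h r) ^ 2 := by
    rw [intervalIntegral.integral_of_le hst]
    exact setIntegral_mono_set hd.integrable_sq (ae_of_all _ fun r => sq_nonneg _)
      hsub.eventuallyLE
  have hle : ∫ r in s..t, (h r ^ 2 - 4 * (r * deriv h r) ^ 2) ≤
      ∫ r in s..t, 2 * deriv ((fun r : ℝ => r) * (h * h)) r := by
    refine intervalIntegral.integral_mono_ae_restrict hst (ihI.sub (iu.const_mul 4))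
      ((hid.mul (hac.mul hac)).intervalIntegrable_deriv.const_mul 2) ?_
    rw [Measure.restrict_congr_set Ioc_ae_eq_Icc.symm]
    filter_upwards [ae_restrict_of_ae_restrict_of_subset hsub hh.ae_hasDerivAt] with r hr
    have := (hasDerivAt_id' r).mul (hr.mul hr)
    rw [this.deriv]
    simp only [Pi.mul_apply]
    nlinarith [sq_nonneg (h r + 2 * (r * deriv h r))]
  rw [intervalIntegral.integral_sub ihI (iu.const_mul 4), intervalIntegral.integral_const_mul,
    intervalIntegral.integral_const_mul, hF] at hle
  simp only [Pi.mul_apply] at hle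
  have h1 := hh.mul_sq_le h0 hd ht
  nlinarith [mul_nonneg hs.le (sq_nonneg (h s))]

theorem LocACIoi.hardy (hh : LocACIoi h) (h0 : Tendsto h atTop (nhds 0))
    (hd : MemLp (fun r => r * deriv h r) 2 (volume.restrict (Ioi 0))) :
    MemLp h 2 (volume.restrict (Ioi 0)) ∧
      ∫ r in Ioi 0, h r ^ 2 ≤ 6 * ∫ r in Ioi 0, (r * deriv h r) ^ 2 := by
  have ha : Tendsto (fun n : ℕ => 1 / ((n : ℝ) + 1)) atTop (nhds 0) :=
    tendsto_one_div_add_atTop_nhds_zero_nat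
  have hb : Tendsto (fun n : ℕ => (n : ℝ) + 1) atTop atTop :=
    tendsto_atTop_add_const_right _ _ tendsto_natCast_atTop_atTop
  have hcov : AECover (volume.restrict (Ioi (0 : ℝ))) atTop
      (fun n : ℕ => Ioc (1 / ((n : ℝ) + 1)) ((n : ℝ) + 1)) :=
    (aecover_Ioi_of_Ioi ha).inter (aecover_Iic hb)
  have hmeas : AEStronglyMeasurable h (volume.restrict (Ioi 0)) :=
    hh.continuousOn.aestronglyMeasurable measurableSet_Ioi
  have hbd : ∀ n : ℕ, ∫ r in Ioc (1 / ((n : ℝ) + 1)) ((n : ℝ) + 1), h r ^ 2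
      ∂(volume.restrict (Ioi 0)) ≤ 6 * ∫ r in Ioi 0, (r * deriv h r) ^ 2 := fun n => by
    have hn : (0 : ℝ) < 1 / ((n : ℝ) + 1) := by positivity
    have hle : 1 / ((n : ℝ) + 1) ≤ (n : ℝ) + 1 := by
      rw [div_le_iff₀ (by positivity)]
      nlinarith [(Nat.cast_nonneg n : (0 : ℝ) ≤ n)]
    have hsub : Ioc (1 / ((n : ℝ) + 1)) ((n : ℝ) + 1) ⊆ Ioi 0 := fun r hr => hn.trans hr.1
    rw [Measure.restrict_restrict measurableSet_Ioc, inter_eq_left.2 hsub,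
      ← intervalIntegral.integral_of_le hle]
    exact hh.intervalIntegral_sq_le h0 hd hn hle
  have hion : ∀ n : ℕ, IntegrableOn (fun r => h r ^ 2) (Ioc (1 / ((n : ℝ) + 1)) ((n : ℝ) + 1))
      (volume.restrict (Ioi 0)) := fun n => by
    have hn : (0 : ℝ) < 1 / ((n : ℝ) + 1) := by positivity
    refine (IntegrableOn.mono_set ?_ Ioc_subset_Icc_self).mono_measure Measure.restrict_le_self
    exact ((hh.continuousOn.mono fun r hr => hn.trans_le hr.1).pow 2).integrableOn_Icc
  have hi : Integrable (fun r => h r ^ 2) (volume.restrict (Ioi 0)) :=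
    hcov.integrable_of_integral_bounded_of_nonneg_ae _ hion (ae_of_all _ fun r => sq_nonneg _)
      (Eventually.of_forall hbd)
  exact ⟨(memLp_two_iff_integrable_sq hmeas).2 hi,
    le_of_tendsto' (hcov.integral_tendsto_of_countably_generated hi) hbd⟩

end Hardy

/-! ### Solving the linear equation by the Lax-Milgram theorem -/

/-- The function vanishing at infinity whose derivative is `φ r / r`. -/
def tailPrim (φ : ℝ → ℝ) (r : ℝ) : ℝ := -∫ s in Ioi r, φ s / s

section TailPrim

variable {φ ψ : ℝ → ℝ}

lemma tailPrim_sub_eq_integral (hφ : MemLp φ 2 (volume.restrict (Ioi 0))) (s t : ℝ) (hs : 0 < s)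
    (hst : s ≤ t) : IntervalIntegrable (fun r => φ r / r) volume s t ∧
      tailPrim φ t - tailPrim φ s = ∫ r in s..t, φ r / r := by
  have h1 := integrableOn_Ioi_div_of_memLp hφ hs
  refine ⟨(intervalIntegrable_iff_integrableOn_Ioc_of_le hst).2 (h1.mono_set Ioc_subset_Ioi_self),
    ?_⟩
  rw [← intervalIntegral.integral_Ioi_sub_Ioi h1 hst, tailPrim, tailPrim]
  ring

lemma locACIoi_tailPrim (hφ : MemLp φ 2 (volume.restrict (Ioi 0))) : LocACIoi (tailPrim φ) :=
  .of_sub_eq_integral (tailPrim_sub_eq_integral hφ)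

lemma mul_deriv_tailPrim_ae_eq (hφ : MemLp φ 2 (volume.restrict (Ioi 0))) :
    (fun r => r * deriv (tailPrim φ) r) =ᵐ[volume.restrict (Ioi 0)] φ := by
  filter_upwards [ae_hasDerivAt_of_sub_eq_integral (tailPrim_sub_eq_integral hφ),
    ae_restrict_mem measurableSet_Ioi] with r hr hr0
  rw [hr.deriv, mul_div_cancel₀ _ (ne_of_gt hr0)]

lemma memLp_mul_deriv_tailPrim (hφ : MemLp φ 2 (volume.restrict (Ioi 0))) :
    MemLp (fun r => r * deriv (tailPrim φ) r) 2 (volume.restrict (Ioi 0)) :=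
  (memLp_congr_ae (mul_deriv_tailPrim_ae_eq hφ)).2 hφ

lemma tendsto_tailPrim (hφ : MemLp φ 2 (volume.restrict (Ioi 0))) :
    Tendsto (tailPrim φ) atTop (nhds 0) := by
  have h1 := intervalIntegral_tendsto_integral_Ioi 1
    (integrableOn_Ioi_div_of_memLp hφ one_pos) tendsto_id
  have h2 := h1.add_const (tailPrim φ 1)
  rw [tailPrim, add_neg_cancel] at h2
  refine h2.congr' ?_
  filter_upwards [eventually_ge_atTop 1] with t ht
  have := (tailPrim_sub_eq_integral hφ 1 t one_pos ht).2
  rw [id, ← this, tailPrim, tailPrim]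
  ring

lemma tailPrim_congr (h : φ =ᵐ[volume.restrict (Ioi 0)] ψ) {r : ℝ} (hr : 0 < r) :
    tailPrim φ r = tailPrim ψ r := by
  rw [tailPrim, tailPrim]
  congr 1
  refine integral_congr_ae ?_
  filter_upwards [ae_restrict_of_ae_restrict_of_subset (Ioi_subset_Ioi hr.le) h] with s hs
  rw [hs]

lemma tailPrim_add (hφ : MemLp φ 2 (volume.restrict (Ioi 0)))
    (hψ : MemLp ψ 2 (volume.restrict (Ioi 0))) {r : ℝ} (hr : 0 < r) :
    tailPrim (φ + ψ) r = tailPrim φ r + tailPrim ψ r := by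
  simp only [tailPrim, Pi.add_apply, add_div]
  rw [integral_add (integrableOn_Ioi_div_of_memLp hφ hr) (integrableOn_Ioi_div_of_memLp hψ hr)]
  ring

lemma tailPrim_smul (c : ℝ) (r : ℝ) : tailPrim (c • φ) r = c * tailPrim φ r := by
  simp only [tailPrim, Pi.smul_apply, smul_eq_mul, mul_div_assoc]
  rw [integral_const_mul]
  ring

lemma tailPrim_mul_deriv {h : ℝ → ℝ} (hh : LocACIoi h) (h0 : Tendsto h atTop (nhds 0))
    (hd : MemLp (fun r => r * deriv h r) 2 (volume.restrict (Ioi 0))) {t : ℝ} (ht : 0 < t) :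
    tailPrim (fun r => r * deriv h r) t = h t := by
  rw [tailPrim, eq_comm, ← neg_eq_iff_eq_neg, ← hh.integral_deriv_Ioi h0 hd ht, eq_comm]
  exact setIntegral_congr_fun measurableSet_Ioi
    fun r hr => mul_div_cancel_left₀ _ (ht.trans hr).ne'

lemma hardy_tailPrim (hφ : MemLp φ 2 (volume.restrict (Ioi 0))) :
    MemLp (tailPrim φ) 2 (volume.restrict (Ioi 0)) ∧
      ∫ r in Ioi 0, tailPrim φ r ^ 2 ≤ 6 * ∫ r in Ioi 0, φ r ^ 2 := by
  have := (locACIoi_tailPrim hφ).hardy (tendsto_tailPrim hφ) (memLp_mul_deriv_tailPrim hφ)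
  refine ⟨this.1, this.2.trans_eq ?_⟩
  congr 1
  refine integral_congr_ae ?_
  filter_upwards [mul_deriv_tailPrim_ae_eq hφ] with r hr
  rw [hr]

end TailPrim

lemma inner_Lp_eq_integral {μ : Measure ℝ} (u v : Lp ℝ 2 μ) : inner ℝ u v = ∫ x, u x * v x ∂μ := by
  rw [L2.inner_def]
  refine integral_congr_ae (ae_of_all _ fun x => ?_)
  simp [mul_comm]

lemma memLp_mul_tailPrim {m φ : ℝ → ℝ} {M : ℝ} (hm : ContinuousOn m (Ioi 0))
    (hM : ∀ r, 0 < r → |m r| ≤ M) (hφ : MemLp φ 2 (volume.restrict (Ioi 0))) :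
    MemLp (fun r => m r * tailPrim φ r) 2 (volume.restrict (Ioi 0)) := by
  refine MemLp.of_le_mul (c := M) (hardy_tailPrim hφ).1
    ((hm.aestronglyMeasurable measurableSet_Ioi).mul (hardy_tailPrim hφ).1.1) ?_
  filter_upwards [ae_restrict_mem measurableSet_Ioi] with r hr
  rw [norm_mul]
  exact mul_le_mul_of_nonneg_right (hM r hr) (norm_nonneg _)

lemma exists_mul_tailPrim_operator {m : ℝ → ℝ} {M : ℝ} (hm : ContinuousOn m (Ioi 0))
    (hM : ∀ r, 0 < r → |m r| ≤ M) :
    ∃ S : Lp ℝ 2 (volume.restrict (Ioi (0 : ℝ))) →L[ℝ] Lp ℝ 2 (volume.restrict (Ioi (0 : ℝ))),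
      ∀ φ, S φ =ᵐ[volume.restrict (Ioi 0)] fun r => m r * tailPrim φ r := by
  let S₀ : Lp ℝ 2 (volume.restrict (Ioi (0 : ℝ))) → Lp ℝ 2 (volume.restrict (Ioi (0 : ℝ))) :=
    fun φ => (memLp_mul_tailPrim hm hM (Lp.memLp φ)).toLp _
  have hS₀ : ∀ φ, S₀ φ =ᵐ[volume.restrict (Ioi 0)] fun r => m r * tailPrim φ r :=
    fun φ => MemLp.coeFn_toLp _
  have hM0 : 0 ≤ M := (abs_nonneg _).trans (hM 1 one_pos)
  let S₁ : Lp ℝ 2 (volume.restrict (Ioi (0 : ℝ))) →ₗ[ℝ] Lp ℝ 2 (volume.restrict (Ioi (0 : ℝ))) :=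
    { toFun := S₀
      map_add' := fun φ ψ => by
        refine Lp.ext ?_
        filter_upwards [hS₀ (φ + ψ), hS₀ φ, hS₀ ψ, Lp.coeFn_add (S₀ φ) (S₀ ψ),
          ae_restrict_mem measurableSet_Ioi] with r h1 h2 h3 h4 hr
        rw [h1, h4, Pi.add_apply, h2, h3, tailPrim_congr (Lp.coeFn_add φ ψ) hr,
          tailPrim_add (Lp.memLp φ) (Lp.memLp ψ) hr, mul_add]
      map_smul' := fun c φ => by
        refine Lp.ext ?_
        filter_upwards [hS₀ (c • φ), hS₀ φ, Lp.coeFn_smul c (S₀ φ),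
          ae_restrict_mem measurableSet_Ioi] with r h1 h2 h4 hr
        rw [h1, RingHom.id_apply, h4, Pi.smul_apply, h2, tailPrim_congr (Lp.coeFn_smul c φ) hr,
          tailPrim_smul, smul_eq_mul]
        ring }
  refine ⟨S₁.mkContinuous (M * 3) fun φ => ?_, hS₀⟩
  refine abs_le_of_sq_le_sq' ?_ (by positivity) |>.2
  have e1 : ‖S₁ φ‖ ^ 2 = ∫ r in Ioi 0, (m r * tailPrim φ r) ^ 2 := by
    rw [← real_inner_self_eq_norm_sq, inner_Lp_eq_integral]
    refine integral_congr_ae ?_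
    filter_upwards [hS₀ φ] with r hr
    rw [show S₁ φ = S₀ φ from rfl, hr, sq]
  have e2 : ‖φ‖ ^ 2 = ∫ r in Ioi 0, φ r ^ 2 := by
    rw [← real_inner_self_eq_norm_sq, inner_Lp_eq_integral]
    simp only [sq]
  obtain ⟨k1, k2⟩ := hardy_tailPrim (Lp.memLp φ)
  have e3 : ∫ r in Ioi 0, (m r * tailPrim φ r) ^ 2 ≤ ∫ r in Ioi 0, M ^ 2 * tailPrim φ r ^ 2 := by
    refine setIntegral_mono_on (memLp_mul_tailPrim hm hM (Lp.memLp φ)).integrable_sq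
      (k1.integrable_sq.const_mul _) measurableSet_Ioi fun r hr => ?_
    rw [mul_pow]
    exact mul_le_mul_of_nonneg_right (sq_le_sq' (abs_le.1 (hM r hr)).1 (abs_le.1 (hM r hr)).2)
      (sq_nonneg _)
  rw [integral_const_mul] at e3
  rw [mul_pow, e1, e2]
  nlinarith [mul_le_mul_of_nonneg_left k2 (sq_nonneg M), sq_nonneg (M * ‖φ‖)]

theorem exists_weak_solution {b w : ℝ → ℝ} {M : ℝ} (hb : ContinuousOn b (Ioi 0))
    (hM : ∀ r, 0 < r → |b r| ≤ M) (hw : MemLp w 2 (volume.restrict (Ioi 0))) :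
    ∃ h, LocACIoi h ∧ Tendsto h atTop (nhds 0) ∧
      MemLp (fun r => r * deriv h r) 2 (volume.restrict (Ioi 0)) ∧
      (∀ G, LocACIoi G → Tendsto G atTop (nhds 0) →
        MemLp (fun r => r * deriv G r) 2 (volume.restrict (Ioi 0)) →
        ∫ r in Ioi 0, (r ^ 2 * deriv h r * deriv G r + 2 * b r ^ 2 * h r * G r) =
          ∫ r in Ioi 0, w r * G r) ∧
      ∫ r in Ioi 0, (r ^ 2 * deriv h r ^ 2 + 2 * b r ^ 2 * h r ^ 2) ≤ 6 * ∫ r in Ioi 0, w r ^ 2 := by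
  obtain ⟨S, hS⟩ := exists_mul_tailPrim_operator hb hM
  obtain ⟨T, hT⟩ := exists_mul_tailPrim_operator (m := fun _ => 1) (M := 1) continuousOn_const
    (fun r _ => by simp)
  let B : Lp ℝ 2 (volume.restrict (Ioi (0 : ℝ))) →L[ℝ] Lp ℝ 2 (volume.restrict (Ioi (0 : ℝ))) →L[ℝ] ℝ :=
    innerSL ℝ + (2 : ℝ) • (innerSL ℝ).bilinearComp S S
  have hB : ∀ u v, B u v = inner ℝ u v + 2 * inner ℝ (S u) (S v) := fun u v => by
    simp [B]
    rfl
  have hco : IsCoercive B := ⟨1, one_pos, fun u => by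
    rw [hB, real_inner_self_eq_norm_sq, real_inner_self_eq_norm_sq]
    nlinarith [sq_nonneg ‖S u‖]⟩
  set φ := hco.continuousLinearEquivOfBilin.symm (T.adjoint (hw.toLp w)) with hφdef
  have hφ : ∀ ψ, B φ ψ = inner ℝ (hw.toLp w) (T ψ) := fun ψ => by
    rw [← hco.continuousLinearEquivOfBilin_apply, hφdef, ContinuousLinearEquiv.apply_symm_apply,
      ContinuousLinearMap.adjoint_inner_left]
  have hφL := Lp.memLp φ
  have hh := locACIoi_tailPrim hφL
  have hh0 := tendsto_tailPrim hφL
  have hhd := memLp_mul_deriv_tailPrim hφL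
  have weak : ∀ G, LocACIoi G → Tendsto G atTop (nhds 0) →
        MemLp (fun r => r * deriv G r) 2 (volume.restrict (Ioi 0)) →
        ∫ r in Ioi 0, (r ^ 2 * deriv (tailPrim φ) r * deriv G r
          + 2 * b r ^ 2 * tailPrim φ r * G r) = ∫ r in Ioi 0, w r * G r := by
    intro G hG hG0 hGd
    have h1 := hφ (hGd.toLp _)
    have h2 : ∀ r, 0 < r → tailPrim (hGd.toLp _) r = G r := fun r hr => by
      rw [tailPrim_congr hGd.coeFn_toLp hr, tailPrim_mul_deriv hG hG0 hGd hr]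
    rw [hB, inner_Lp_eq_integral, inner_Lp_eq_integral, inner_Lp_eq_integral, ← integral_const_mul,
      ← integral_add ((Lp.memLp _).integrable_mul (Lp.memLp _))
        (((Lp.memLp _).integrable_mul (Lp.memLp _)).const_mul 2)] at h1
    refine Eq.trans ?_ (h1.trans ?_)
    · refine integral_congr_ae ?_
      filter_upwards [hS φ, hS (hGd.toLp _), hGd.coeFn_toLp, mul_deriv_tailPrim_ae_eq hφL,
        ae_restrict_mem measurableSet_Ioi] with r k1 k2 k3 k4 hr
      rw [k1, k2, k3, ← k4, h2 r hr]
      ring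
    · refine integral_congr_ae ?_
      filter_upwards [hT (hGd.toLp _), hw.coeFn_toLp, ae_restrict_mem measurableSet_Ioi]
        with r k1 k2 hr
      rw [k1, k2, h2 r hr, one_mul]
  refine ⟨tailPrim φ, hh, hh0, hhd, weak, ?_⟩
  have h3 := weak _ hh hh0 hhd
  obtain ⟨k1, k2⟩ := hh.hardy hh0 hhd
  have k3 : MemLp (fun r => b r * tailPrim φ r) 2 (volume.restrict (Ioi 0)) :=
    memLp_mul_tailPrim hb hM hφL
  have h4 : ∫ r in Ioi 0, w r * tailPrim φ r ≤
      ∫ r in Ioi 0, (3 * w r ^ 2 + 1 / 12 * tailPrim φ r ^ 2) :=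
    integral_mono (hw.integrable_mul k1)
      ((hw.integrable_sq.const_mul _).add (k1.integrable_sq.const_mul _)) fun r => by
        simp only []
        nlinarith [sq_nonneg (6 * w r - tailPrim φ r)]
  rw [integral_add (hw.integrable_sq.const_mul _) (k1.integrable_sq.const_mul _),
    integral_const_mul, integral_const_mul] at h4
  have h5 : ∫ r in Ioi 0, (r ^ 2 * deriv (tailPrim φ) r * deriv (tailPrim φ) r
      + 2 * b r ^ 2 * tailPrim φ r * tailPrim φ r) =
      ∫ r in Ioi 0, (r ^ 2 * deriv (tailPrim φ) r ^ 2 + 2 * b r ^ 2 * tailPrim φ r ^ 2) := by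
    congr 1; ext r; ring
  have h6 : ∫ r in Ioi 0, (r * deriv (tailPrim φ) r) ^ 2 ≤
      ∫ r in Ioi 0, (r ^ 2 * deriv (tailPrim φ) r ^ 2 + 2 * b r ^ 2 * tailPrim φ r ^ 2) := by
    refine integral_mono hhd.integrable_sq ?_ fun r => ?_
    · refine (hhd.integrable_sq.add (k3.integrable_sq.const_mul 2)).congr (ae_of_all _ fun r => ?_)
      simp only [Pi.add_apply]; ring
    · simp only []
      nlinarith [sq_nonneg (b r * tailPrim φ r)]
  linarith

/-! ### Behaviour at the origin -/

section Origin

variable {u b : ℝ → ℝ}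

lemma monotoneOn_mul_sq_mul_deriv (hu : ∀ r, 0 < r → DifferentiableAt ℝ u r)
    (he : ∀ r, 0 < r → HasDerivAt (fun ρ => ρ ^ 2 * deriv u ρ) (2 * b r ^ 2 * u r) r) :
    MonotoneOn (fun r => u r * (r ^ 2 * deriv u r)) (Ioi 0) := by
  have hd : ∀ r, 0 < r → HasDerivAt (fun r => u r * (r ^ 2 * deriv u r))
      (deriv u r * (r ^ 2 * deriv u r) + u r * (2 * b r ^ 2 * u r)) r := fun r hr =>
    (hu r hr).hasDerivAt.mul (he r hr)
  refine monotoneOn_of_deriv_nonneg (convex_Ioi 0)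
    (fun r hr => (hd r hr).continuousAt.continuousWithinAt) (fun r hr => ?_) fun r hr => ?_
  · rw [interior_Ioi] at hr
    exact (hd r hr).differentiableAt.differentiableWithinAt
  · rw [interior_Ioi] at hr
    rw [(hd r hr).deriv]
    nlinarith [sq_nonneg (r * deriv u r), sq_nonneg (b r * u r)]

lemma mul_sq_mul_deriv_nonneg (hu : ∀ r, 0 < r → DifferentiableAt ℝ u r)
    (he : ∀ r, 0 < r → HasDerivAt (fun ρ => ρ ^ 2 * deriv u ρ) (2 * b r ^ 2 * u r) r)
    (hint : IntegrableOn (fun r => u r * (r * deriv u r)) (Ioc 0 1)) {r₀ : ℝ} (h₀ : 0 < r₀) :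
    0 ≤ u r₀ * (r₀ ^ 2 * deriv u r₀) := by
  by_contra! hneg
  set c := -(u r₀ * (r₀ ^ 2 * deriv u r₀)) with hc
  have hc0 : 0 < c := by linarith
  have hm : 0 < min r₀ 1 := lt_min h₀ one_pos
  have h1 : IntegrableOn (fun r => u r * (r * deriv u r)) (Ioc 0 (min r₀ 1)) :=
    hint.mono_set (Ioc_subset_Ioc_right (min_le_right _ _))
  have h2 : IntegrableOn (fun r : ℝ => r⁻¹) (Ioc 0 (min r₀ 1)) := by
    refine (h1.norm.const_mul c⁻¹).mono' measurable_inv.aestronglyMeasurable ?_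
    filter_upwards [ae_restrict_mem measurableSet_Ioc] with r hr
    have hr0 : 0 < r := hr.1
    have h3 : u r * (r ^ 2 * deriv u r) ≤ -c := by
      rw [hc, neg_neg]
      exact monotoneOn_mul_sq_mul_deriv hu he hr0 h₀ (hr.2.trans (min_le_left _ _))
    have h4 : c ≤ r * |u r * (r * deriv u r)| := by
      rw [← abs_of_pos hr0, ← abs_mul, abs_of_pos hr0]
      refine le_trans ?_ (neg_le_abs _)
      nlinarith
    rw [norm_inv, Real.norm_eq_abs, abs_of_pos hr0, Real.norm_eq_abs, inv_mul_eq_div,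
      le_div_iff₀ hc0, inv_mul_le_iff₀ hr0]
    exact h4
  have h5 := (intervalIntegrable_iff_integrableOn_Ioc_of_le hm.le).2 h2
  rw [intervalIntegrable_inv_iff] at h5
  rcases h5 with h5 | h5
  · exact hm.ne h5
  · exact h5 left_mem_uIcc

lemma monotoneOn_sq (hu : ∀ r, 0 < r → DifferentiableAt ℝ u r)
    (he : ∀ r, 0 < r → HasDerivAt (fun ρ => ρ ^ 2 * deriv u ρ) (2 * b r ^ 2 * u r) r)
    (hint : IntegrableOn (fun r => u r * (r * deriv u r)) (Ioc 0 1)) :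
    MonotoneOn (fun r => u r ^ 2) (Ioi 0) := by
  have hd : ∀ r, 0 < r → HasDerivAt (fun r => u r ^ 2) (2 * u r * deriv u r) r := fun r hr => by
    refine ((hu r hr).hasDerivAt.fun_pow 2).congr_deriv ?_
    norm_num
  refine monotoneOn_of_deriv_nonneg (convex_Ioi 0)
    (fun r hr => (hd r hr).continuousAt.continuousWithinAt) (fun r hr => ?_) fun r hr => ?_
  · rw [interior_Ioi] at hr
    exact (hd r hr).differentiableAt.differentiableWithinAt
  · rw [interior_Ioi] at hr
    have hr : 0 < r := hr
    rw [(hd r hr).deriv]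
    have := mul_sq_mul_deriv_nonneg hu he hint hr
    have h2 : 0 ≤ (u r * deriv u r) * r ^ 2 := by linarith
    linarith [nonneg_of_mul_nonneg_left h2 (by positivity)]

theorem exists_tendsto_nhdsGT_zero (hu : ∀ r, 0 < r → DifferentiableAt ℝ u r)
    (he : ∀ r, 0 < r → HasDerivAt (fun ρ => ρ ^ 2 * deriv u ρ) (2 * b r ^ 2 * u r) r)
    (hint : IntegrableOn (fun r => u r * (r * deriv u r)) (Ioc 0 1)) :
    ∃ l, Tendsto u (nhdsWithin 0 (Ioi 0)) (nhds l) := by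
  have hmono := monotoneOn_sq hu he hint
  have hbdd : BddBelow ((fun r => u r ^ 2) '' Ioi 0) :=
    ⟨0, by rintro _ ⟨r, -, rfl⟩; exact sq_nonneg _⟩
  set L := sInf ((fun r => u r ^ 2) '' Ioi 0) with hL
  have hlim : Tendsto (fun r => u r ^ 2) (nhdsWithin 0 (Ioi 0)) (nhds L) :=
    hmono.tendsto_nhdsGT hbdd
  have habs : Tendsto (fun r => |u r|) (nhdsWithin 0 (Ioi 0)) (nhds (√L)) := by
    simpa only [Function.comp_def, Real.sqrt_sq_eq_abs] using (Real.continuous_sqrt.tendsto L).comp hlim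
  have hcont : ContinuousOn u (Ioi 0) := fun r hr => (hu r hr).continuousAt.continuousWithinAt
  by_cases hz : ∃ r, 0 < r ∧ u r = 0
  · obtain ⟨r, hr, hr0⟩ := hz
    have hL0 : L = 0 := le_antisymm
      ((csInf_le hbdd ⟨r, hr, rfl⟩).trans_eq (by simp [hr0]))
      (le_csInf ⟨_, ⟨1, mem_Ioi.2 one_pos, rfl⟩⟩ (by rintro _ ⟨r, -, rfl⟩; exact sq_nonneg _))
    rw [hL0, Real.sqrt_zero] at habs
    exact ⟨0, (tendsto_zero_iff_abs_tendsto_zero _).2 habs⟩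
  · push Not at hz
    rcases lt_or_gt_of_ne (hz 1 one_pos) with h1 | h1
    · refine ⟨-√L, habs.neg.congr' ?_⟩
      filter_upwards [self_mem_nhdsWithin] with r hr
      rw [abs_of_neg, neg_neg]
      by_contra! hge
      obtain ⟨x, hx, hx0⟩ := isPreconnected_Ioi.intermediate_value (mem_Ioi.2 one_pos) hr hcont
        ⟨h1.le, hge⟩
      exact hz x hx hx0
    · refine ⟨√L, habs.congr' ?_⟩
      filter_upwards [self_mem_nhdsWithin] with r hr
      rw [abs_of_pos]
      by_contra! hge
      obtain ⟨x, hx, hx0⟩ := isPreconnected_Ioi.intermediate_value hr (mem_Ioi.2 one_pos) hcont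
        ⟨hge, h1.le⟩
      exact hz x hx hx0

end Origin

/-! ### Consequences of finite energy -/

lemma calE1_nonneg {κ : ℝ} (hκ : 0 < κ) (a f : ℝ → ℝ) (r : ℝ) : 0 ≤ calE1 κ a f r := by
  unfold calE1; positivity

lemma calE2_nonneg (a g : ℝ → ℝ) (r : ℝ) : 0 ≤ calE2 a g r := by
  unfold calE2; positivity

lemma aestronglyMeasurable_mul_deriv (g : ℝ → ℝ) :
    AEStronglyMeasurable (fun r => r * deriv g r) (volume.restrict (Ioi 0)) :=
  (measurable_id.mul (measurable_deriv g)).aestronglyMeasurable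

section Energy

variable {κ : ℝ} {a f g : ℝ → ℝ}

lemma integrableOn_calE2_iff (ha : ContinuousOn a (Ioi 0)) (hg : ContinuousOn g (Ioi 0)) :
    IntegrableOn (calE2 a g) (Ioi 0) ↔ MemLp (fun r => r * deriv g r) 2 (volume.restrict (Ioi 0)) ∧
      MemLp (fun r => a r * g r) 2 (volume.restrict (Ioi 0)) := by
  have m1 := aestronglyMeasurable_mul_deriv g
  have m2 : AEStronglyMeasurable (fun r => a r * g r) (volume.restrict (Ioi 0)) :=
    (ha.mul hg).aestronglyMeasurable measurableSet_Ioi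
  rw [memLp_two_iff_integrable_sq m1, memLp_two_iff_integrable_sq m2]
  constructor
  · intro h
    refine ⟨h.mono' (m1.pow 2) (ae_of_all _ fun r => ?_), h.mono' (m2.pow 2) (ae_of_all _ fun r => ?_)⟩
    all_goals
      rw [Real.norm_eq_abs, abs_of_nonneg (sq_nonneg _), calE2]
      nlinarith [sq_nonneg (r * deriv g r), sq_nonneg (a r * g r)]
  · rintro ⟨h1, h2⟩
    refine (h1.add (h2.const_mul 2)).congr (ae_of_all _ fun r => ?_)
    simp only [Pi.add_apply, calE2]
    ring

lemma FiniteEnergy.integrableOn (hκ : 0 < κ) (ha : ContinuousOn a (Ioi 0))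
    (hf : ContinuousOn f (Ioi 0)) (h : FiniteEnergy κ a f g) :
    IntegrableOn (calE1 κ a f) (Ioi 0) ∧ IntegrableOn (calE2 a g) (Ioi 0) := by
  have hd : ∀ u : ℝ → ℝ, AEMeasurable (deriv u) (volume.restrict (Ioi 0)) := fun u =>
    (measurable_deriv u).aemeasurable
  have hac : AEMeasurable a (volume.restrict (Ioi 0)) := ha.aemeasurable measurableSet_Ioi
  have hfc : AEMeasurable f (volume.restrict (Ioi 0)) := hf.aemeasurable measurableSet_Ioi
  have hda := hd a
  have hdf := hd f
  have h1 : IntegrableOn (calE1 κ a f) (Ioi 0) := by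
    refine Integrable.mono' h (AEMeasurable.aestronglyMeasurable ?_) (ae_of_all _ fun r => ?_)
    · have hs : AEMeasurable (fun r => Real.sin (f r)) (volume.restrict (Ioi 0)) :=
        Real.measurable_sin.comp_aemeasurable hfc
      unfold calE1
      fun_prop
    · rw [Real.norm_eq_abs, abs_of_nonneg (calE1_nonneg hκ a f r)]
      linarith [calE2_nonneg a g r]
  refine ⟨h1, (Integrable.sub h h1).congr (ae_of_all _ fun r => ?_)⟩
  simp

lemma integrableOn_deriv_sq_of_calE1 (hκ : 0 < κ) (h : IntegrableOn (calE1 κ a f) (Ioi 0)) :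
    IntegrableOn (fun r => deriv a r ^ 2) (Ioi 0) ∧
      MemLp (fun r => r * deriv f r) 2 (volume.restrict (Ioi 0)) := by
  have key : ∀ r, deriv a r ^ 2 ≤ calE1 κ a f r ∧ (r * deriv f r) ^ 2 ≤ 2 * calE1 κ a f r := by
    intro r
    have h1 : 0 ≤ 2 * κ * (a r) ^ 2 * Real.sin (f r) ^ 2
        * (2 * (deriv f r) ^ 2 + (a r) ^ 2 * Real.sin (f r) ^ 2 / r ^ 2) := by positivity
    have h2 : 0 ≤ ((a r) ^ 2 - 1) ^ 2 / r ^ 2 := by positivity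
    have h3 : 0 ≤ a r ^ 2 * Real.sin (f r) ^ 2 := by positivity
    have h4 : 0 ≤ r ^ 2 * deriv f r ^ 2 := by positivity
    unfold calE1
    constructor <;> nlinarith [sq_nonneg (deriv a r)]
  refine ⟨h.mono' ((measurable_deriv a).pow_const 2).aestronglyMeasurable
    (ae_of_all _ fun r => ?_), (memLp_two_iff_integrable_sq (aestronglyMeasurable_mul_deriv f)).2
    ((h.const_mul 2).mono' ((aestronglyMeasurable_mul_deriv f).pow 2) (ae_of_all _ fun r => ?_))⟩
  · rw [Real.norm_eq_abs, abs_of_nonneg (sq_nonneg _)]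
    exact (key r).1
  · rw [Real.norm_eq_abs, abs_of_nonneg (sq_nonneg _)]
    exact (key r).2

lemma locallyIntegrableOn_deriv_sq_of_memLp {h : ℝ → ℝ}
    (hd : MemLp (fun r => r * deriv h r) 2 (volume.restrict (Ioi 0))) :
    LocallyIntegrableOn (fun r => deriv h r ^ 2) (Ioi 0) := by
  have h1 : LocallyIntegrableOn (fun r => (r * deriv h r) ^ 2) (Ioi 0) :=
    IntegrableOn.locallyIntegrableOn hd.integrable_sq
  have h2 : ContinuousOn (fun r : ℝ => 1 / r ^ 2) (Ioi 0) :=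
    continuousOn_const.div (by fun_prop) fun r hr => pow_ne_zero 2 (ne_of_gt hr)
  have h3 := h1.continuousOn_mul h2 isOpen_Ioi.isLocallyClosed
  refine locallyIntegrableOn_Ioi_of_Icc fun s t hs hst =>
    (h3.integrableOn_Icc_of_pos hs (t := t)).congr_fun (fun r hr => ?_) measurableSet_Icc
  have hr0 : 0 < r := hs.trans_le hr.1
  simp only []
  field_simp

lemma integrableOn_cross {G : ℝ → ℝ}
    (h1 : MemLp (fun r => r * deriv g r) 2 (volume.restrict (Ioi 0)))
    (h2 : MemLp (fun r => a r * g r) 2 (volume.restrict (Ioi 0)))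
    (h3 : MemLp (fun r => r * deriv G r) 2 (volume.restrict (Ioi 0)))
    (h4 : MemLp (fun r => a r * G r) 2 (volume.restrict (Ioi 0))) :
    IntegrableOn (fun r => r ^ 2 * deriv g r * deriv G r + 2 * a r ^ 2 * g r * G r) (Ioi 0) := by
  refine ((h1.integrable_mul h3).add ((h2.integrable_mul h4).const_mul 2)).congr
    (ae_of_all _ fun r => ?_)
  simp only [Pi.add_apply, Pi.mul_apply]
  ring

end Energy

/-! ### Weak solutions of the constraint equation -/

/-- `g` solves `(r² g')' = 2 a² g` weakly, tested against functions vanishing at infinity. -/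
def WeakSol (a g : ℝ → ℝ) : Prop :=
  ∀ G : ℝ → ℝ, LocACIoi G → Tendsto G atTop (nhds 0) →
    MemLp (fun r => r * deriv G r) 2 (volume.restrict (Ioi 0)) →
    ∫ r in Ioi (0 : ℝ), (r ^ 2 * deriv g r * deriv G r + 2 * a r ^ 2 * g r * G r) = 0

lemma memLp_bounded_mul {a G : ℝ → ℝ} {M : ℝ} (ha : ContinuousOn a (Ioi 0))
    (hM : ∀ r, 0 < r → |a r| ≤ M) (hG : MemLp G 2 (volume.restrict (Ioi 0))) :
    MemLp (fun r => a r * G r) 2 (volume.restrict (Ioi 0)) := by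
  refine MemLp.of_le_mul (c := M) hG ((ha.aestronglyMeasurable measurableSet_Ioi).mul hG.1) ?_
  filter_upwards [ae_restrict_mem measurableSet_Ioi] with r hr
  rw [norm_mul]
  exact mul_le_mul_of_nonneg_right (hM r hr) (norm_nonneg _)

lemma Constrained.weakSol {κ ω q : ℝ} {a f g : ℝ → ℝ} {M : ℝ} (h : Constrained κ ω q a f g)
    (hM : ∀ r, 0 < r → |a r| ≤ M) : WeakSol a g := by
  intro G hG hG0 hGd
  have ha := h.1.locAC_a.locACIoi.continuousOn
  exact (h.2 G hG hG0 ((integrableOn_calE2_iff ha hG.continuousOn).2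
    ⟨hGd, memLp_bounded_mul ha hM (hG.hardy hG0 hGd).1⟩)).2

lemma Admissible.constrained {κ ω q : ℝ} {a f g : ℝ → ℝ} (hκ : 0 < κ)
    (h : Admissible κ ω q a f g) (hw : WeakSol a g) : Constrained κ ω q a f g := by
  have ha := h.locAC_a.locACIoi.continuousOn
  have hg := h.locAC_g.locACIoi.continuousOn
  have hE := (integrableOn_calE2_iff ha hg).1
    (h.finite_energy.integrableOn hκ ha h.locAC_f.locACIoi.continuousOn).2
  refine ⟨h, fun G hG hG0 hGi => ?_⟩
  obtain ⟨k1, k2⟩ := (integrableOn_calE2_iff ha hG.continuousOn).1 hGi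
  exact ⟨integrableOn_cross hE.1 hE.2 k1 k2, hw G hG hG0 k1⟩

lemma exists_bound_of_continuousOn_Ici {a : ℝ → ℝ} (ha : ContinuousOn a (Ici 0))
    (h0 : Tendsto a atTop (nhds 0)) : ∃ M, ∀ r, 0 < r → |a r| ≤ M := by
  obtain ⟨R, hR⟩ := eventually_atTop.1
    ((tendsto_zero_iff_abs_tendsto_zero a).1 h0 |>.eventually (gt_mem_nhds one_pos))
  obtain ⟨C, hC⟩ := isCompact_Icc.exists_bound_of_continuousOn
    (ha.mono (Icc_subset_Ici_self : Icc 0 R ⊆ Ici 0))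
  refine ⟨max C 1, fun r hr => ?_⟩
  rcases le_total r R with h | h
  · exact (hC r ⟨hr.le, h⟩).trans (le_max_left _ _)
  · exact (hR r h).le.trans (le_max_right _ _)

/-! ### Re-solving the constraint for a perturbed gauge amplitude -/

namespace IsTest

variable {η : ℝ → ℝ}

lemma locACIoi (h : IsTest η) : LocACIoi η := ContDiff.locACIoi h.1

lemma eventuallyEq_zero_atTop (h : IsTest η) : ∀ᶠ r in atTop, η r = 0 := by
  obtain ⟨s, t, -, -, -, hst⟩ := exists_Icc_of_tsupport_subset_Ioi h.2.1 h.2.2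
  filter_upwards [eventually_gt_atTop t] with r hr
  exact eq_zero_of_notMem_of_tsupport_subset hst fun h => hr.not_ge h.2

lemma tendsto_atTop (h : IsTest η) : Tendsto η atTop (nhds 0) :=
  tendsto_const_nhds.congr' (h.eventuallyEq_zero_atTop.mono fun _ hr => hr.symm)

lemma apply_zero (h : IsTest η) : η 0 = 0 :=
  eq_zero_of_notMem_of_tsupport_subset h.2.2 (lt_irrefl (0 : ℝ))

lemma memLp (h : IsTest η) : MemLp η 2 (volume.restrict (Ioi 0)) :=
  (h.1.continuous.memLp_of_hasCompactSupport h.2.1).restrict _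

lemma memLp_mul_deriv (h : IsTest η) :
    MemLp (fun r => r * deriv η r) 2 (volume.restrict (Ioi 0)) :=
  ((continuous_id.mul h.continuous_deriv).memLp_of_hasCompactSupport h.2.1.deriv.mul_left).restrict _

lemma exists_bound (h : IsTest η) : ∃ D, ∀ r, |η r| ≤ D :=
  h.1.continuous.bounded_above_of_compact_support h.2.1

end IsTest

section Partner

variable {a g : ℝ → ℝ}

lemma WeakSol.exists_tendsto {k : ℝ → ℝ} (ha : ContinuousOn a (Ioi 0)) (hk : LocACIoi k)
    (hw : WeakSol a k) (hint : IntegrableOn (fun r => k r * (r * deriv k r)) (Ioc 0 1)) :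
    ∃ l, Tendsto k (nhdsWithin 0 (Ioi 0)) (nhds l) := by
  have hQ : ContinuousOn (fun r => 2 * a r ^ 2 * k r) (Ioi 0) :=
    (continuousOn_const.mul (ha.pow 2)).mul hk.continuousOn
  obtain ⟨h1, -, h3⟩ := hk.regularity_of_weak_eq (c := fun r => r ^ 2)
    (Q := fun r => 2 * a r ^ 2 * k r) (by fun_prop) (fun r hr => (pow_pos hr 2).ne')
    (hQ.locallyIntegrableOn measurableSet_Ioi)
    (fun η hη => hw η hη.locACIoi hη.tendsto_atTop hη.memLp_mul_deriv)
  exact exists_tendsto_nhdsGT_zero h1 (h3 hQ) hint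

lemma LocACIoi.ae_deriv_add {h k : ℝ → ℝ} (hh : LocACIoi h) (hk : LocACIoi k) :
    ∀ᵐ r ∂volume.restrict (Ioi 0), deriv (fun x => h x + k x) r = deriv h r + deriv k r := by
  filter_upwards [hh.ae_hasDerivAt, hk.ae_hasDerivAt] with r h1 h2
  exact (h1.add h2).deriv

lemma deriv_eqOn_Ioi {h k : ℝ → ℝ} (hk : EqOn k h (Ioi 0)) : EqOn (deriv k) (deriv h) (Ioi 0) :=
  hk.deriv isOpen_Ioi

theorem exists_constrained_partner {a₁ : ℝ → ℝ} {M q : ℝ}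
    (ha₁ : ContinuousOn a₁ (Ioi 0)) (hM : ∀ r, 0 < r → |a₁ r| ≤ M)
    (hg : LocAC g) (hgq : Tendsto g atTop (nhds q))
    (hgd : MemLp (fun r => r * deriv g r) 2 (volume.restrict (Ioi 0)))
    (ha₁g : MemLp (fun r => a₁ r * g r) 2 (volume.restrict (Ioi 0)))
    (hsol : WeakSol a g) {w : ℝ → ℝ} (hw : MemLp w 2 (volume.restrict (Ioi 0)))
    (hweq : ∀ r, 0 < r → w r = -2 * (a₁ r ^ 2 - a r ^ 2) * g r) :
    ∃ h g₁, LocACIoi h ∧ Tendsto h atTop (nhds 0) ∧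
      MemLp (fun r => r * deriv h r) 2 (volume.restrict (Ioi 0)) ∧
      ∫ r in Ioi (0 : ℝ), calE2 a₁ h r ≤ 6 * ∫ r in Ioi (0 : ℝ), w r ^ 2 ∧
      LocAC g₁ ∧ Tendsto g₁ atTop (nhds q) ∧ EqOn g₁ (fun r => g r + h r) (Ioi 0) ∧
      MemLp (fun r => r * deriv g₁ r) 2 (volume.restrict (Ioi 0)) ∧
      MemLp (fun r => a₁ r * g₁ r) 2 (volume.restrict (Ioi 0)) ∧ WeakSol a₁ g₁ := by
  obtain ⟨h, hh, hh0, hhd, hhs, hhe⟩ := exists_weak_solution ha₁ hM hw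
  have hgI := hg.locACIoi
  have hhL := (hh.hardy hh0 hhd).1
  have hah := memLp_bounded_mul ha₁ hM hhL
  set k : ℝ → ℝ := fun r => g r + h r with hkdef
  have hk : LocACIoi k := hgI.add hh
  have hkq : Tendsto k atTop (nhds q) := by simpa using hgq.add hh0
  have hdk := hgI.ae_deriv_add hh
  have hkd : MemLp (fun r => r * deriv k r) 2 (volume.restrict (Ioi 0)) := by
    refine (hgd.add hhd).ae_eq ?_
    filter_upwards [hdk] with r hr
    simp only [Pi.add_apply, hkdef, hr]
    ring
  have hak : MemLp (fun r => a₁ r * k r) 2 (volume.restrict (Ioi 0)) := by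
    refine (ha₁g.add hah).ae_eq (ae_of_all _ fun r => ?_)
    simp only [Pi.add_apply, hkdef]
    ring
  have hkw : WeakSol a₁ k := by
    intro G hG hG0 hGd
    have hGL := (hG.hardy hG0 hGd).1
    have i1 : IntegrableOn
        (fun r => r ^ 2 * deriv h r * deriv G r + 2 * a₁ r ^ 2 * h r * G r) (Ioi 0) :=
      integrableOn_cross hhd hah hGd (memLp_bounded_mul ha₁ hM hGL)
    have i2 : IntegrableOn (fun r => w r * G r) (Ioi 0) := hw.integrable_mul hGL
    have i3 : IntegrableOn
        (fun r => r ^ 2 * deriv k r * deriv G r + 2 * a₁ r ^ 2 * k r * G r) (Ioi 0) :=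
      integrableOn_cross hkd hak hGd (memLp_bounded_mul ha₁ hM hGL)
    have e1 := hsol G hG hG0 hGd
    have e2 := hhs G hG hG0 hGd
    have e3 : ∫ r in Ioi (0 : ℝ), (r ^ 2 * deriv g r * deriv G r + 2 * a r ^ 2 * g r * G r) =
        ∫ r in Ioi (0 : ℝ), ((r ^ 2 * deriv k r * deriv G r + 2 * a₁ r ^ 2 * k r * G r)
          - (r ^ 2 * deriv h r * deriv G r + 2 * a₁ r ^ 2 * h r * G r) + w r * G r) := by
      refine integral_congr_ae ?_
      filter_upwards [hdk, ae_restrict_mem measurableSet_Ioi] with r hr hr0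
      simp only [hr, hweq r hr0, hkdef]
      ring
    have e4 := integral_add (i3.sub i1) i2
    have e5 := integral_sub i3 i1
    simp only [Pi.sub_apply] at e4 e5
    linarith
  obtain ⟨l, hl⟩ : ∃ l, Tendsto k (nhdsWithin 0 (Ioi 0)) (nhds l) := by
    refine hkw.exists_tendsto ha₁ hk ?_
    have hle : volume.restrict (Ioc (0 : ℝ) 1) ≤ volume.restrict (Ioi 0) :=
      Measure.restrict_mono Ioc_subset_Ioi_self le_rfl
    have hgL : MemLp g 2 (volume.restrict (Ioc (0 : ℝ) 1)) := by
      obtain ⟨C, hC⟩ := isCompact_Icc.exists_bound_of_continuousOn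
        (hg.1.mono (Icc_subset_Ici_self : Icc (0 : ℝ) 1 ⊆ Ici 0))
      refine MemLp.of_bound ((hgI.continuousOn.mono Ioc_subset_Ioi_self).aestronglyMeasurable
        measurableSet_Ioc) C ?_
      filter_upwards [ae_restrict_mem measurableSet_Ioc] with r hr
      exact hC r (Ioc_subset_Icc_self hr)
    exact (hgL.add (hhL.mono_measure hle)).integrable_mul (hkd.mono_measure hle)
  have hE : EqOn (Function.update k 0 l) k (Ioi 0) := fun r hr =>
    Function.update_of_ne (ne_of_gt hr) _ _
  have hdE := deriv_eqOn_Ioi hE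
  have hset : Ici (0 : ℝ) \ {0} = Ioi 0 := Ici_sdiff_left
  refine ⟨h, Function.update k 0 l, hh, hh0, hhd, hhe, ⟨?_, hk.congr hE⟩,
    hkq.congr' ?_, hE, hkd.ae_eq ?_, hak.ae_eq ?_, fun G hG hG0 hGd => ?_⟩
  · intro r hr
    rcases (mem_Ici.1 hr).eq_or_lt with rfl | hr
    · rw [continuousWithinAt_update_same, hset]
      exact hl
    · refine ContinuousAt.continuousWithinAt ?_
      exact ((hk.congr hE).continuousOn).continuousAt (Ioi_mem_nhds hr)
  · filter_upwards [eventually_gt_atTop 0] with r hr using (hE hr).symm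
  · filter_upwards [ae_restrict_mem measurableSet_Ioi] with r hr
    rw [hdE hr]
  · filter_upwards [ae_restrict_mem measurableSet_Ioi] with r hr
    rw [hE hr]
  · refine Eq.trans ?_ (hkw G hG hG0 hGd)
    refine setIntegral_congr_fun measurableSet_Ioi fun r hr => ?_
    simp only [hE hr, hdE hr]

end Partner

/-! ### The action along a variation, compared with the constrained class -/

section Comparison

variable {κ ω q : ℝ} {a f g : ℝ → ℝ}

lemma actionL_add_of_weakSol {u k : ℝ → ℝ} (h1 : IntegrableOn (calE1 κ a f) (Ioi 0))
    (ha : ContinuousOn a (Ioi 0)) (hg : LocACIoi g) (hk : LocACIoi k)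
    (hk0 : Tendsto k atTop (nhds 0))
    (hgd : MemLp (fun r => r * deriv g r) 2 (volume.restrict (Ioi 0)))
    (hag : MemLp (fun r => a r * g r) 2 (volume.restrict (Ioi 0)))
    (hkd : MemLp (fun r => r * deriv k r) 2 (volume.restrict (Ioi 0)))
    (hak : MemLp (fun r => a r * k r) 2 (volume.restrict (Ioi 0)))
    (hw : WeakSol a g) (hu : EqOn u (fun r => g r + k r) (Ioi 0)) :
    actionL κ a f u = actionL κ a f g - ∫ r in Ioi (0 : ℝ), calE2 a k r := by
  have hgi := (integrableOn_calE2_iff ha hg.continuousOn).2 ⟨hgd, hag⟩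
  have hki := (integrableOn_calE2_iff ha hk.continuousOn).2 ⟨hkd, hak⟩
  have hci := integrableOn_cross hgd hag hkd hak
  have e0 := hw k hk hk0 hkd
  have e1 := integral_sub (h1.sub hgi) hki
  have e2 := integral_sub ((h1.sub hgi).sub hki) (hci.const_mul 2)
  have e3 := integral_const_mul (μ := volume.restrict (Ioi (0 : ℝ))) (2 : ℝ)
    (fun r => r ^ 2 * deriv g r * deriv k r + 2 * a r ^ 2 * g r * k r)
  have e4 : actionL κ a f u = ∫ r in Ioi (0 : ℝ), (calE1 κ a f r - calE2 a g r - calE2 a k r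
      - 2 * (r ^ 2 * deriv g r * deriv k r + 2 * a r ^ 2 * g r * k r)) := by
    refine integral_congr_ae ?_
    filter_upwards [hg.ae_deriv_add hk, ae_restrict_mem measurableSet_Ioi] with r hr hr0
    simp only [calE2, hu hr0, deriv_eqOn_Ioi hu hr0, hr]
    ring
  simp only [Pi.sub_apply] at e1 e2
  unfold actionL at e4 ⊢
  linarith

lemma calE2_sub_le {h k : ℝ → ℝ} (hh : LocACIoi h) (hk : LocACIoi k) (t : ℝ) :
    ∀ᵐ r ∂volume.restrict (Ioi 0), calE2 a (fun r => t * k r + -1 * h r) r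
      ≤ 2 * t ^ 2 * calE2 a k r + 2 * calE2 a h r := by
  filter_upwards [hh.ae_hasDerivAt, hk.ae_hasDerivAt] with r h1 h2
  have h3 := ((h2.const_mul t).add (h1.const_mul (-1))).deriv
  change deriv (fun r => t * k r + -1 * h r) r = _ at h3
  simp only [calE2, h3]
  nlinarith [sq_nonneg (r * (t * deriv k r + deriv h r)), sq_nonneg (a r * (t * k r + h r))]

lemma integrableOn_calE1_add_mul {da df : ℝ → ℝ} (ha : LocACIoi a) (hf : LocACIoi f)
    (hκ : 0 < κ) (h1 : IntegrableOn (calE1 κ a f) (Ioi 0)) (hda : IsTest da) (hdf : IsTest df)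
    {t : ℝ} (ht : |t| ≤ 1) :
    IntegrableOn (calE1 κ (fun r => a r + t * da r) (fun r => f r + t * df r)) (Ioi 0) := by
  obtain ⟨k1, k2⟩ := integrableOn_deriv_sq_of_calE1 hκ h1
  have := (action_variation (κ := κ) ha hf isTest_zero.locACIoi k1.locallyIntegrableOn
    (locallyIntegrableOn_deriv_sq_of_memLp k2)
    (locallyIntegrableOn_deriv_sq_of_memLp isTest_zero.memLp_mul_deriv)
    (by simpa [calE2] using h1) hda hdf isTest_zero).1 t ht
  simpa [calE2] using this

lemma LocAC.add_mul {h η : ℝ → ℝ} (hh : LocAC h) (hη : IsTest η) (t : ℝ) :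
    LocAC (fun r => h r + t * η r) :=
  ⟨hh.1.add (continuous_const.mul hη.1.continuous).continuousOn,
    hh.locACIoi.add (hη.locACIoi.const_mul t)⟩

lemma IsTest.tendsto_add_mul {h η : ℝ → ℝ} {l : ℝ} (hη : IsTest η) (hh : Tendsto h atTop (nhds l))
    (t : ℝ) : Tendsto (fun r => h r + t * η r) atTop (nhds l) := by
  simpa using hh.add (hη.tendsto_atTop.const_mul t)

theorem exists_actionL_le_add_sq {da df dg : ℝ → ℝ} (hκ : 0 < κ)
    (hafg : Constrained κ ω q a f g)
    (hmin : ∀ a₁ f₁ g₁ : ℝ → ℝ, Constrained κ ω q a₁ f₁ g₁ →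
      actionL κ a f g ≤ actionL κ a₁ f₁ g₁)
    (hda : IsTest da) (hdf : IsTest df) (hdg : IsTest dg) :
    ∃ C : ℝ, ∀ t : ℝ, |t| ≤ 1 → actionL κ a f g ≤
      actionL κ (fun r => a r + t * da r) (fun r => f r + t * df r) (fun r => g r + t * dg r)
        + C * t ^ 2 := by
  obtain ⟨M, hM⟩ := exists_bound_of_continuousOn_Ici hafg.1.locAC_a.1 hafg.1.a_infty
  obtain ⟨D, hD⟩ := hda.exists_bound
  have haI := hafg.1.locAC_a.locACIoi
  have hfI := hafg.1.locAC_f.locACIoi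
  have hgI := hafg.1.locAC_g.locACIoi
  obtain ⟨hE1, hE2⟩ := hafg.1.finite_energy.integrableOn hκ haI.continuousOn hfI.continuousOn
  obtain ⟨hgd, hag⟩ := (integrableOn_calE2_iff haI.continuousOn hgI.continuousOn).1 hE2
  have hsol := hafg.weakSol hM
  have hM0 : 0 ≤ M := (abs_nonneg _).trans (hM 1 one_pos)
  have hD0 : 0 ≤ D := (abs_nonneg _).trans (hD 1)
  set K := M + D with hK
  have hdag : IntegrableOn (fun r => (da r * g r) ^ 2) (Ioi 0) := by
    have := integrableOn_mul_of_tsupport_subset (F := fun r => da r * g r ^ 2) (η := da)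
      (((hda.1.continuous.continuousOn).mul (hgI.continuousOn.pow 2)).locallyIntegrableOn
        measurableSet_Ioi) hda.1.continuous hda.2.1 hda.2.2
    refine this.congr (ae_of_all _ fun r => ?_)
    simp only []
    ring
  have hdagL : MemLp (fun r => da r * g r) 2 (volume.restrict (Ioi 0)) :=
    (memLp_two_iff_integrable_sq ((hda.1.continuous.continuousOn.mul
      hgI.continuousOn).aestronglyMeasurable measurableSet_Ioi)).2 hdag
  set I₁ := ∫ r in Ioi (0 : ℝ), (da r * g r) ^ 2 with hI₁
  set I₂ := ∫ r in Ioi (0 : ℝ), ((r * deriv dg r) ^ 2 + 2 * K ^ 2 * dg r ^ 2) with hI₂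
  refine ⟨2 * I₂ + 192 * K ^ 2 * I₁, fun t ht => ?_⟩
  set a₁ : ℝ → ℝ := fun r => a r + t * da r with ha₁
  set f₁ : ℝ → ℝ := fun r => f r + t * df r with hf₁
  have htda : ∀ r, |t * da r| ≤ D := fun r => by
    rw [abs_mul]
    exact (mul_le_of_le_one_left (abs_nonneg _) ht).trans (hD r)
  have hbd : ∀ r, 0 < r → |a₁ r| ≤ K := fun r hr =>
    (abs_add_le _ _).trans (add_le_add (hM r hr) (htda r))
  have ha₁A : LocAC a₁ := hafg.1.locAC_a.add_mul hda t
  have hf₁A : LocAC f₁ := hafg.1.locAC_f.add_mul hdf t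
  have ha₁c := ha₁A.locACIoi.continuousOn
  have hE1' : IntegrableOn (calE1 κ a₁ f₁) (Ioi 0) :=
    integrableOn_calE1_add_mul haI hfI hκ hE1 hda hdf ht
  have ha₁g : MemLp (fun r => a₁ r * g r) 2 (volume.restrict (Ioi 0)) := by
    refine (hag.add (hdagL.const_mul t)).ae_eq (ae_of_all _ fun r => ?_)
    simp only [Pi.add_apply, ha₁]
    ring
  set w : ℝ → ℝ := fun r => -2 * t * (a₁ r + a r) * (da r * g r) with hw
  have hsum : ∀ r, 0 < r → |-2 * t * (a₁ r + a r)| ≤ 4 * K * |t| := fun r hr => by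
    rw [abs_mul, abs_mul, abs_neg, abs_two]
    have := (abs_add_le (a₁ r) (a r)).trans (add_le_add (hbd r hr) (hM r hr))
    nlinarith [abs_nonneg t]
  have hwL : MemLp w 2 (volume.restrict (Ioi 0)) :=
    memLp_bounded_mul (continuousOn_const.mul (ha₁c.add haI.continuousOn)) hsum hdagL
  have hwle : ∫ r in Ioi (0 : ℝ), w r ^ 2 ≤ 16 * K ^ 2 * t ^ 2 * I₁ := by
    rw [hI₁, ← integral_const_mul]
    refine integral_mono_ae hwL.integrable_sq (hdag.const_mul _) ?_
    filter_upwards [ae_restrict_mem measurableSet_Ioi] with r hr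
    have h1 := sq_le_sq' (neg_le_of_abs_le (hsum r hr)) (le_of_abs_le (hsum r hr))
    rw [mul_pow (4 * K), sq_abs] at h1
    simp only [hw]
    rw [mul_pow _ (da r * g r)]
    refine mul_le_mul_of_nonneg_right (h1.trans_eq (by ring)) (sq_nonneg _)
  obtain ⟨h, g₁, hh, hh0, hhd, hhe, hg₁, hg₁q, hg₁e, hg₁d, hag₁, hsol₁⟩ :=
    exists_constrained_partner ha₁c hbd hafg.1.locAC_g hafg.1.g_infty hgd ha₁g hsol hwL
      (fun r _ => by simp only [hw, ha₁]; ring)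
  have hE2' := (integrableOn_calE2_iff ha₁c hg₁.locACIoi.continuousOn).2 ⟨hg₁d, hag₁⟩
  have hadm : Admissible κ ω q a₁ f₁ g₁ :=
    { locAC_a := ha₁A
      locAC_f := hf₁A
      locAC_g := hg₁
      a_zero := by simp [ha₁, hafg.1.a_zero, hda.apply_zero]
      f_zero := by simp [hf₁, hafg.1.f_zero, hdf.apply_zero]
      a_infty := hda.tendsto_add_mul hafg.1.a_infty t
      f_infty := hdf.tendsto_add_mul hafg.1.f_infty t
      g_infty := hg₁q
      finite_energy := hE1'.add hE2' }
  have hle := hmin a₁ f₁ g₁ (hadm.constrained hκ hsol₁)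
  have hahL := memLp_bounded_mul ha₁c hbd (hh.hardy hh0 hhd).1
  have hadgL := memLp_bounded_mul ha₁c hbd hdg.memLp
  have hkI : LocACIoi (fun r => t * dg r + -1 * h r) :=
    (hdg.locACIoi.const_mul t).add (hh.const_mul (-1))
  have hk0 : Tendsto (fun r => t * dg r + -1 * h r) atTop (nhds 0) := by
    simpa using (hdg.tendsto_atTop.const_mul t).add (hh0.const_mul (-1))
  have hkd : MemLp (fun r => r * deriv (fun r => t * dg r + -1 * h r) r) 2
      (volume.restrict (Ioi 0)) := by
    refine ((hdg.memLp_mul_deriv.const_mul t).add (hhd.const_mul (-1))).ae_eq ?_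
    filter_upwards [hh.ae_hasDerivAt, hdg.locACIoi.ae_hasDerivAt] with r h1 h2
    have h3 := ((h2.const_mul t).add (h1.const_mul (-1))).deriv
    change deriv (fun r => t * dg r + -1 * h r) r = _ at h3
    simp only [Pi.add_apply, h3]
    ring
  have hak : MemLp (fun r => a₁ r * (t * dg r + -1 * h r)) 2 (volume.restrict (Ioi 0)) := by
    refine ((hadgL.const_mul t).add (hahL.const_mul (-1))).ae_eq (ae_of_all _ fun r => ?_)
    simp only [Pi.add_apply]
    ring
  have hsplit := actionL_add_of_weakSol (u := fun r => g r + t * dg r) hE1' ha₁c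
    hg₁.locACIoi hkI hk0 hg₁d hag₁ hkd hak hsol₁ (fun r hr => by
      simp only [hg₁e hr]
      ring)
  have hki := (integrableOn_calE2_iff ha₁c hkI.continuousOn).2 ⟨hkd, hak⟩
  have hhi := (integrableOn_calE2_iff ha₁c hh.continuousOn).2 ⟨hhd, hahL⟩
  have hdgi := (integrableOn_calE2_iff ha₁c hdg.locACIoi.continuousOn).2
    ⟨hdg.memLp_mul_deriv, hadgL⟩
  have e1 := integral_mono_ae hki ((hdgi.const_mul (2 * t ^ 2)).add (hhi.const_mul 2))
    (calE2_sub_le hh hdg.locACIoi t)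
  have e2 := integral_add (hdgi.const_mul (2 * t ^ 2)) (hhi.const_mul 2)
  have e3 : ∫ r in Ioi (0 : ℝ), calE2 a₁ dg r ≤ I₂ := by
    refine integral_mono_ae hdgi
      (hdg.memLp_mul_deriv.integrable_sq.add (hdg.memLp.integrable_sq.const_mul _)) ?_
    filter_upwards [ae_restrict_mem measurableSet_Ioi] with r hr
    have h1 := sq_le_sq' (neg_le_of_abs_le (hbd r hr)) (le_of_abs_le (hbd r hr))
    simp only [calE2]
    nlinarith [mul_le_mul_of_nonneg_right h1 (sq_nonneg (dg r))]
  rw [integral_const_mul, integral_const_mul] at e2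
  simp only [Pi.add_apply] at e1 e2
  have e4 := mul_le_mul_of_nonneg_left e3 (sq_nonneg t)
  rw [hsplit]
  nlinarith

end Comparison

theorem firstVariation_eq_zero {κ ω q : ℝ} {a f g da df dg : ℝ → ℝ} (hκ : 0 < κ)
    (hafg : Constrained κ ω q a f g)
    (hmin : ∀ a₁ f₁ g₁ : ℝ → ℝ, Constrained κ ω q a₁ f₁ g₁ →
      actionL κ a f g ≤ actionL κ a₁ f₁ g₁)
    (hda : IsTest da) (hdf : IsTest df) (hdg : IsTest dg) :
    HasDerivAt (fun t : ℝ => actionL κ (fun r => a r + t * da r) (fun r => f r + t * df r)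
      (fun r => g r + t * dg r)) 0 0 ∧
    ∫ r in Ioi 0, dlagr κ r (a r) (f r) (g r) (deriv a r) (deriv f r) (deriv g r)
        (da r) (df r) (dg r) (deriv da r) (deriv df r) (deriv dg r) = 0 := by
  have haI := hafg.1.locAC_a.locACIoi
  have hfI := hafg.1.locAC_f.locACIoi
  have hgI := hafg.1.locAC_g.locACIoi
  obtain ⟨hE1, hE2⟩ := hafg.1.finite_energy.integrableOn hκ haI.continuousOn hfI.continuousOn
  obtain ⟨hgd, -⟩ := (integrableOn_calE2_iff haI.continuousOn hgI.continuousOn).1 hE2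
  obtain ⟨k1, k2⟩ := integrableOn_deriv_sq_of_calE1 hκ hE1
  have hder := (action_variation (κ := κ) haI hfI hgI k1.locallyIntegrableOn
    (locallyIntegrableOn_deriv_sq_of_memLp k2) (locallyIntegrableOn_deriv_sq_of_memLp hgd)
    (hE1.sub hE2) hda hdf hdg).2
  obtain ⟨C, hC⟩ := exists_actionL_le_add_sq hκ hafg hmin hda hdf hdg
  have hlm : IsLocalMin (fun t : ℝ => actionL κ (fun r => a r + t * da r)
      (fun r => f r + t * df r) (fun r => g r + t * dg r) + C * t ^ 2) 0 := by
    filter_upwards [Metric.closedBall_mem_nhds (0 : ℝ) one_pos] with t ht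
    have := hC t (by simpa using ht)
    simpa using this
  have hder' := hder.add ((hasDerivAt_pow 2 (0 : ℝ)).const_mul C)
  have h0 := hlm.hasDerivAt_eq_zero hder'
  simp only [Nat.cast_ofNat, Nat.add_one_sub_one, pow_one, mul_zero, add_zero] at h0
  exact ⟨hder.congr_deriv h0, h0⟩

/-- a minimizer of `L` over `𝒞` is a critical point of `L` with
respect to all compactly supported `C¹` variations (no Lagrange multiplier
arises from the constraint), and it satisfies the dyon equations (4)-(6). -/
theorem minimizer_solves_equations
    (κ ω q : ℝ) (hκ : 0 < κ) (hω : ω ∈ Set.Ioo (Real.pi / 2) Real.pi)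
    (hq0 : 0 < q) (hq1 : q < (Real.sqrt 2 / Real.pi) * (Real.pi - ω))
    (hq2 : q < (1 / Real.sqrt 2) * Real.sin ω)
    (a f g : ℝ → ℝ) (hafg : Constrained κ ω q a f g)
    (hmin : ∀ a₁ f₁ g₁ : ℝ → ℝ, Constrained κ ω q a₁ f₁ g₁ →
      actionL κ a f g ≤ actionL κ a₁ f₁ g₁) :
    (∀ atil ftil gtil : ℝ → ℝ,
      ContDiff ℝ 1 atil → HasCompactSupport atil → tsupport atil ⊆ Set.Ioi 0 →
      ContDiff ℝ 1 ftil → HasCompactSupport ftil → tsupport ftil ⊆ Set.Ioi 0 →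
      ContDiff ℝ 1 gtil → HasCompactSupport gtil → tsupport gtil ⊆ Set.Ioi 0 →
      HasDerivAt (fun t : ℝ =>
          actionL κ (fun r => a r + t * atil r) (fun r => f r + t * ftil r)
            (fun r => g r + t * gtil r)) 0 0) ∧
    DyonEqs κ a f g := by
  have key := fun {da df dg : ℝ → ℝ} (hda : IsTest da) (hdf : IsTest df) (hdg : IsTest dg) =>
    firstVariation_eq_zero hκ hafg hmin hda hdf hdg
  refine ⟨fun atil ftil gtil a1 a2 a3 f1 f2 f3 g1 g2 g3 =>
    (key ⟨a1, a2, a3⟩ ⟨f1, f2, f3⟩ ⟨g1, g2, g3⟩).1, ?_⟩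
  have hE1 := (hafg.1.finite_energy.integrableOn hκ hafg.1.locAC_a.locACIoi.continuousOn
    hafg.1.locAC_f.locACIoi.continuousOn).1
  exact dyonEqs_of_critical hκ hafg.1.locAC_a.locACIoi hafg.1.locAC_f.locACIoi
    hafg.1.locAC_g.locACIoi
    (locallyIntegrableOn_deriv_sq_of_memLp (integrableOn_deriv_sq_of_calE1 hκ hE1).2)
    fun _ _ _ hda hdf hdg => (key hda hdf hdg).2
end
end

section
/- Let ω ∈ (π/2, π) and let q satisfy 0 < q < (√2/π)(π − ω) and q < (1/√2)·sin ω. Let (a,f,g) ∈ 𝒞 be a minimizer of L over 𝒞 which is twice continuously differentiable on (0,∞), satisfies the dyon equations (4), (5), (6) on (0,∞), and satisfies a ≥ 0, 0 ≤ f ≤ π/2, 0 ≤ g ≤ q. Then a(r) > 0, 0 < f(r) < π − ω, and 0 < g(r) < q for all r > 0, and f and g are strictly increasing on (0,∞). -/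
open Real MeasureTheory Set Filter

noncomputable section

/-- A solution of the planar linear system `x' = p y`, `y' = m x` on `(0,∞)` with continuous
coefficients that vanishes at one point has vanishing first component. -/
theorem eq_zero_of_linear_system {x y p m : ℝ → ℝ}
    (hp : ContinuousOn p (Ioi 0)) (hm : ContinuousOn m (Ioi 0))
    (hx : ∀ r ∈ Ioi (0 : ℝ), HasDerivAt x (p r * y r) r)
    (hy : ∀ r ∈ Ioi (0 : ℝ), HasDerivAt y (m r * x r) r)
    {r₀ : ℝ} (hr₀ : 0 < r₀) (hx₀ : x r₀ = 0) (hy₀ : y r₀ = 0)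
    {s : ℝ} (hs : 0 < s) : x s = 0 := by
  have hsub : uIcc r₀ s ⊆ Ioi 0 := fun t ht => lt_of_lt_of_le (lt_min hr₀ hs) ht.1
  obtain ⟨K, hK⟩ := (isCompact_uIcc (a := r₀) (b := s)).exists_bound_of_continuousOn
    ((hp.add hm).mono hsub)
  have hbound : ∀ t ∈ uIcc r₀ s,
      |2 * (p t + m t) * (x t * y t)| ≤ K * (x t ^ 2 + y t ^ 2) := by
    intro t ht
    have h1 : |p t + m t| ≤ K := hK t ht
    have h2 : 2 * |x t * y t| ≤ x t ^ 2 + y t ^ 2 := by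
      rw [abs_mul, ← sq_abs (x t), ← sq_abs (y t)]
      nlinarith [sq_nonneg (|x t| - |y t|)]
    calc |2 * (p t + m t) * (x t * y t)| = |p t + m t| * (2 * |x t * y t|) := by
          rw [abs_mul, abs_mul, abs_two]; ring
      _ ≤ K * (x t ^ 2 + y t ^ 2) :=
          mul_le_mul h1 h2 (by positivity) ((abs_nonneg _).trans h1)
  have hder : ∀ c : ℝ, ∀ t ∈ Ioi (0 : ℝ),
      HasDerivAt (fun t => (x t ^ 2 + y t ^ 2) * exp (c * t))
        ((2 * (p t + m t) * (x t * y t) + c * (x t ^ 2 + y t ^ 2)) * exp (c * t)) t := by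
    intro c t ht
    have h := (((hx t ht).pow 2).add ((hy t ht).pow 2)).mul
      (((hasDerivAt_id t).const_mul c).exp)
    refine h.congr_deriv ?_
    simp only [id, Pi.add_apply, Pi.pow_apply]
    ring
  have hzero : x s ^ 2 + y s ^ 2 ≤ 0 := by
    rcases le_total r₀ s with h | h
    · have hU : uIcc r₀ s = Icc r₀ s := uIcc_of_le h
      have hanti : AntitoneOn (fun t => (x t ^ 2 + y t ^ 2) * exp (-K * t)) (Icc r₀ s) := by
        refine antitoneOn_of_hasDerivWithinAt_nonpos (convex_Icc _ _)
          (fun t ht => (hder _ t (hsub (hU ▸ ht))).continuousAt.continuousWithinAt)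
          (fun t ht => (hder _ t (hsub (hU ▸ interior_subset ht))).hasDerivWithinAt) ?_
        intro t ht
        have := (abs_le.1 (hbound t (hU ▸ interior_subset ht))).2
        exact mul_nonpos_of_nonpos_of_nonneg (by linarith) (exp_pos _).le
      have := hanti (left_mem_Icc.2 h) (right_mem_Icc.2 h) h
      simp only [hx₀, hy₀] at this
      exact nonpos_of_mul_nonpos_left (by simpa using this) (exp_pos (-K * s))
    · have hU : uIcc r₀ s = Icc s r₀ := uIcc_of_ge h
      have hmono : MonotoneOn (fun t => (x t ^ 2 + y t ^ 2) * exp (K * t)) (Icc s r₀) := by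
        refine monotoneOn_of_hasDerivWithinAt_nonneg (convex_Icc _ _)
          (fun t ht => (hder _ t (hsub (hU ▸ ht))).continuousAt.continuousWithinAt)
          (fun t ht => (hder _ t (hsub (hU ▸ interior_subset ht))).hasDerivWithinAt) ?_
        intro t ht
        have := (abs_le.1 (hbound t (hU ▸ interior_subset ht))).1
        exact mul_nonneg (by linarith) (exp_pos _).le
      have := hmono (left_mem_Icc.2 h) (right_mem_Icc.2 h) h
      simp only [hx₀, hy₀] at this
      exact nonpos_of_mul_nonpos_left (by simpa using this) (exp_pos (K * s))
  nlinarith [sq_nonneg (x s), sq_nonneg (y s)]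

theorem deriv_eq_zero_of_nonneg_of_eq_zero {h : ℝ → ℝ} (hh : ∀ r ∈ Ioi (0 : ℝ), 0 ≤ h r)
    {r : ℝ} (hr : 0 < r) (h0 : h r = 0) : deriv h r = 0 :=
  IsLocalMin.deriv_eq_zero <| by
    filter_upwards [Ioi_mem_nhds hr] with t ht
    rw [h0]
    exact hh t ht

theorem StrictMonoOn.lt_of_tendsto_atTop {h : ℝ → ℝ} {L : ℝ} (hh : StrictMonoOn h (Ioi 0))
    (hL : Tendsto h atTop (nhds L)) {r : ℝ} (hr : 0 < r) : h r < L := by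
  have hr1 : (0 : ℝ) < r + 1 := by linarith
  refine (hh hr hr1 (by linarith)).trans_le (ge_of_tendsto hL ?_)
  filter_upwards [eventually_ge_atTop (r + 1)] with t ht
  exact hh.monotoneOn hr1 (hr1.trans_le ht) ht

theorem MonotoneOn.le_of_tendsto_atTop {h : ℝ → ℝ} {L : ℝ} (hh : MonotoneOn h (Ioi 0))
    (hL : Tendsto h atTop (nhds L)) {r : ℝ} (hr : 0 < r) : h r ≤ L := by
  refine ge_of_tendsto hL ?_
  filter_upwards [eventually_ge_atTop r] with t ht
  exact hh hr (hr.trans_le ht) ht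

theorem strictMonoOn_Ioi_of_hasDerivAt_pos {h h' : ℝ → ℝ}
    (hd : ∀ r ∈ Ioi (0 : ℝ), HasDerivAt h (h' r) r) (hpos : ∀ r ∈ Ioi (0 : ℝ), 0 < h' r) :
    StrictMonoOn h (Ioi 0) :=
  strictMonoOn_of_hasDerivWithinAt_pos (convex_Ioi 0)
    (fun r hr => (hd r hr).continuousAt.continuousWithinAt)
    (fun r hr => (hd r (interior_subset hr)).hasDerivWithinAt)
    (fun r hr => hpos r (interior_subset hr))

theorem monotoneOn_Ioi_of_hasDerivAt_nonneg {h h' : ℝ → ℝ}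
    (hd : ∀ r ∈ Ioi (0 : ℝ), HasDerivAt h (h' r) r) (hpos : ∀ r ∈ Ioi (0 : ℝ), 0 ≤ h' r) :
    MonotoneOn h (Ioi 0) :=
  monotoneOn_of_hasDerivWithinAt_nonneg (convex_Ioi 0)
    (fun r hr => (hd r hr).continuousAt.continuousWithinAt)
    (fun r hr => (hd r (interior_subset hr)).hasDerivWithinAt)
    (fun r hr => hpos r (interior_subset hr))

theorem StrictMonoOn.pos_of_nonneg {u : ℝ → ℝ} (hu : StrictMonoOn u (Ioi 0))
    (h0 : ∀ r ∈ Ioi (0 : ℝ), 0 ≤ u r) {r : ℝ} (hr : 0 < r) : 0 < u r :=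
  (h0 (r / 2) (half_pos hr)).trans_lt (hu (half_pos hr) hr (half_lt_self hr))

/-- A nonnegative function vanishing at `0` whose weighted derivative `P f'` is nondecreasing
has `P f' ≥ 0`. -/
theorem weighted_deriv_nonneg_of_zero {f P : ℝ → ℝ} (hP : ∀ r ∈ Ioi (0 : ℝ), 0 < P r)
    (hc : ContinuousOn f (Ici 0)) (h0 : f 0 = 0) (hf : ∀ r ∈ Ioi (0 : ℝ), 0 ≤ f r)
    (hu : MonotoneOn (fun r => P r * deriv f r) (Ioi 0)) {r : ℝ} (hr : 0 < r) :
    0 ≤ P r * deriv f r := by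
  by_contra! hneg
  have hanti : StrictAntiOn f (Icc 0 r) := by
    refine strictAntiOn_of_deriv_neg (convex_Icc _ _) (hc.mono Icc_subset_Ici_self) ?_
    intro t ht
    rw [interior_Icc] at ht
    have := hu ht.1 hr ht.2.le
    exact neg_of_mul_neg_right (this.trans_lt hneg) (hP t ht.1).le
  have := hanti (left_mem_Icc.2 hr.le) (right_mem_Icc.2 hr.le) hr
  linarith [hf r hr]

/-- A function with values in `[0, q]` such that `r² g'` is nondecreasing has `r² g' ≥ 0`. -/
theorem sq_mul_deriv_nonneg_of_bounded {g : ℝ → ℝ} {q : ℝ}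
    (hd : ∀ r ∈ Ioi (0 : ℝ), DifferentiableAt ℝ g r)
    (hg : ∀ r ∈ Ioi (0 : ℝ), 0 ≤ g r ∧ g r ≤ q)
    (hu : MonotoneOn (fun r => r ^ 2 * deriv g r) (Ioi 0)) {r : ℝ} (hr : 0 < r) :
    0 ≤ r ^ 2 * deriv g r := by
  by_contra! hneg
  obtain ⟨c, hc⟩ : ∃ c, c = -(r ^ 2 * deriv g r) := ⟨_, rfl⟩
  have hc0 : 0 < c := by linarith
  have hder : ∀ t ∈ Ioi (0 : ℝ),
      HasDerivAt (fun t => g t - c * t⁻¹) (deriv g t - c * (-(t ^ 2)⁻¹)) t := fun t ht =>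
    (hd t ht).hasDerivAt.sub ((hasDerivAt_inv (ne_of_gt ht)).const_mul c)
  have hanti : AntitoneOn (fun t => g t - c * t⁻¹) (Ioc 0 r) := by
    refine antitoneOn_of_hasDerivWithinAt_nonpos (convex_Ioc _ _)
      (fun t ht => (hder t ht.1).continuousAt.continuousWithinAt)
      (fun t ht => (hder t (interior_subset ht).1).hasDerivWithinAt) ?_
    intro t ht
    have ht := interior_subset ht
    have ht0 : (0 : ℝ) < t := ht.1
    have h1 : t ^ 2 * deriv g t ≤ -c := by
      have := hu ht.1 hr ht.2
      simp only at this
      linarith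
    have h2 : deriv g t - c * (-(t ^ 2)⁻¹) = (t ^ 2 * deriv g t + c) / t ^ 2 := by
      field_simp
      ring
    rw [h2]
    exact div_nonpos_of_nonpos_of_nonneg (by linarith) (by positivity)
  have hq : 0 ≤ q := (hg r hr).1.trans (hg r hr).2
  have hD : 0 < q + c * r⁻¹ + 1 := by positivity
  have hs0 : 0 < c / (q + c * r⁻¹ + 1) := by positivity
  have hsr : c / (q + c * r⁻¹ + 1) ≤ r := by
    rw [div_le_iff₀ hD]
    have : r * (q + c * r⁻¹ + 1) = c + r * (q + 1) := by
      field_simp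
      ring
    rw [this]
    have : 0 ≤ r * (q + 1) := by positivity
    linarith
  have h := hanti ⟨hs0, hsr⟩ ⟨hr, le_rfl⟩ hsr
  have hval : c * (c / (q + c * r⁻¹ + 1))⁻¹ = q + c * r⁻¹ + 1 := by
    rw [inv_div, mul_div_cancel₀ _ hc0.ne']
  simp only [hval] at h
  linarith [(hg _ hs0).2, (hg r hr).1]

/-- qualitative properties of the minimizing solution:
`a > 0`, `0 < f < π - ω`, `0 < g < q` on `(0,∞)`, and `f`, `g` are strictly
increasing there. -/
theorem solution_properties
    (κ ω q : ℝ) (hκ : 0 < κ) (hω : ω ∈ Set.Ioo (Real.pi / 2) Real.pi)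
    (hq0 : 0 < q) (hq1 : q < (Real.sqrt 2 / Real.pi) * (Real.pi - ω))
    (hq2 : q < (1 / Real.sqrt 2) * Real.sin ω)
    (a f g : ℝ → ℝ) (hafg : Constrained κ ω q a f g)
    (hmin : ∀ a₁ f₁ g₁ : ℝ → ℝ, Constrained κ ω q a₁ f₁ g₁ →
      actionL κ a f g ≤ actionL κ a₁ f₁ g₁)
    (hC2a : ContDiffOn ℝ 2 a (Set.Ioi 0)) (hC2f : ContDiffOn ℝ 2 f (Set.Ioi 0))
    (hC2g : ContDiffOn ℝ 2 g (Set.Ioi 0))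
    (heqs : DyonEqs κ a f g)
    (ha : ∀ r ∈ Set.Ioi (0 : ℝ), 0 ≤ a r)
    (hf : ∀ r ∈ Set.Ioi (0 : ℝ), 0 ≤ f r ∧ f r ≤ Real.pi / 2)
    (hg : ∀ r ∈ Set.Ioi (0 : ℝ), 0 ≤ g r ∧ g r ≤ q) :
    (∀ r ∈ Set.Ioi (0 : ℝ),
      0 < a r ∧ 0 < f r ∧ f r < Real.pi - ω ∧ 0 < g r ∧ g r < q) ∧
    StrictMonoOn f (Set.Ioi 0) ∧ StrictMonoOn g (Set.Ioi 0) := by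
  obtain ⟨hadm, -⟩ := hafg
  have hda : ContinuousOn a (Ioi 0) := hC2a.continuousOn
  have hdf : ContinuousOn f (Ioi 0) := hC2f.continuousOn
  have hdg : ContinuousOn g (Ioi 0) := hC2g.continuousOn
  have hf' : ContinuousOn (deriv f) (Ioi 0) :=
    hC2f.continuousOn_deriv_of_isOpen isOpen_Ioi (by norm_num)
  have hid : ContinuousOn (fun r : ℝ => r ^ 2) (Ioi 0) := by fun_prop
  have hid0 : ∀ r ∈ Ioi (0 : ℝ), r ^ 2 ≠ 0 := fun r hr => pow_ne_zero 2 (ne_of_gt hr)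
  have hsin : ContinuousOn (fun r => Real.sin (f r)) (Ioi 0) :=
    Real.continuous_sin.comp_continuousOn hdf
  have hcos : ContinuousOn (fun r => Real.cos (f r)) (Ioi 0) :=
    Real.continuous_cos.comp_continuousOn hdf
  have hsinc : ContinuousOn (fun r => Real.sinc (f r)) (Ioi 0) :=
    Real.continuous_sinc.comp_continuousOn hdf
  have hapos : ∀ r ∈ Ioi (0 : ℝ), 0 < a r := by
    intro r hr
    refine (ha r hr).lt_of_ne' fun h0 => ?_
    have hzero : ∀ s ∈ Ioi (0 : ℝ), a s = 0 := fun s hs =>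
      eq_zero_of_linear_system (x := a) (y := deriv a) (p := fun _ => 1)
        (m := fun r => (a r ^ 2 - 1) / r ^ 2 + (1 / 4) * Real.sin (f r) ^ 2
          + κ * Real.sin (f r) ^ 2 * deriv f r ^ 2
          + κ * a r ^ 2 * Real.sin (f r) ^ 4 / r ^ 2 - g r ^ 2 / 2)
        continuousOn_const (by fun_prop (disch := assumption))
        (fun t ht => by simpa using (heqs t ht).1.hasDerivAt)
        (fun t ht => (heqs t ht).2.2.2.1.congr_deriv (by ring)) hr h0
        (deriv_eq_zero_of_nonneg_of_eq_zero ha hr h0) hs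
    have hlim : Tendsto a (nhdsWithin 0 (Ioi 0)) (nhds 1) := by
      have := (hadm.locAC_a.1 0 self_mem_Ici).mono_left (nhdsWithin_mono 0 Ioi_subset_Ici_self)
      rwa [hadm.a_zero] at this
    have hlim0 : Tendsto a (nhdsWithin 0 (Ioi 0)) (nhds 0) :=
      tendsto_const_nhds.congr' (by
        filter_upwards [self_mem_nhdsWithin] with s hs
        exact (hzero s hs).symm)
    exact one_ne_zero (tendsto_nhds_unique hlim hlim0)
  have hgpos : ∀ r ∈ Ioi (0 : ℝ), 0 < g r := by
    intro r hr
    refine (hg r hr).1.lt_of_ne' fun h0 => ?_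
    have hzero : ∀ s ∈ Ioi (0 : ℝ), g s = 0 := fun s hs =>
      eq_zero_of_linear_system (x := g) (y := fun r => r ^ 2 * deriv g r)
        (p := fun r => (r ^ 2)⁻¹) (m := fun r => 2 * a r ^ 2)
        (hid.inv₀ hid0) (by fun_prop)
        (fun t ht => (heqs t ht).2.2.1.hasDerivAt.congr_deriv
          (inv_mul_cancel_left₀ (hid0 t ht) _).symm)
        (fun t ht => (heqs t ht).2.2.2.2.2) hr h0
        (by simp [deriv_eq_zero_of_nonneg_of_eq_zero (fun t ht => (hg t ht).1) hr h0]) hs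
    have hlim0 : Tendsto g atTop (nhds 0) :=
      tendsto_const_nhds.congr' (by
        filter_upwards [eventually_gt_atTop 0] with s hs
        exact (hzero s hs).symm)
    exact hq0.ne' (tendsto_nhds_unique hadm.g_infty hlim0)
  have hgu : StrictMonoOn (fun r => r ^ 2 * deriv g r) (Ioi 0) :=
    strictMonoOn_Ioi_of_hasDerivAt_pos (fun r hr => (heqs r hr).2.2.2.2.2) fun r hr => by
      have := hapos r hr
      have := hgpos r hr
      positivity
  have hgmono : StrictMonoOn g (Ioi 0) :=
    strictMonoOn_Ioi_of_hasDerivAt_pos (fun r hr => (heqs r hr).2.2.1.hasDerivAt) fun r hr =>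
      pos_of_mul_pos_right (hgu.pos_of_nonneg (fun t ht => sq_mul_deriv_nonneg_of_bounded
        (fun s hs => (heqs s hs).2.2.1) hg hgu.monotoneOn ht) hr) (sq_nonneg r)
  obtain ⟨P, hPdef⟩ : ∃ P : ℝ → ℝ, P = fun r => 8 * κ * (a r ^ 2 * Real.sin (f r) ^ 2) + r ^ 2 :=
    ⟨_, rfl⟩
  obtain ⟨w, hwdef⟩ : ∃ w : ℝ → ℝ, w = fun r => 2 * a r ^ 2 + 8 * κ * a r ^ 2 * deriv f r ^ 2
      + 8 * κ * a r ^ 4 * Real.sin (f r) ^ 2 / r ^ 2 := ⟨_, rfl⟩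
  have hPpos : ∀ r ∈ Ioi (0 : ℝ), 0 < P r := by
    intro r hr
    have hr' : (0 : ℝ) < r := hr
    simp only [hPdef]
    positivity
  have hwpos : ∀ r ∈ Ioi (0 : ℝ), 0 < w r := by
    intro r hr
    have hr' : (0 : ℝ) < r := hr
    have := hapos r hr
    simp only [hwdef]
    positivity
  have hu' : ∀ r ∈ Ioi (0 : ℝ), HasDerivAt (fun r => P r * deriv f r)
      (Real.sin (f r) * Real.cos (f r) * w r) r := by
    intro r hr
    have h := (heqs r hr).2.2.2.2.1
    convert h using 1
    · funext ρ
      simp only [hPdef]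
      ring
    · simp only [hwdef]
      ring
  have hfu_nonneg : ∀ r ∈ Ioi (0 : ℝ), 0 ≤ P r * deriv f r := fun r hr =>
    weighted_deriv_nonneg_of_zero hPpos hadm.locAC_f.1 hadm.f_zero (fun t ht => (hf t ht).1)
      (monotoneOn_Ioi_of_hasDerivAt_nonneg hu' fun t ht =>
        mul_nonneg (mul_nonneg
          (Real.sin_nonneg_of_nonneg_of_le_pi (hf t ht).1 (by linarith [(hf t ht).2, Real.pi_pos]))
          (Real.cos_nonneg_of_neg_pi_div_two_le_of_le
            (by linarith [(hf t ht).1, Real.pi_pos]) (hf t ht).2)) (hwpos t ht).le) hr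
  have hfmono : MonotoneOn f (Ioi 0) :=
    monotoneOn_Ioi_of_hasDerivAt_nonneg (fun r hr => (heqs r hr).2.1.hasDerivAt) fun r hr =>
      nonneg_of_mul_nonneg_right (hfu_nonneg r hr) (hPpos r hr)
  have hflt : ∀ r ∈ Ioi (0 : ℝ), f r < Real.pi / 2 := fun r hr =>
    (hfmono.le_of_tendsto_atTop hadm.f_infty hr).trans_lt (by linarith [hω.1])
  have hfpos : ∀ r ∈ Ioi (0 : ℝ), 0 < f r := by
    intro r hr
    refine (hf r hr).1.lt_of_ne' fun h0 => ?_
    have hzero : ∀ s ∈ Ioi (0 : ℝ), f s = 0 := fun s hs =>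
      eq_zero_of_linear_system (x := f) (y := fun r => P r * deriv f r)
        (p := fun r => (P r)⁻¹) (m := fun r => Real.sinc (f r) * Real.cos (f r) * w r)
        (ContinuousOn.inv₀ (by rw [hPdef]; fun_prop) fun t ht => (hPpos t ht).ne')
        (by rw [hwdef]; fun_prop (disch := assumption))
        (fun t ht => (heqs t ht).2.1.hasDerivAt.congr_deriv
          (inv_mul_cancel_left₀ (hPpos t ht).ne' _).symm)
        (fun t ht => (hu' t ht).congr_deriv (by
          rcases eq_or_ne (f t) 0 with h | h
          · simp [h]
          · rw [Real.sinc_of_ne_zero h]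
            field_simp)) hr h0
        (by simp [deriv_eq_zero_of_nonneg_of_eq_zero (fun t ht => (hf t ht).1) hr h0]) hs
    have hlim0 : Tendsto f atTop (nhds 0) :=
      tendsto_const_nhds.congr' (by
        filter_upwards [eventually_gt_atTop 0] with s hs
        exact (hzero s hs).symm)
    linarith [tendsto_nhds_unique hadm.f_infty hlim0, hω.2]
  have hfu : StrictMonoOn (fun r => P r * deriv f r) (Ioi 0) :=
    strictMonoOn_Ioi_of_hasDerivAt_pos hu' fun r hr =>
      mul_pos (mul_pos
        (Real.sin_pos_of_pos_of_lt_pi (hfpos r hr) (by linarith [hflt r hr, Real.pi_pos]))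
        (Real.cos_pos_of_mem_Ioo
          ⟨by linarith [hfpos r hr, Real.pi_pos], hflt r hr⟩)) (hwpos r hr)
  have hfstrict : StrictMonoOn f (Ioi 0) :=
    strictMonoOn_Ioi_of_hasDerivAt_pos (fun r hr => (heqs r hr).2.1.hasDerivAt) fun r hr =>
      pos_of_mul_pos_right (hfu.pos_of_nonneg hfu_nonneg hr) (hPpos r hr).le
  exact ⟨fun r hr => ⟨hapos r hr, hfpos r hr, hfstrict.lt_of_tendsto_atTop hadm.f_infty hr,
    hgpos r hr, hgmono.lt_of_tendsto_atTop hadm.g_infty hr⟩, hfstrict, hgmono⟩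
end
end

section
/- Let ω ∈ (π/2, π) and 0 < q < (1/√2)·sin ω, and set γ = (1/2)·√(sin² ω − 2q²) > 0. Let a, f, g be functions on (0,∞) with a twice differentiable satisfying the equation a'' = a(a² − 1)/r² + (1/4) a sin² f + κ a sin² f (f')² + κ a³ sin⁴ f / r² − a g²/2 on (0,∞), with a(r) > 0 for all r > 0, lim_{r→∞} a(r) = 0, 0 ≤ f(r) ≤ π − ω with lim_{r→∞} f(r) = π − ω, and 0 ≤ g(r) ≤ q. Then for every ε ∈ (0,1) there exist constants C_ε > 0 and r_ε > 0 such that a(r) ≤ C_ε · e^{−γ(1−ε) r} for all r ≥ r_ε. -/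
open Real MeasureTheory Set Filter

theorem le_add_of_deriv_ge {u u' : ℝ → ℝ} {R c : ℝ}
    (hu : ∀ r ≥ R, HasDerivAt u (u' r) r) (hc : ∀ r ≥ R, c ≤ u' r) {s : ℝ} (hs : R ≤ s) :
    u R + c * (s - R) ≤ u s := by
  have hd : ∀ r ≥ R, HasDerivAt (fun x => u x - c * x) (u' r - c) r := fun r hr => by
    simpa using (hu r hr).fun_sub ((hasDerivAt_id r).const_mul c)
  have hm : MonotoneOn (fun x => u x - c * x) (Ici R) :=
    monotoneOn_of_hasDerivWithinAt_nonneg (f' := fun x => u' x - c) (convex_Ici R)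
      (fun r hr => (hd r hr).continuousAt.continuousWithinAt)
      (fun r hr => (hd r (interior_subset hr)).hasDerivWithinAt)
      (fun r hr => sub_nonneg.2 (hc r (interior_subset hr)))
  have := hm self_mem_Ici hs hs
  simp only at this
  linarith

theorem hasDerivAt_mul_exp_mul {u : ℝ → ℝ} {d r : ℝ} (hu : HasDerivAt u d r) (m : ℝ) :
    HasDerivAt (fun x => u x * exp (m * x)) ((d + m * u r) * exp (m * r)) r := by
  have he : HasDerivAt (fun x => exp (m * x)) (exp (m * r) * m) r := by
    simpa using ((hasDerivAt_id r).const_mul m).exp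
  exact (hu.fun_mul he).congr_deriv (by ring)

/-- A positive solution of `a'' ≥ m² a` that vanishes at infinity satisfies `a' ≤ -m a`. -/
theorem deriv_add_mul_nonpos_of_tendsto_zero {a a' a'' : ℝ → ℝ} {m R : ℝ} (hm : 0 < m)
    (ha : ∀ r ≥ R, HasDerivAt a (a' r) r) (ha' : ∀ r ≥ R, HasDerivAt a' (a'' r) r)
    (hineq : ∀ r ≥ R, m ^ 2 * a r ≤ a'' r) (hpos : ∀ r ≥ R, 0 < a r)
    (hlim : Tendsto a atTop (nhds 0)) {r : ℝ} (hr : R ≤ r) : a' r + m * a r ≤ 0 := by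
  by_contra! hw
  set c := a' r + m * a r with hc
  have hlow : ∀ s ≥ r, c ≤ a' s + m * a s := by
    intro s hs
    have h := le_add_of_deriv_ge (R := r) (c := 0)
      (fun x hx => hasDerivAt_mul_exp_mul ((ha' x (hr.trans hx)).fun_add
        ((ha x (hr.trans hx)).const_mul m)) (-m))
      (fun x hx => mul_nonneg (by
        have := hineq x (hr.trans hx)
        linarith) (exp_pos _).le) hs
    simp only [zero_mul, add_zero, ← hc] at h
    have he : exp (-m * s) ≤ exp (-m * r) := exp_le_exp.2 (by nlinarith)
    exact le_of_mul_le_mul_right ((mul_le_mul_of_nonneg_left he hw.le).trans h) (exp_pos _)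
  obtain ⟨S, hS⟩ := eventually_atTop.1
    (hlim.eventually (gt_mem_nhds (show 0 < c / (2 * m) by positivity)))
  have hT : ∀ s ≥ max S r, c / 2 ≤ a' s := by
    intro s hs
    have h1 := hlow s ((le_max_right _ _).trans hs)
    have h2 := hS s ((le_max_left _ _).trans hs)
    rw [lt_div_iff₀ (by positivity)] at h2
    linarith
  have hle : max S r ≤ max S r + 1 / m := le_add_of_nonneg_right (by positivity)
  have hgrow := le_add_of_deriv_ge
    (fun s hs => ha s (hr.trans ((le_max_right _ _).trans hs))) hT hle
  have hsmall := hS _ ((le_max_left S r).trans hle)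
  have hp := hpos _ (hr.trans (le_max_right S r))
  have : c / 2 * (max S r + 1 / m - max S r) = c / (2 * m) := by field_simp; ring
  linarith

theorem le_mul_exp_neg_of_tendsto_zero {a a' a'' : ℝ → ℝ} {m R : ℝ} (hm : 0 < m)
    (ha : ∀ r ≥ R, HasDerivAt a (a' r) r) (ha' : ∀ r ≥ R, HasDerivAt a' (a'' r) r)
    (hineq : ∀ r ≥ R, m ^ 2 * a r ≤ a'' r) (hpos : ∀ r ≥ R, 0 < a r)
    (hlim : Tendsto a atTop (nhds 0)) {r : ℝ} (hr : R ≤ r) :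
    a r ≤ a R * exp (m * R) * exp (-m * r) := by
  have h := le_add_of_deriv_ge (c := 0) (fun x hx => (hasDerivAt_mul_exp_mul (ha x hx) m).fun_neg)
    (fun x hx => neg_nonneg.2 (mul_nonpos_of_nonpos_of_nonneg
      (deriv_add_mul_nonpos_of_tendsto_zero hm ha ha' hineq hpos hlim hx) (exp_pos _).le)) hr
  simp only [zero_mul, add_zero, neg_le_neg_iff] at h
  rwa [neg_mul, exp_neg, ← div_eq_mul_inv, le_div_iff₀ (exp_pos _)]

/-- exponential decay of the gauge profile `a`: with
`γ = (1/2)√(sin²ω - 2q²) > 0`, for every `ε ∈ (0,1)` one has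
`a(r) ≤ C_ε e^{-γ(1-ε) r}` for all large `r`. -/
theorem gauge_profile_exponential_decay
    (κ ω q γ : ℝ) (hκ : 0 < κ) (hω : ω ∈ Set.Ioo (Real.pi / 2) Real.pi)
    (hq0 : 0 < q) (hq1 : q < (1 / Real.sqrt 2) * Real.sin ω)
    (hγ : γ = (1 / 2) * Real.sqrt (Real.sin ω ^ 2 - 2 * q ^ 2))
    (a f g : ℝ → ℝ)
    (hadiff : ∀ r ∈ Set.Ioi (0 : ℝ), DifferentiableAt ℝ a r)
    (heq : ∀ r ∈ Set.Ioi (0 : ℝ),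
      HasDerivAt (deriv a)
        (a r * ((a r) ^ 2 - 1) / r ^ 2 + (1 / 4) * a r * Real.sin (f r) ^ 2
          + κ * a r * Real.sin (f r) ^ 2 * (deriv f r) ^ 2
          + κ * (a r) ^ 3 * Real.sin (f r) ^ 4 / r ^ 2
          - a r * (g r) ^ 2 / 2) r)
    (hapos : ∀ r ∈ Set.Ioi (0 : ℝ), 0 < a r)
    (hainf : Filter.Tendsto a Filter.atTop (nhds 0))
    (hf : ∀ r ∈ Set.Ioi (0 : ℝ), 0 ≤ f r ∧ f r ≤ Real.pi - ω)
    (hfinf : Filter.Tendsto f Filter.atTop (nhds (Real.pi - ω)))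
    (hg : ∀ r ∈ Set.Ioi (0 : ℝ), 0 ≤ g r ∧ g r ≤ q) :
    0 < γ ∧
    ∀ ε ∈ Set.Ioo (0 : ℝ) 1, ∃ C > (0 : ℝ), ∃ R > (0 : ℝ),
      ∀ r ≥ R, a r ≤ C * Real.exp (-γ * (1 - ε) * r) := by
  have hsin : 0 < sin ω := sin_pos_of_pos_of_lt_pi (by linarith [hω.1, pi_pos]) hω.2
  have hrad : 0 < sin ω ^ 2 - 2 * q ^ 2 := by
    have h2 : (0 : ℝ) < √2 := by positivity
    have hq : √2 * q < sin ω := by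
      rwa [one_div_mul_eq_div, lt_div_iff₀' h2] at hq1
    have := pow_lt_pow_left₀ hq (by positivity) two_ne_zero
    rw [mul_pow, sq_sqrt zero_le_two] at this
    linarith
  have hγpos : 0 < γ := by rw [hγ]; positivity
  have hγsq : γ ^ 2 = sin ω ^ 2 / 4 - q ^ 2 / 2 := by
    rw [hγ, mul_pow, sq_sqrt hrad.le]
    ring
  refine ⟨hγpos, fun ε hε => ?_⟩
  have hmpos : 0 < γ * (1 - ε) := mul_pos hγpos (by linarith [hε.2])
  have hmlt : (γ * (1 - ε)) ^ 2 < γ ^ 2 :=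
    pow_lt_pow_left₀ (by nlinarith [hε.1]) hmpos.le two_ne_zero
  have hcoef : Tendsto (fun r => -(1 / r ^ 2) + sin (f r) ^ 2 / 4 - q ^ 2 / 2) atTop
      (nhds (γ ^ 2)) := by
    have h1 : Tendsto (fun r : ℝ => 1 / r ^ 2) atTop (nhds 0) :=
      tendsto_const_nhds.div_atTop (tendsto_pow_atTop two_ne_zero)
    have h2 : Tendsto (fun r => sin (f r)) atTop (nhds (sin ω)) := by
      rw [← sin_pi_sub]
      exact (continuous_sin.tendsto _).comp hfinf
    have h3 := (h1.neg.add ((h2.pow 2).div_const 4)).sub_const (q ^ 2 / 2)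
    rw [hγsq]
    simpa using h3
  obtain ⟨S, hS⟩ := eventually_atTop.1 (hcoef.eventually (lt_mem_nhds hmlt))
  have hR : 0 < max S 1 := lt_max_of_lt_right one_pos
  refine ⟨a (max S 1) * exp (γ * (1 - ε) * max S 1), mul_pos (hapos _ hR) (exp_pos _),
    max S 1, hR, fun r hr => ?_⟩
  rw [neg_mul]
  refine le_mul_exp_neg_of_tendsto_zero hmpos
    (fun x hx => (hadiff x (hR.trans_le hx)).hasDerivAt) (fun x hx => heq x (hR.trans_le hx))
    (fun x hx => ?_) (fun x hx => hapos x (hR.trans_le hx)) hainf hr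
  have hx0 : 0 < x := hR.trans_le hx
  have ha := hapos x hx0
  have hg2 : g x ^ 2 ≤ q ^ 2 := pow_le_pow_left₀ (hg x hx0).1 (hg x hx0).2 2
  have hmain := mul_le_mul_of_nonneg_right (hS x ((le_max_left _ _).trans hx)).le ha.le
  have hgq := mul_le_mul_of_nonneg_left hg2 ha.le
  have hcube : 0 ≤ a x ^ 3 / x ^ 2 := by positivity
  have hkin : 0 ≤ κ * a x * sin (f x) ^ 2 * deriv f x ^ 2 := by positivity
  have hquart : 0 ≤ κ * a x ^ 3 * sin (f x) ^ 4 / x ^ 2 := by positivity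
  have hsplit : a x * (a x ^ 2 - 1) / x ^ 2 = a x ^ 3 / x ^ 2 - 1 / x ^ 2 * a x := by ring
  rw [hsplit]
  linarith
end

section
/- Let κ > 0, δ > 0, M ≥ 0, and let a, f be functions on [0, δ], with f locally absolutely continuous, f(0) = 0, 0 ≤ f(r) ≤ π/2 for r ∈ [0, δ], a(r) ≥ 1/2 for r ∈ [0, δ], and ∫₀^δ a(ρ)² sin²(f(ρ)) f'(ρ)² dρ ≤ M. Then sin²(f(r)) ≤ 4 r^{1/2} M^{1/2} for all r ∈ [0, δ], and consequently 0 ≤ f(r) ≤ π M^{1/4} r^{1/4} for all r ∈ [0, δ]. -/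
open Real MeasureTheory Set Filter

/-- A function whose increments are dominated by those of an absolutely continuous function is
absolutely continuous. -/
theorem AbsolutelyContinuousOnInterval.of_dist_le {X Y : Type*} [PseudoMetricSpace X]
    [PseudoMetricSpace Y] {g : ℝ → X} {h : ℝ → Y} {a b : ℝ}
    (hg : AbsolutelyContinuousOnInterval g a b)
    (hdist : ∀ x ∈ uIcc a b, ∀ y ∈ uIcc a b, dist (h x) (h y) ≤ dist (g x) (g y)) :
    AbsolutelyContinuousOnInterval h a b := by
  rw [absolutelyContinuousOnInterval_iff] at hg ⊢
  intro ε hε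
  obtain ⟨η, hη, H⟩ := hg ε hε
  refine ⟨η, hη, fun E hE hlen ↦ (Finset.sum_le_sum fun i hi ↦ ?_).trans_lt (H E hE hlen)⟩
  exact hdist _ (hE.1 i hi).1 _ (hE.1 i hi).2

/-- An absolutely continuous function satisfies `cos f(a) - cos f(b) = ∫ sin f f'`. -/
theorem AbsolutelyContinuousOnInterval.integral_sin_mul_deriv {f : ℝ → ℝ} {a b : ℝ}
    (hf : AbsolutelyContinuousOnInterval f a b) :
    IntervalIntegrable (fun x ↦ Real.sin (f x) * deriv f x) volume a b ∧
      ∫ x in a..b, Real.sin (f x) * deriv f x = Real.cos (f a) - Real.cos (f b) := by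
  have hcos : AbsolutelyContinuousOnInterval (fun x ↦ Real.cos (f x)) a b :=
    hf.of_dist_le fun x _ y _ ↦ by
      simpa using Real.lipschitzWith_cos.dist_le_mul (f x) (f y)
  have hae : ∀ᵐ x, x ∈ uIoc a b →
      -deriv (fun x ↦ Real.cos (f x)) x = Real.sin (f x) * deriv f x := by
    filter_upwards [hf.ae_differentiableAt] with x hx hmem
    have hd := (hx (uIoc_subset_uIcc hmem)).hasDerivAt.cos.deriv
    rw [hd]
    ring
  constructor
  · exact hcos.intervalIntegrable_deriv.neg.congr_ae
      ((ae_restrict_iff' measurableSet_uIoc).2 hae)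
  · rw [← intervalIntegral.integral_congr_ae hae, intervalIntegral.integral_neg,
      hcos.integral_deriv_eq_sub]
    ring

/-- If `u² ≤ F` then `(∫ u)² ≤ (∫ F) (b - a)`. -/
theorem intervalIntegral.sq_integral_le_of_sq_le {u F : ℝ → ℝ} {a b : ℝ} (hab : a ≤ b)
    (hu : IntervalIntegrable u volume a b) (hF : IntervalIntegrable F volume a b)
    (h : ∀ x ∈ Icc a b, u x ^ 2 ≤ F x) :
    (∫ x in a..b, u x) ^ 2 ≤ (b - a) * ∫ x in a..b, F x := by
  have key : ∀ s : ℝ, 0 ≤ (b - a) * (s * s) + (-2 * ∫ x in a..b, u x) * s + ∫ x in a..b, F x := by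
    intro s
    have hmono := intervalIntegral.integral_mono_on hab (hu.const_mul (2 * s))
      ((intervalIntegrable_const (c := s ^ 2)).add hF) fun x hx ↦ by
        nlinarith [h x hx, sq_nonneg (s - u x)]
    rw [intervalIntegral.integral_add intervalIntegrable_const hF,
      intervalIntegral.integral_const_mul, intervalIntegral.integral_const, smul_eq_mul] at hmono
    linarith
  have := discrim_le_zero key
  rw [discrim] at this
  linarith



/-- the uniform estimate near `r = 0`:
`sin²(f(r)) ≤ 4 √r √M`, hence `0 ≤ f(r) ≤ π M^{1/4} r^{1/4}` on `[0,δ]`. -/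
theorem profile_estimate_near_zero
    (κ δ M : ℝ) (hκ : 0 < κ) (hδ : 0 < δ) (hM : 0 ≤ M) (a f : ℝ → ℝ)
    (hAC : ∀ s t : ℝ, 0 ≤ s → s ≤ t → t ≤ δ →
      IntervalIntegrable (deriv f) MeasureTheory.volume s t ∧
      f t - f s = ∫ r in s..t, deriv f r)
    (hf0 : f 0 = 0)
    (hf : ∀ r ∈ Set.Icc (0 : ℝ) δ, 0 ≤ f r ∧ f r ≤ Real.pi / 2)
    (ha : ∀ r ∈ Set.Icc (0 : ℝ) δ, 1 / 2 ≤ a r)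
    (hii : IntervalIntegrable
      (fun ρ => (a ρ) ^ 2 * Real.sin (f ρ) ^ 2 * (deriv f ρ) ^ 2)
      MeasureTheory.volume 0 δ)
    (hbound : ∫ ρ in (0 : ℝ)..δ, (a ρ) ^ 2 * Real.sin (f ρ) ^ 2 * (deriv f ρ) ^ 2 ≤ M) :
    ∀ r ∈ Set.Icc (0 : ℝ) δ,
      Real.sin (f r) ^ 2 ≤ 4 * Real.sqrt r * Real.sqrt M ∧
      0 ≤ f r ∧ f r ≤ Real.pi * M ^ ((1 : ℝ) / 4) * r ^ ((1 : ℝ) / 4) := by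
  rintro r ⟨hr0, hrδ⟩
  set E : ℝ → ℝ := fun ρ ↦ a ρ ^ 2 * Real.sin (f ρ) ^ 2 * deriv f ρ ^ 2 with hE
  obtain ⟨hfr0, hfr⟩ := hf r ⟨hr0, hrδ⟩
  have hac : AbsolutelyContinuousOnInterval f 0 r := by
    have hg := (hAC 0 r le_rfl hr0 hrδ).1.absolutelyContinuousOnInterval_intervalIntegral
      (c := 0) (by simp)
    refine hg.of_dist_le fun x hx y hy ↦ le_of_eq ?_
    rw [uIcc_of_le hr0] at hx hy
    rw [← (hAC 0 x le_rfl hx.1 (hx.2.trans hrδ)).2, ← (hAC 0 y le_rfl hy.1 (hy.2.trans hrδ)).2]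
    simp [hf0]
  obtain ⟨hint, hFTC⟩ := hac.integral_sin_mul_deriv
  have hEr : IntervalIntegrable E volume 0 r := hii.mono_set (by
    rw [uIcc_of_le hr0, uIcc_of_le hδ.le]
    exact Icc_subset_Icc_right hrδ)
  have hEM : ∫ ρ in (0 : ℝ)..r, E ρ ≤ M :=
    (intervalIntegral.integral_mono_interval le_rfl hr0 hrδ
      (Eventually.of_forall fun ρ ↦ by simp only [hE, Pi.zero_apply]; positivity) hii).trans hbound
  have hCS := intervalIntegral.sq_integral_le_of_sq_le hr0 hint (hEr.const_mul 4) fun ρ hρ ↦ by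
    have h1 : 1 ≤ 4 * a ρ ^ 2 := by nlinarith [ha ρ ⟨hρ.1, hρ.2.trans hrδ⟩]
    have h2 := mul_le_mul_of_nonneg_right h1 (sq_nonneg (Real.sin (f ρ) * deriv f ρ))
    simp only [hE]
    linarith
  rw [hFTC, hf0, Real.cos_zero, intervalIntegral.integral_const_mul, sub_zero] at hCS
  have hcos : 1 - Real.cos (f r) ≤ 2 * Real.sqrt r * Real.sqrt M := by
    refine le_of_sq_le_sq ?_ (by positivity)
    rw [mul_pow, mul_pow, Real.sq_sqrt hr0, Real.sq_sqrt hM]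
    nlinarith [mul_le_mul_of_nonneg_left hEM hr0]
  have hsin : Real.sin (f r) ^ 2 ≤ 4 * Real.sqrt r * Real.sqrt M := by
    nlinarith [Real.sin_sq_add_cos_sq (f r), sq_nonneg (1 - Real.cos (f r))]
  refine ⟨hsin, hfr0, ?_⟩
  have hquarter : ∀ x : ℝ, 0 ≤ x → (x ^ ((1 : ℝ) / 4)) ^ 2 = Real.sqrt x := fun x hx ↦ by
    rw [← Real.rpow_natCast, ← Real.rpow_mul hx, Real.sqrt_eq_rpow]
    norm_num
  have hsin' : Real.sin (f r) ≤ 2 * M ^ ((1 : ℝ) / 4) * r ^ ((1 : ℝ) / 4) := by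
    refine le_of_sq_le_sq ?_ (by positivity)
    rw [mul_pow, mul_pow, hquarter M hM, hquarter r hr0]
    linarith
  have hjordan := (Real.mul_le_sin hfr0 hfr).trans hsin'
  rw [div_mul_eq_mul_div, div_le_iff₀ Real.pi_pos] at hjordan
  linarith
end

section
/- Let q > 0, γ ∈ (0, 1), δ > 0. Let a, g be continuous functions on [0, δ] with g twice differentiable on (0, δ) satisfying (r² g')' = 2 a² g on (0, δ), and suppose 2 a(r)² ≥ 2 − γ for all r ∈ [0, δ], 0 ≤ g(r) ≤ q for all r ∈ [0, δ], and g(0) = 0. Then g(r) ≤ (q / δ^{1−γ}) · r^{1−γ} for all r ∈ (0, δ). -/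
open Real MeasureTheory Set Filter

/-- If `h` has derivative `h'` near `x`, and the flux `p * h'` with positive weight `p`
has positive derivative at `x`, then `h` has no local maximum at `x`. -/
theorem not_isLocalMax_of_hasDerivAt_flux_pos {h h' p : ℝ → ℝ} {x c : ℝ}
    (hh : ∀ᶠ y in nhds x, HasDerivAt h (h' y) y) (hp : ∀ᶠ y in nhds x, 0 < p y)
    (hF : HasDerivAt (fun y => p y * h' y) c x) (hc : 0 < c) : ¬ IsLocalMax h x := by
  intro hmax
  have hF0 : p x * h' x = 0 := by
    rw [hmax.hasDerivAt_eq_zero hh.self_of_nhds, mul_zero]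
  have hpos : ∀ᶠ y in nhdsWithin x (Ioi x), 0 < p y * h' y := by
    have hslope := (hasDerivAt_iff_tendsto_slope.1 hF).eventually (lt_mem_nhds hc)
    filter_upwards [nhdsWithin_mono x (fun y (hy : x < y) => hy.ne') hslope,
      self_mem_nhdsWithin] with y hy hxy
    rw [slope_def_field, hF0, sub_zero] at hy
    exact (div_pos_iff_of_pos_right (sub_pos.2 hxy)).1 hy
  have hright := hpos.and (nhdsWithin_le_nhds (hh.and (hp.and hmax)))
  obtain ⟨u, hxu, hu⟩ := mem_nhdsGT_iff_exists_Ioc_subset.1 hright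
  have hmono : StrictMonoOn h (Icc x u) := by
    refine strictMonoOn_of_hasDerivWithinAt_pos (f' := h') (convex_Icc x u) ?_ ?_ ?_
    · intro y hy
      rcases hy.1.eq_or_lt with rfl | hxy
      · exact hh.self_of_nhds.continuousAt.continuousWithinAt
      · exact (hu ⟨hxy, hy.2⟩).2.1.continuousAt.continuousWithinAt
    · intro y hy
      rw [interior_Icc] at hy
      exact (hu ⟨hy.1, hy.2.le⟩).2.1.hasDerivWithinAt
    · intro y hy
      rw [interior_Icc] at hy
      have hy' := hu ⟨hy.1, hy.2.le⟩
      exact (mul_pos_iff_of_pos_left hy'.2.2.1).1 hy'.1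
  have hlt : x < u := hxu
  exact (hmono (left_mem_Icc.2 hlt.le) (right_mem_Icc.2 hlt.le) hlt).not_ge
    (hu (right_mem_Ioc.2 hlt)).2.2.2

/-- The radial power `r ^ (1 - γ)` satisfies `(r² σ')' = (1 - γ) (2 - γ) σ`. -/
theorem hasDerivAt_sq_mul_deriv_rpow (γ : ℝ) {r : ℝ} (hr : 0 < r) :
    HasDerivAt (fun ρ => ρ ^ 2 * ((1 - γ) * ρ ^ (-γ))) ((1 - γ) * (2 - γ) * r ^ (1 - γ)) r := by
  have hd : HasDerivAt (fun ρ : ℝ => (1 - γ) * ρ ^ (2 - γ))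
      ((1 - γ) * ((2 - γ) * r ^ (2 - γ - 1))) r :=
    (hasDerivAt_rpow_const (Or.inl hr.ne')).const_mul (1 - γ)
  rw [show 2 - γ - 1 = 1 - γ by ring, ← mul_assoc] at hd
  refine hd.congr_of_eventuallyEq ?_
  filter_upwards [lt_mem_nhds hr] with ρ hρ
  rw [show 2 - γ = 2 + -γ by ring, rpow_add hρ, rpow_two]
  ring

/-- comparison (maximum principle) estimate for the electric
potential near the origin: `g(r) ≤ (q/δ^{1-γ}) r^{1-γ}` on `(0,δ)`. -/
theorem electric_potential_holder_bound
    (q γ δ : ℝ) (hq : 0 < q) (hγ : γ ∈ Set.Ioo (0 : ℝ) 1) (hδ : 0 < δ)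
    (a g : ℝ → ℝ)
    (ha : ContinuousOn a (Set.Icc 0 δ)) (hgc : ContinuousOn g (Set.Icc 0 δ))
    (hdiff : ∀ r ∈ Set.Ioo (0 : ℝ) δ, DifferentiableAt ℝ g r)
    (heq : ∀ r ∈ Set.Ioo (0 : ℝ) δ,
      HasDerivAt (fun ρ => ρ ^ 2 * deriv g ρ) (2 * (a r) ^ 2 * g r) r)
    (halb : ∀ r ∈ Set.Icc (0 : ℝ) δ, 2 - γ ≤ 2 * (a r) ^ 2)
    (hg : ∀ r ∈ Set.Icc (0 : ℝ) δ, 0 ≤ g r ∧ g r ≤ q)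
    (hg0 : g 0 = 0) :
    ∀ r ∈ Set.Ioo (0 : ℝ) δ, g r ≤ (q / δ ^ (1 - γ)) * r ^ (1 - γ) := by
  obtain ⟨hγ0, hγ1⟩ := hγ
  intro r hr
  by_contra! hlt
  set C := q / δ ^ (1 - γ)
  have hCpos : 0 < C := div_pos hq (rpow_pos_of_pos hδ _)
  have hCδ : C * δ ^ (1 - γ) = q := div_mul_cancel₀ q (rpow_pos_of_pos hδ _).ne'
  have hcont : ContinuousOn (fun ρ => g ρ - C * ρ ^ (1 - γ)) (Icc 0 δ) :=
    hgc.sub (continuousOn_const.mul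
      (continuous_rpow_const (sub_nonneg.2 hγ1.le)).continuousOn)
  obtain ⟨x, hx, hmax⟩ := isCompact_Icc.exists_isMaxOn (nonempty_Icc.2 hδ.le) hcont
  have hxpos : 0 < g x - C * x ^ (1 - γ) :=
    (sub_pos.2 hlt).trans_le (hmax (Ioo_subset_Icc_self hr))
  have hx0 : 0 < x := by
    refine hx.1.lt_of_ne ?_
    rintro rfl
    rw [hg0, zero_rpow (sub_pos.2 hγ1).ne'] at hxpos
    simp at hxpos
  have hxδ : x < δ := by
    refine hx.2.lt_of_ne ?_
    rintro rfl
    linarith [(hg x hx).2]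
  refine not_isLocalMax_of_hasDerivAt_flux_pos (p := fun ρ => ρ ^ 2)
    (h' := fun ρ => deriv g ρ - C * ((1 - γ) * ρ ^ (-γ)))
    (c := 2 * a x ^ 2 * g x - C * ((1 - γ) * (2 - γ) * x ^ (1 - γ)))
    ?_ ?_ ?_ ?_ (hmax.isLocalMax (Icc_mem_nhds hx0 hxδ))
  · filter_upwards [Ioo_mem_nhds hx0 hxδ] with y hy
    have hσ := (hasDerivAt_rpow_const (p := 1 - γ) (Or.inl hy.1.ne')).const_mul C
    rw [show 1 - γ - 1 = -γ by ring] at hσ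
    exact (hdiff y hy).hasDerivAt.sub hσ
  · filter_upwards [lt_mem_nhds hx0] with y hy using pow_pos hy 2
  · refine ((heq x ⟨hx0, hxδ⟩).sub
      ((hasDerivAt_sq_mul_deriv_rpow γ hx0).const_mul C)).congr_of_eventuallyEq ?_
    refine Eventually.of_forall fun y => ?_
    simp only [Pi.sub_apply]
    ring
  · have hσ : 0 < C * x ^ (1 - γ) := mul_pos hCpos (rpow_pos_of_pos hx0 _)
    have hbound := mul_le_mul_of_nonneg_right (halb x hx) (hg x hx).1
    have hgap := mul_pos (show 0 < 2 - γ by linarith) hxpos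
    have hextra := mul_pos (mul_pos hγ0 (show 0 < 2 - γ by linarith)) hσ
    linarith
end

section
/- Let q > 0, t ∈ ℝ, and let a, ã be real functions on (0,∞) with ã ∈ L²(0,∞). Suppose g and g_t are locally absolutely continuous on (0,∞), satisfy 0 ≤ g ≤ q and 0 ≤ g_t ≤ q, lim_{r→∞} g(r) = lim_{r→∞} g_t(r) = q, the constraint identities ∫₀^∞ (r² g' G' + 2 a² g G) dr = 0 and ∫₀^∞ (r² g_t' G' + 2 (a + t ã)² g_t G) dr = 0 hold with the choice of test function G = g_t − g (which vanishes at infinity), and the relevant integrals are finite. Then ∫₀^∞ ( r² (g_t'(r) − g'(r))² + a(r)² (g_t(r) − g(r))² ) dr ≤ 8 q² t² ∫₀^∞ ã(r)² dr, and for every r > 0 and t ≠ 0, |g_t(r) − g(r)| ≤ 2√2 · q · |t| · ‖ã‖_{L²(0,∞)} · r^{−1/2}. -/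
open Real MeasureTheory Set Filter

/-- A weighted Cauchy–Schwarz inequality: the increment of a function is controlled by its
weighted Dirichlet energy, with the decay rate `s ^ (-1/2)`. -/
theorem sq_intervalIntegral_le_weighted_energy_div {f : ℝ → ℝ} {s u : ℝ} (hs : 0 < s) (hsu : s ≤ u)
    (hf : IntervalIntegrable f volume s u)
    (hE : IntegrableOn (fun r => r ^ 2 * f r ^ 2) (Ioi 0)) :
    (∫ r in s..u, f r) ^ 2 ≤ (∫ r in Ioi (0 : ℝ), r ^ 2 * f r ^ 2) / s := by
  set E := ∫ r in Ioi (0 : ℝ), r ^ 2 * f r ^ 2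
  set D := |∫ r in s..u, f r|
  have hE0 : 0 ≤ E := setIntegral_nonneg measurableSet_Ioi fun r _ => by positivity
  rw [← sq_abs]
  change D ^ 2 ≤ E / s
  rcases (abs_nonneg (∫ r in s..u, f r)).eq_or_lt with h0 | hD
  · have : D = 0 := h0.symm
    rw [this, zero_pow two_ne_zero]
    positivity
  change 0 < D at hD
  have hsub : Ioc s u ⊆ Ioi 0 := fun r hr => hs.trans hr.1
  have hE_int : IntervalIntegrable (fun r => r ^ 2 * f r ^ 2) volume s u :=
    (intervalIntegrable_iff_integrableOn_Ioc_of_le hsu).2 (hE.mono_set hsub)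
  have hE_le : ∫ r in s..u, r ^ 2 * f r ^ 2 ≤ E := by
    rw [intervalIntegral.integral_of_le hsu]
    exact setIntegral_mono_set hE (ae_of_all _ fun r => by positivity) hsub.eventuallyLE
  have hzero : (0 : ℝ) ∉ uIcc s u := by
    rw [uIcc_of_le hsu]
    exact fun h => hs.not_ge h.1
  have hw_int : IntervalIntegrable (fun r : ℝ => r ^ (-2 : ℤ)) volume s u :=
    intervalIntegral.intervalIntegrable_zpow (Or.inr hzero)
  have hw_le : ∫ r in s..u, r ^ (-2 : ℤ) ≤ 1 / s := by
    rw [integral_zpow (Or.inr ⟨by norm_num, hzero⟩)]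
    have hu : 0 < u⁻¹ := inv_pos.2 (hs.trans_le hsu)
    norm_num
    linarith
  have hyoung : D ≤ ∫ r in s..u,
      (1 / (2 * (D * s)) * (r ^ 2 * f r ^ 2) + D * s / 2 * r ^ (-2 : ℤ)) := by
    refine (intervalIntegral.abs_integral_le_integral_abs hsu).trans ?_
    refine intervalIntegral.integral_mono_on hsu hf.abs
      ((hE_int.const_mul _).add (hw_int.const_mul _)) fun r hr => ?_
    have hr : 0 < r := hs.trans_le hr.1
    rw [← sub_nonneg]
    have hsq : 1 / (2 * (D * s)) * (r ^ 2 * f r ^ 2) + D * s / 2 * r ^ (-2 : ℤ) - |f r|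
        = (r ^ 2 * |f r| - D * s) ^ 2 / (2 * (D * s) * r ^ 2) := by
      rw [← sq_abs (f r), zpow_neg]
      norm_cast
      field_simp
      ring
    rw [hsq]
    positivity
  rw [intervalIntegral.integral_add (hE_int.const_mul _) (hw_int.const_mul _),
    intervalIntegral.integral_const_mul, intervalIntegral.integral_const_mul] at hyoung
  have hbound : D ≤ 1 / (2 * (D * s)) * E + D * s / 2 * (1 / s) := by
    refine hyoung.trans ?_
    gcongr
  have hsimp : 1 / (2 * (D * s)) * E + D * s / 2 * (1 / s) = E / s / (2 * D) + D / 2 := by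
    field_simp
  rw [hsimp] at hbound
  have hdiv : D / 2 ≤ E / s / (2 * D) := by linarith
  rw [le_div_iff₀ (by positivity)] at hdiv
  linarith

/-- The pointwise inequality behind the energy estimate, where `x` and `y` are the values of the
unperturbed and perturbed potentials and `p` and `p'` those of their derivatives. -/
theorem energy_density_le {q r t a b x y p p' : ℝ} (hx : 0 ≤ x ∧ x ≤ q) (hy : 0 ≤ y ∧ y ≤ q) :
    r ^ 2 * (p' - p) ^ 2 + a ^ 2 * (y - x) ^ 2
      ≤ (r ^ 2 * p' * (p' - p) + 2 * (a + t * b) ^ 2 * y * (y - x))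
        - (r ^ 2 * p * (p' - p) + 2 * a ^ 2 * x * (y - x)) + 8 * q ^ 2 * t ^ 2 * b ^ 2 := by
  have hy2 : y ^ 2 ≤ q ^ 2 := pow_le_pow_left₀ hy.1 hy.2 2
  have hxy : x * y ≤ q ^ 2 := by nlinarith [mul_le_mul hx.2 hy.2 hy.1 (hx.1.trans hx.2)]
  have hcoef : 0 ≤ 8 * q ^ 2 - 2 * y ^ 2 - 2 * x * y := by nlinarith [sq_nonneg q]
  nlinarith [sq_nonneg (a * (y - x) + 2 * (t * b) * y), mul_nonneg (sq_nonneg (t * b)) hcoef]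

/-- the key perturbation estimate for the constrained electric
potentials: `∫₀^∞ (r²(g_t' - g')² + a²(g_t - g)²) dr ≤ 8 q² t² ∫₀^∞ ã² dr`,
and `|g_t(r) - g(r)| ≤ 2√2 q |t| ‖ã‖_{L²} r^{-1/2}`. -/
theorem perturbation_estimate
    (q t : ℝ) (hq : 0 < q) (a atil g gt : ℝ → ℝ)
    (hatil : MeasureTheory.IntegrableOn (fun r => (atil r) ^ 2) (Set.Ioi 0))
    (hACg : ∀ s u : ℝ, 0 < s → s ≤ u →
      IntervalIntegrable (deriv g) MeasureTheory.volume s u ∧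
      g u - g s = ∫ r in s..u, deriv g r)
    (hACgt : ∀ s u : ℝ, 0 < s → s ≤ u →
      IntervalIntegrable (deriv gt) MeasureTheory.volume s u ∧
      gt u - gt s = ∫ r in s..u, deriv gt r)
    (hgb : ∀ r ∈ Set.Ioi (0 : ℝ), 0 ≤ g r ∧ g r ≤ q)
    (hgtb : ∀ r ∈ Set.Ioi (0 : ℝ), 0 ≤ gt r ∧ gt r ≤ q)
    (hginf : Filter.Tendsto g Filter.atTop (nhds q))
    (hgtinf : Filter.Tendsto gt Filter.atTop (nhds q))
    -- finiteness of the relevant integrals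
    (hfin1 : MeasureTheory.IntegrableOn
      (fun r => r ^ 2 * (deriv gt r - deriv g r) ^ 2) (Set.Ioi 0))
    (hfin2 : MeasureTheory.IntegrableOn
      (fun r => (a r) ^ 2 * (gt r - g r) ^ 2) (Set.Ioi 0))
    (hfin3 : MeasureTheory.IntegrableOn
      (fun r => r ^ 2 * deriv g r * (deriv gt r - deriv g r)
        + 2 * (a r) ^ 2 * g r * (gt r - g r)) (Set.Ioi 0))
    (hfin4 : MeasureTheory.IntegrableOn
      (fun r => r ^ 2 * deriv gt r * (deriv gt r - deriv g r)
        + 2 * (a r + t * atil r) ^ 2 * gt r * (gt r - g r)) (Set.Ioi 0))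
    -- the two constraint identities, with the test function `G = g_t - g`
    (hcon1 : ∫ r in Set.Ioi (0 : ℝ),
      (r ^ 2 * deriv g r * (deriv gt r - deriv g r)
        + 2 * (a r) ^ 2 * g r * (gt r - g r)) = 0)
    (hcon2 : ∫ r in Set.Ioi (0 : ℝ),
      (r ^ 2 * deriv gt r * (deriv gt r - deriv g r)
        + 2 * (a r + t * atil r) ^ 2 * gt r * (gt r - g r)) = 0) :
    (∫ r in Set.Ioi (0 : ℝ),
        (r ^ 2 * (deriv gt r - deriv g r) ^ 2 + (a r) ^ 2 * (gt r - g r) ^ 2))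
      ≤ 8 * q ^ 2 * t ^ 2 * ∫ r in Set.Ioi (0 : ℝ), (atil r) ^ 2 ∧
    (t ≠ 0 → ∀ r ∈ Set.Ioi (0 : ℝ),
      |gt r - g r| ≤ 2 * Real.sqrt 2 * q * |t|
        * Real.sqrt (∫ ρ in Set.Ioi (0 : ℝ), (atil ρ) ^ 2) / Real.sqrt r) := by
  set A := ∫ r in Ioi (0 : ℝ), (atil r) ^ 2
  have henergy : (∫ r in Ioi (0 : ℝ),
      (r ^ 2 * (deriv gt r - deriv g r) ^ 2 + (a r) ^ 2 * (gt r - g r) ^ 2))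
      ≤ 8 * q ^ 2 * t ^ 2 * A := by
    have hdiff := hfin4.sub hfin3
    have hA := hatil.const_mul (8 * q ^ 2 * t ^ 2)
    have hmono := setIntegral_mono_on (hfin1.add hfin2) (hdiff.add hA) measurableSet_Ioi
      fun r hr => energy_density_le (r := r) (t := t) (a := a r) (b := atil r)
        (p := deriv g r) (p' := deriv gt r) (hgb r hr) (hgtb r hr)
    refine hmono.trans_eq ?_
    refine (integral_add hdiff hA).trans ?_
    rw [integral_const_mul]
    have hzero := integral_sub hfin4 hfin3
    rw [hcon1, hcon2, sub_zero] at hzero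
    exact (congrArg (· + _) hzero).trans (zero_add _)
  refine ⟨henergy, fun _ r hr => ?_⟩
  have hr : 0 < r := hr
  have hdirichlet : (∫ ρ in Ioi (0 : ℝ), ρ ^ 2 * (deriv gt ρ - deriv g ρ) ^ 2)
      ≤ 8 * q ^ 2 * t ^ 2 * A :=
    (integral_mono hfin1 (hfin1.add hfin2) fun ρ =>
      le_add_of_nonneg_right (by positivity)).trans henergy
  have hincr : ∀ u, r ≤ u →
      ((gt u - g u) - (gt r - g r)) ^ 2 ≤ 8 * q ^ 2 * t ^ 2 * A / r := fun u hu => by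
    obtain ⟨hg_int, hg_eq⟩ := hACg r u hr hu
    obtain ⟨hgt_int, hgt_eq⟩ := hACgt r u hr hu
    have hG : (gt u - g u) - (gt r - g r) = ∫ ρ in r..u, (deriv gt ρ - deriv g ρ) := by
      rw [intervalIntegral.integral_sub hgt_int hg_int, ← hg_eq, ← hgt_eq]
      ring
    rw [hG]
    refine (sq_intervalIntegral_le_weighted_energy_div hr hu (hgt_int.sub hg_int) hfin1).trans ?_
    exact div_le_div_of_nonneg_right hdirichlet hr.le
  have hlim : Tendsto (fun u => ((gt u - g u) - (gt r - g r)) ^ 2) atTop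
      (nhds (((q - q) - (gt r - g r)) ^ 2)) :=
    ((hgtinf.sub hginf).sub_const _).pow 2
  have hsq : (gt r - g r) ^ 2 ≤ 8 * q ^ 2 * t ^ 2 * A / r := by
    have := le_of_tendsto hlim ((eventually_ge_atTop r).mono hincr)
    rwa [sub_self, zero_sub, neg_sq] at this
  have hA0 : 0 ≤ A := setIntegral_nonneg measurableSet_Ioi fun ρ _ => sq_nonneg _
  refine abs_le_of_sq_le_sq (hsq.trans_eq ?_) (by positivity)
  rw [div_pow, mul_pow, mul_pow, mul_pow, mul_pow, sq_abs, sq_sqrt hA0, sq_sqrt hr.le,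
    sq_sqrt (by norm_num)]
  ring
end
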